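/- Suppose |1−χ| = O(ε), Re < Re₀ and ε < ε₁ (the thresholds from the basic energy estimate). Then for all t ∈ [0,T]: ε⁻²‖∇φ(t)‖²_{L²} + ‖∂₁ψ(t)‖²_{L²} + ∫₀ᵗ‖∇div ψ(s)‖²_{L²}ds ≤ C(ε⁻²‖φ₀‖²_{H¹} + ‖∂₁ψ₀‖²_{L²} + A₁(0) + ε⁻²A₀(0) + ε⁻²∫₀ᵗ‖∇φ(s)‖²_{L²}ds), where C depends only on Re, Pr, μ′/μ and γ. -/

import Mathlib

noncomputable section

open MeasureTheory Real Filter Topology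

namespace Couette

/-- The periodic cell of the horizontally periodic layer `Ω = 𝕊¹ × (0,1)`. -/
def Ω : Set (ℝ × ℝ) := {x : ℝ × ℝ | x.1 ∈ Set.Ioo 0 (2 * π) ∧ x.2 ∈ Set.Ioo 0 1}

variable {F : Type*} [NormedAddCommGroup F] [NormedSpace ℝ F]

/-- Partial derivative in the horizontal direction `x₁`. -/
def d1 (f : ℝ × ℝ → F) (x : ℝ × ℝ) : F := fderiv ℝ f x (1, 0)

/-- Partial derivative in the vertical direction `x₂`. -/
def d2 (f : ℝ × ℝ → F) (x : ℝ × ℝ) : F := fderiv ℝ f x (0, 1)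

/-- Time derivative of a time-dependent field. -/
def dt (f : ℝ → ℝ × ℝ → F) (t : ℝ) (x : ℝ × ℝ) : F := deriv (fun s => f s x) t

/-- Divergence of a (two-dimensional) vector field. -/
def divv (v : ℝ × ℝ → ℝ × ℝ) (x : ℝ × ℝ) : ℝ :=
  d1 (fun y => (v y).1) x + d2 (fun y => (v y).2) x

/-- Gradient of a scalar field. -/
def grad (f : ℝ × ℝ → ℝ) (x : ℝ × ℝ) : ℝ × ℝ := (d1 f x, d2 f x)

/-- Laplacian. -/
def lap (f : ℝ × ℝ → F) (x : ℝ × ℝ) : F := d1 (d1 f) x + d2 (d2 f) x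

/-- Euclidean inner product on `ℝ²`. -/
def dot (a b : ℝ × ℝ) : ℝ := a.1 * b.1 + a.2 * b.2

/-- The contraction `𝔇(v) : 𝔇(w)` of deformation tensors, where
`𝔇(v) = (∇v + (∇v)ᵀ)/2`. -/
def defContract (v w : ℝ × ℝ → ℝ × ℝ) (x : ℝ × ℝ) : ℝ :=
  d1 (fun y => (v y).1) x * d1 (fun y => (w y).1) x
    + d2 (fun y => (v y).2) x * d2 (fun y => (w y).2) x
    + 2 * ((d1 (fun y => (v y).2) x + d2 (fun y => (v y).1) x) / 2)
        * ((d1 (fun y => (w y).2) x + d2 (fun y => (w y).1) x) / 2)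

/-- Squared `L²(Ω)` norm of the `j`-th spatial derivative. -/
def dSq (j : ℕ) (f : ℝ × ℝ → F) : ℝ := ∫ x in Ω, ‖iteratedFDeriv ℝ j f x‖ ^ 2

/-- Squared `L²(Ω)` norm. -/
def L2Sq (f : ℝ × ℝ → F) : ℝ := dSq 0 f

/-- Squared `Hᵏ(Ω)` norm. -/
def HSq (k : ℕ) (f : ℝ × ℝ → F) : ℝ := ∑ j ∈ Finset.range (k + 1), dSq j f

/-- `L∞(Ω)` (sup) norm. -/
def LinfSup (f : ℝ × ℝ → F) : ℝ := ⨆ x ∈ Ω, ‖f x‖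

/-- Membership in the Sobolev space `Hᵏ(Ω)`. -/
def MemH (k : ℕ) (f : ℝ × ℝ → F) : Prop :=
  ∀ j ≤ k, IntegrableOn (fun x => ‖iteratedFDeriv ℝ j f x‖ ^ 2) Ω

/-- Continuity in time, with values in `Hᵏ(Ω)`, on the time set `s`. -/
def ContInH (k : ℕ) (f : ℝ → ℝ × ℝ → F) (s : Set ℝ) : Prop :=
  (∀ t ∈ s, MemH k (f t)) ∧
    ∀ t₀ ∈ s, Tendsto (fun t => HSq k (fun x => f t x - f t₀ x)) (nhdsWithin t₀ s) (nhds 0)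

/-- Square integrability in time, with values in `Hᵏ(Ω)`, on the time set `s`. -/
def L2InH (k : ℕ) (f : ℝ → ℝ × ℝ → F) (s : Set ℝ) : Prop :=
  IntegrableOn (fun t => HSq k (f t)) s

/-- Temperature `𝒯̃` of the non-dimensional plane Couette flow
(here `C_p = γ/(γ-1)`, the gas constant being normalized to `R = 1`). -/
def tT (γ Pr ε χ : ℝ) (x : ℝ × ℝ) : ℝ :=
  χ + (1 - χ) * x.2 - ε ^ 2 * Pr / (2 * (γ / (γ - 1))) * (x.2 ^ 2 - x.2)

/-- Density `ρ̃ = 𝒯̃⁻¹` of the plane Couette flow. -/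
def tρ (γ Pr ε χ : ℝ) (x : ℝ × ℝ) : ℝ := (tT γ Pr ε χ x)⁻¹

/-- Velocity `ũ = (x₂, 0)` of the plane Couette flow. -/
def tu (x : ℝ × ℝ) : ℝ × ℝ := (x.2, 0)

/-- Total density `ρ = ρ̃ + φ`. -/
def pρ (γ Pr ε χ : ℝ) (φ : ℝ → ℝ × ℝ → ℝ) (t : ℝ) (x : ℝ × ℝ) : ℝ := tρ γ Pr ε χ x + φ t x

/-- Total temperature `𝒯 = 𝒯̃ + θ`. -/
def pT (γ Pr ε χ : ℝ) (θ : ℝ → ℝ × ℝ → ℝ) (t : ℝ) (x : ℝ × ℝ) : ℝ := tT γ Pr ε χ x + θ t x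

/-- Total velocity `u = ũ + ψ`. -/
def pu (ψ : ℝ → ℝ × ℝ → ℝ × ℝ) (t : ℝ) (x : ℝ × ℝ) : ℝ × ℝ := tu x + ψ t x

/-- A classical solution `(φ, ψ, θ) = (ρ - ρ̃, u - ũ, 𝒯 - 𝒯̃)` of the perturbation
system around the plane Couette flow on `Ω × [0,T]`, with non-slip and isothermal
boundary conditions and periodicity in `x₁`.  Here `μ = 1/Re`, `μ' = r·μ`
(`r = μ'/μ = ν'/ν`), and `κ = C_p/(Re·Pr)` with `C_p = γ/(γ-1)`. -/
structure PerturbSol (γ Pr r Re ε χ T : ℝ) where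
  φ : ℝ → ℝ × ℝ → ℝ
  ψ : ℝ → ℝ × ℝ → ℝ × ℝ
  θ : ℝ → ℝ × ℝ → ℝ
  mass_eq : ∀ t ∈ Set.Icc (0 : ℝ) T, ∀ x ∈ Ω,
    dt φ t x + dot (pu ψ t x) (grad (φ t) x) + pρ γ Pr ε χ φ t x * divv (ψ t) x
      + dot (ψ t x) (grad (tρ γ Pr ε χ) x) = 0
  mom_eq1 : ∀ t ∈ Set.Icc (0 : ℝ) T, ∀ x ∈ Ω,
    pρ γ Pr ε χ φ t x * ((dt ψ t x).1 + dot (pu ψ t x) (grad (fun y => (ψ t y).1) x)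
        + dot (ψ t x) (grad (fun y => (tu y).1) x))
      + (ε ^ 2)⁻¹ * d1 (fun y => pρ γ Pr ε χ φ t y * pT γ Pr ε χ θ t y) x
      - Re⁻¹ * lap (fun y => (ψ t y).1) x
      - (Re⁻¹ + r * Re⁻¹) * d1 (divv (ψ t)) x = 0
  mom_eq2 : ∀ t ∈ Set.Icc (0 : ℝ) T, ∀ x ∈ Ω,
    pρ γ Pr ε χ φ t x * ((dt ψ t x).2 + dot (pu ψ t x) (grad (fun y => (ψ t y).2) x)
        + dot (ψ t x) (grad (fun y => (tu y).2) x))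
      + (ε ^ 2)⁻¹ * d2 (fun y => pρ γ Pr ε χ φ t y * pT γ Pr ε χ θ t y) x
      - Re⁻¹ * lap (fun y => (ψ t y).2) x
      - (Re⁻¹ + r * Re⁻¹) * d2 (divv (ψ t)) x = 0
  energy_eq : ∀ t ∈ Set.Icc (0 : ℝ) T, ∀ x ∈ Ω,
    pρ γ Pr ε χ φ t x / (γ - 1) * (dt θ t x + dot (pu ψ t x) (grad (θ t) x)
        + dot (ψ t x) (grad (tT γ Pr ε χ) x))
      + pρ γ Pr ε χ φ t x * pT γ Pr ε χ θ t x * divv (ψ t) x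
      - γ / (γ - 1) / (Re * Pr) * lap (θ t) x
      = ε ^ 2 * (2 * Re⁻¹ * defContract (ψ t) (ψ t) x
          + 4 * Re⁻¹ * defContract tu (ψ t) x + r * Re⁻¹ * (divv (ψ t) x) ^ 2)
  bc_ψ : ∀ t ∈ Set.Icc (0 : ℝ) T, ∀ x : ℝ × ℝ, (x.2 = 0 ∨ x.2 = 1) → ψ t x = 0
  bc_θ : ∀ t ∈ Set.Icc (0 : ℝ) T, ∀ x : ℝ × ℝ, (x.2 = 0 ∨ x.2 = 1) → θ t x = 0
  periodic_φ : ∀ t x, φ t (x.1 + 2 * π, x.2) = φ t x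
  periodic_ψ : ∀ t x, ψ t (x.1 + 2 * π, x.2) = ψ t x
  periodic_θ : ∀ t x, θ t (x.1 + 2 * π, x.2) = θ t x

/-- Smoothness (in time and space) of a solution of the perturbation system. -/
def SmoothSol {γ Pr r Re ε χ T : ℝ} (S : PerturbSol γ Pr r Re ε χ T) : Prop :=
  ContDiff ℝ (⊤ : ℕ∞) (Function.uncurry S.φ) ∧ ContDiff ℝ (⊤ : ℕ∞) (Function.uncurry S.ψ) ∧
    ContDiff ℝ (⊤ : ℕ∞) (Function.uncurry S.θ)

/-- Standing hypotheses on a solution of the perturbation system: initial regularity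
`(φ₀, ψ₀, θ₀) ∈ H³`, zero average of the initial density perturbation, and the
compatibility conditions `∂tψ(0) = ∂tθ(0) = 0` on `∂Ω`. -/
def StdHyp {γ Pr r Re ε χ T : ℝ} (S : PerturbSol γ Pr r Re ε χ T) : Prop :=
  MemH 3 (S.φ 0) ∧ MemH 3 (S.ψ 0) ∧ MemH 3 (S.θ 0) ∧
    (∫ x in Ω, S.φ 0 x) = 0 ∧
    ∀ x : ℝ × ℝ, (x.2 = 0 ∨ x.2 = 1) → dt S.ψ 0 x = 0 ∧ dt S.θ 0 x = 0

/-- The energy functional `A₀`. -/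
def A0 (ε : ℝ) (φ : ℝ → ℝ × ℝ → ℝ) (ψ : ℝ → ℝ × ℝ → ℝ × ℝ) (θ : ℝ → ℝ × ℝ → ℝ)
    (t : ℝ) : ℝ :=
  (⨆ s ∈ Set.Icc (0 : ℝ) t,
      (L2Sq (ψ s) + (ε ^ 2)⁻¹ * L2Sq (φ s) + (ε ^ 2)⁻¹ * L2Sq (θ s)))
    + ∫ s in (0 : ℝ)..t, (HSq 1 (ψ s) + (ε ^ 2)⁻¹ * HSq 1 (θ s))

/-- The energy functional `A₁`. -/
def A1 (ε : ℝ) (φ : ℝ → ℝ × ℝ → ℝ) (ψ : ℝ → ℝ × ℝ → ℝ × ℝ) (θ : ℝ → ℝ × ℝ → ℝ)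
    (t : ℝ) : ℝ :=
  (⨆ s ∈ Set.Icc (0 : ℝ) t, (dSq 1 (ψ s) + (ε ^ 2)⁻¹ * dSq 1 (θ s)))
    + ∫ s in (0 : ℝ)..t, (L2Sq (dt ψ s) + (ε ^ 2)⁻¹ * L2Sq (dt θ s))

/-- The energy functional `A₂`. -/
def A2 (ε : ℝ) (φ : ℝ → ℝ × ℝ → ℝ) (ψ : ℝ → ℝ × ℝ → ℝ × ℝ) (θ : ℝ → ℝ × ℝ → ℝ)
    (t : ℝ) : ℝ :=
  (ε ^ 2)⁻¹ * (⨆ s ∈ Set.Icc (0 : ℝ) t, dSq 1 (φ s))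
    + (∫ s in (0 : ℝ)..t, ((ε ^ 4)⁻¹ * HSq 1 (φ s) + (ε ^ 2)⁻¹ * L2Sq (dt φ s)))
    + ∫ s in (0 : ℝ)..t, (HSq 2 (ψ s) + (ε ^ 2)⁻¹ * HSq 2 (θ s))

/-- The energy functional `A₃`. -/
def A3 (ε : ℝ) (φ : ℝ → ℝ × ℝ → ℝ) (ψ : ℝ → ℝ × ℝ → ℝ × ℝ) (θ : ℝ → ℝ × ℝ → ℝ)
    (t : ℝ) : ℝ :=
  (⨆ s ∈ Set.Icc (0 : ℝ) t,
      ((ε ^ 2)⁻¹ * L2Sq (dt φ s) + L2Sq (dt ψ s) + (ε ^ 2)⁻¹ * L2Sq (dt θ s)))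
    + ∫ s in (0 : ℝ)..t, (dSq 1 (dt ψ s) + (ε ^ 2)⁻¹ * dSq 1 (dt θ s))

/-- The energy functional `A₄`. -/
def A4 (ε : ℝ) (φ : ℝ → ℝ × ℝ → ℝ) (ψ : ℝ → ℝ × ℝ → ℝ × ℝ) (θ : ℝ → ℝ × ℝ → ℝ)
    (t : ℝ) : ℝ :=
  (⨆ s ∈ Set.Icc (0 : ℝ) t,
      ((ε ^ 2)⁻¹ * dSq 2 (φ s) + dSq 2 (ψ s) + (ε ^ 2)⁻¹ * dSq 2 (θ s)))
    + ∫ s in (0 : ℝ)..t, ((ε ^ 4)⁻¹ * HSq 2 (φ s) + HSq 3 (ψ s) + (ε ^ 2)⁻¹ * HSq 3 (θ s))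

/-- The energy functional `A₅`. -/
def A5 (ε : ℝ) (φ : ℝ → ℝ × ℝ → ℝ) (ψ : ℝ → ℝ × ℝ → ℝ × ℝ) (θ : ℝ → ℝ × ℝ → ℝ)
    (t : ℝ) : ℝ :=
  (⨆ s ∈ Set.Icc (0 : ℝ) t,
      ((ε ^ 2)⁻¹ * dSq 3 (φ s) + (dSq 3 (ψ s) + dSq 1 (dt ψ s))
        + (ε ^ 2)⁻¹ * (dSq 3 (θ s) + dSq 1 (dt θ s))))
    + ∫ s in (0 : ℝ)..t, (L2Sq (dt (dt ψ) s) + (ε ^ 2)⁻¹ * L2Sq (dt (dt θ) s))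

/-- The total weighted energy functional `N(t)`. -/
def Nfun (ε : ℝ) (φ : ℝ → ℝ × ℝ → ℝ) (ψ : ℝ → ℝ × ℝ → ℝ × ℝ) (θ : ℝ → ℝ × ℝ → ℝ)
    (t : ℝ) : ℝ :=
  (ε ^ 2)⁻¹ * A0 ε φ ψ θ t + A1 ε φ ψ θ t + A2 ε φ ψ θ t
    + ε ^ 2 * A3 ε φ ψ θ t + ε ^ 2 * A4 ε φ ψ θ t + ε ^ 4 * A5 ε φ ψ θ t

/-- The relative entropy
`η = (ε²ρ/𝒯̃)|ψ|² + (ρ/(γ-1))(𝒯/𝒯̃ - ln(𝒯/𝒯̃) - 1) + ρ(τ/τ̃ - ln(τ/τ̃) - 1)`,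
where `τ = 1/ρ`, `τ̃ = 1/ρ̃`. -/
def relEnt (γ Pr ε χ : ℝ) (φ θ : ℝ → ℝ × ℝ → ℝ) (ψ : ℝ → ℝ × ℝ → ℝ × ℝ)
    (t : ℝ) (x : ℝ × ℝ) : ℝ :=
  ε ^ 2 * pρ γ Pr ε χ φ t x / tT γ Pr ε χ x * ‖ψ t x‖ ^ 2
    + pρ γ Pr ε χ φ t x / (γ - 1) *
        (pT γ Pr ε χ θ t x / tT γ Pr ε χ x
          - Real.log (pT γ Pr ε χ θ t x / tT γ Pr ε χ x) - 1)
    + pρ γ Pr ε χ φ t x *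
        ((pρ γ Pr ε χ φ t x)⁻¹ / (tρ γ Pr ε χ x)⁻¹
          - Real.log ((pρ γ Pr ε χ φ t x)⁻¹ / (tρ γ Pr ε χ x)⁻¹) - 1)

/-- A classical solution `(ρ, u, 𝒯)` of the non-dimensional full compressible
Navier–Stokes system on `Ω × (0,∞)`, with non-slip and isothermal boundary
conditions and periodicity in `x₁`. -/
structure FullSol (γ Pr r Re ε χ : ℝ) where
  rho : ℝ → ℝ × ℝ → ℝ
  vel : ℝ → ℝ × ℝ → ℝ × ℝ
  temp : ℝ → ℝ × ℝ → ℝ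
  mass_eq : ∀ t ∈ Set.Ioi (0 : ℝ), ∀ x ∈ Ω,
    dt rho t x + divv (fun y => rho t y • vel t y) x = 0
  mom_eq1 : ∀ t ∈ Set.Ioi (0 : ℝ), ∀ x ∈ Ω,
    rho t x * ((dt vel t x).1 + dot (vel t x) (grad (fun y => (vel t y).1) x))
      + (ε ^ 2)⁻¹ * d1 (fun y => rho t y * temp t y) x
      = Re⁻¹ * lap (fun y => (vel t y).1) x + (Re⁻¹ + r * Re⁻¹) * d1 (divv (vel t)) x
  mom_eq2 : ∀ t ∈ Set.Ioi (0 : ℝ), ∀ x ∈ Ω,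
    rho t x * ((dt vel t x).2 + dot (vel t x) (grad (fun y => (vel t y).2) x))
      + (ε ^ 2)⁻¹ * d2 (fun y => rho t y * temp t y) x
      = Re⁻¹ * lap (fun y => (vel t y).2) x + (Re⁻¹ + r * Re⁻¹) * d2 (divv (vel t)) x
  energy_eq : ∀ t ∈ Set.Ioi (0 : ℝ), ∀ x ∈ Ω,
    rho t x / (γ - 1) * (dt temp t x + dot (vel t x) (grad (temp t) x))
      + rho t x * temp t x * divv (vel t) x
      = γ / (γ - 1) / (Re * Pr) * lap (temp t) x
        + ε ^ 2 * (2 * Re⁻¹ * defContract (vel t) (vel t) x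
            + r * Re⁻¹ * (divv (vel t) x) ^ 2)
  bc_top : ∀ t ∈ Set.Ioi (0 : ℝ), ∀ x : ℝ × ℝ, x.2 = 1 →
    vel t x = (1, 0) ∧ temp t x = 1
  bc_bot : ∀ t ∈ Set.Ioi (0 : ℝ), ∀ x : ℝ × ℝ, x.2 = 0 →
    vel t x = 0 ∧ temp t x = χ
  periodic_rho : ∀ t x, rho t (x.1 + 2 * π, x.2) = rho t x
  periodic_vel : ∀ t x, vel t (x.1 + 2 * π, x.2) = vel t x
  periodic_temp : ∀ t x, temp t (x.1 + 2 * π, x.2) = temp t x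

/-- `∂tφ(0)`, defined from the initial data by taking `t = 0` in the mass equation
of the perturbation system. -/
def dtφ0 (γ Pr ε χ : ℝ) (φ₀ : ℝ × ℝ → ℝ) (ψ₀ : ℝ × ℝ → ℝ × ℝ) (x : ℝ × ℝ) : ℝ :=
  -(dot (tu x + ψ₀ x) (grad φ₀ x) + (tρ γ Pr ε χ x + φ₀ x) * divv ψ₀ x
      + dot (ψ₀ x) (grad (tρ γ Pr ε χ) x))

/-- `∂tψ(0)`, defined from the initial data by taking `t = 0` in the momentum
equation of the perturbation system. -/
def dtψ0 (γ Pr r Re ε χ : ℝ) (φ₀ θ₀ : ℝ × ℝ → ℝ) (ψ₀ : ℝ × ℝ → ℝ × ℝ)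
    (x : ℝ × ℝ) : ℝ × ℝ :=
  ((tρ γ Pr ε χ x + φ₀ x)⁻¹ *
      (Re⁻¹ * lap (fun y => (ψ₀ y).1) x + (Re⁻¹ + r * Re⁻¹) * d1 (divv ψ₀) x
        - (ε ^ 2)⁻¹ * d1 (fun y => (tρ γ Pr ε χ y + φ₀ y) * (tT γ Pr ε χ y + θ₀ y)) x)
      - dot (tu x + ψ₀ x) (grad (fun y => (ψ₀ y).1) x)
      - dot (ψ₀ x) (grad (fun y => (tu y).1) x),
   (tρ γ Pr ε χ x + φ₀ x)⁻¹ *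
      (Re⁻¹ * lap (fun y => (ψ₀ y).2) x + (Re⁻¹ + r * Re⁻¹) * d2 (divv ψ₀) x
        - (ε ^ 2)⁻¹ * d2 (fun y => (tρ γ Pr ε χ y + φ₀ y) * (tT γ Pr ε χ y + θ₀ y)) x)
      - dot (tu x + ψ₀ x) (grad (fun y => (ψ₀ y).2) x)
      - dot (ψ₀ x) (grad (fun y => (tu y).2) x))

/-- `∂tθ(0)`, defined from the initial data by taking `t = 0` in the temperature
equation of the perturbation system. -/
def dtθ0 (γ Pr r Re ε χ : ℝ) (φ₀ θ₀ : ℝ × ℝ → ℝ) (ψ₀ : ℝ × ℝ → ℝ × ℝ)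
    (x : ℝ × ℝ) : ℝ :=
  (γ - 1) * (tρ γ Pr ε χ x + φ₀ x)⁻¹ *
      (γ / (γ - 1) / (Re * Pr) * lap θ₀ x
        - (tρ γ Pr ε χ x + φ₀ x) * (tT γ Pr ε χ x + θ₀ x) * divv ψ₀ x
        + ε ^ 2 * (2 * Re⁻¹ * defContract ψ₀ ψ₀ x + 4 * Re⁻¹ * defContract tu ψ₀ x
            + r * Re⁻¹ * (divv ψ₀ x) ^ 2))
    - dot (tu x + ψ₀ x) (grad θ₀ x) - dot (ψ₀ x) (grad (tT γ Pr ε χ) x)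


abbrev E3 := ℝ × ℝ × ℝ

/-- The algebra of smooth functions of `(t, x₁, x₂)`. -/
def SFalg : Subalgebra ℝ (E3 → ℝ) where
  carrier := {f | ContDiff ℝ (⊤ : ℕ∞) f}
  mul_mem' := fun {f g} hf hg => by
    have hf' : ContDiff ℝ (⊤ : ℕ∞) f := hf
    have hg' : ContDiff ℝ (⊤ : ℕ∞) g := hg
    exact hf'.mul hg'
  add_mem' := fun {f g} hf hg => by
    have hf' : ContDiff ℝ (⊤ : ℕ∞) f := hf
    have hg' : ContDiff ℝ (⊤ : ℕ∞) g := hg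
    exact hf'.add hg'
  algebraMap_mem' := fun c => (contDiff_const : ContDiff ℝ (⊤ : ℕ∞) (fun _ : E3 => c))

abbrev SF : Type := ↥SFalg

theorem SF.smooth (f : SF) : ContDiff ℝ (⊤ : ℕ∞) f.1 := f.2

theorem SF.cont (f : SF) : Continuous f.1 := f.smooth.continuous

theorem SF.diff (f : SF) : Differentiable ℝ f.1 := f.smooth.differentiable (by simp)

theorem smooth_fderiv_apply {f : E3 → ℝ} (hf : ContDiff ℝ (⊤ : ℕ∞) f) (v : E3) :
    ContDiff ℝ (⊤ : ℕ∞) (fun z => fderiv ℝ f z v) := by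
  have h : ContDiff ℝ (⊤ : ℕ∞) (fderiv ℝ f) := hf.fderiv_right (by simp)
  exact h.clm_apply contDiff_const

/-- Directional derivative as a derivation of the algebra of smooth functions. -/
def pdv (v : E3) : Derivation ℝ SF SF :=
  Derivation.mk'
    { toFun := fun f => (⟨fun z => fderiv ℝ f.1 z v, smooth_fderiv_apply f.smooth v⟩ : SF)
      map_add' := by
        intro f g
        apply Subtype.ext
        funext z
        show fderiv ℝ (f.1 + g.1) z v = fderiv ℝ f.1 z v + fderiv ℝ g.1 z v
        rw [fderiv_add (f.diff z) (g.diff z)]; rfl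
      map_smul' := by
        intro c f
        apply Subtype.ext
        funext z
        show fderiv ℝ (c • f.1) z v = c • fderiv ℝ f.1 z v
        rw [fderiv_const_smul (f.diff z)]; rfl }
    (by
      intro f g
      apply Subtype.ext
      funext z
      show fderiv ℝ (f.1 * g.1) z v = f.1 z * fderiv ℝ g.1 z v + g.1 z * fderiv ℝ f.1 z v
      rw [fderiv_mul (f.diff z) (g.diff z)]; rfl)

theorem pdv_apply (v : E3) (f : SF) (z : E3) : (pdv v f).1 z = fderiv ℝ f.1 z v := rfl

theorem pdv_comm (v w : E3) (f : SF) : pdv v (pdv w f) = pdv w (pdv v f) := by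
  apply Subtype.ext
  funext z
  show fderiv ℝ (fun z => fderiv ℝ f.1 z w) z v = fderiv ℝ (fun z => fderiv ℝ f.1 z v) z w
  have h : ContDiff ℝ (⊤ : ℕ∞) (fderiv ℝ f.1) := f.smooth.fderiv_right (by simp)
  have hd : DifferentiableAt ℝ (fderiv ℝ f.1) z := h.differentiable (by simp) z
  have e : ∀ u : E3, fderiv ℝ (fun z => fderiv ℝ f.1 z u) z
      = (fderiv ℝ (fderiv ℝ f.1) z).flip u := by
    intro u
    have := (hd.hasFDerivAt.clm_apply (hasFDerivAt_const u z)).fderiv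
    rw [this]; ext <;> simp
  rw [e, e]
  have hs : IsSymmSndFDerivAt ℝ f.1 z := by
    apply ContDiffAt.isSymmSndFDerivAt (n := (⊤ : ℕ∞)) f.smooth.contDiffAt
    simp only [minSmoothness_of_isRCLikeNormedField]
    exact WithTop.coe_le_coe.2 (le_top : (2 : ℕ∞) ≤ ⊤)
  exact hs.eq v w

/-- Time derivative, `x₁` derivative and `x₂` derivative. -/
def dT : Derivation ℝ SF SF := pdv (1, 0, 0)
def dX : Derivation ℝ SF SF := pdv (0, 1, 0)
def dY : Derivation ℝ SF SF := pdv (0, 0, 1)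

theorem dX_dT (f : SF) : dX (dT f) = dT (dX f) := pdv_comm _ _ f
theorem dY_dT (f : SF) : dY (dT f) = dT (dY f) := pdv_comm _ _ f
theorem dY_dX (f : SF) : dY (dX f) = dX (dY f) := pdv_comm _ _ f

/-- Evaluation. -/
def ev (z : E3) : SF →ₐ[ℝ] ℝ := (Pi.evalAlgHom ℝ (fun _ : E3 => ℝ) z).comp SFalg.val

theorem ev_apply (z : E3) (f : SF) : ev z f = f.1 z := rfl

theorem hasDerivAt_T (f : SF) (t x y : ℝ) :
    HasDerivAt (fun s => f.1 (s, x, y)) ((dT f).1 (t, x, y)) t := by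
  have h1 : HasDerivAt (fun s : ℝ => ((s, x, y) : E3)) (1, 0, 0) t :=
    (hasDerivAt_id t).prodMk ((hasDerivAt_const t x).prodMk (hasDerivAt_const t y))
  exact (f.diff (t, x, y)).hasFDerivAt.comp_hasDerivAt t h1

theorem hasDerivAt_X (f : SF) (t x y : ℝ) :
    HasDerivAt (fun s => f.1 (t, s, y)) ((dX f).1 (t, x, y)) x := by
  have h1 : HasDerivAt (fun s : ℝ => ((t, s, y) : E3)) (0, 1, 0) x :=
    (hasDerivAt_const x t).prodMk ((hasDerivAt_id x).prodMk (hasDerivAt_const x y))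
  exact (f.diff (t, x, y)).hasFDerivAt.comp_hasDerivAt x h1

theorem hasDerivAt_Y (f : SF) (t x y : ℝ) :
    HasDerivAt (fun s => f.1 (t, x, s)) ((dY f).1 (t, x, y)) y := by
  have h1 : HasDerivAt (fun s : ℝ => ((t, x, s) : E3)) (0, 0, 1) y :=
    (hasDerivAt_const y t).prodMk ((hasDerivAt_const y x).prodMk (hasDerivAt_id y))
  exact (f.diff (t, x, y)).hasFDerivAt.comp_hasDerivAt y h1

/-! ### Integration over `Ω` -/

theorem Ω_eq : Ω = Set.Ioo 0 (2 * π) ×ˢ Set.Ioo (0:ℝ) 1 := by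
  ext x; simp [Ω]

theorem Ω_open : IsOpen Ω := by rw [Ω_eq]; exact isOpen_Ioo.prod isOpen_Ioo

theorem Ω_meas : MeasurableSet Ω := Ω_open.measurableSet

theorem Ω_sub : Ω ⊆ Set.Icc (0:ℝ) (2 * π) ×ˢ Set.Icc (0:ℝ) 1 := by
  rw [Ω_eq]; exact Set.prod_mono Set.Ioo_subset_Icc_self Set.Ioo_subset_Icc_self

theorem Ωc_compact : IsCompact (Set.Icc (0:ℝ) (2 * π) ×ˢ Set.Icc (0:ℝ) 1) :=
  isCompact_Icc.prod isCompact_Icc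

theorem cont_integrableOn {g : ℝ × ℝ → ℝ} (hg : Continuous g) : IntegrableOn g Ω :=
  (hg.continuousOn.integrableOn_compact Ωc_compact).mono_set Ω_sub

theorem two_pi_pos' : (0:ℝ) ≤ 2 * π := by positivity

theorem setInt_iter {g : ℝ × ℝ → ℝ} (hg : Continuous g) :
    ∫ x in Ω, g x = ∫ x in (0:ℝ)..(2 * π), ∫ y in (0:ℝ)..1, g (x, y) := by
  have h := cont_integrableOn hg
  rw [Ω_eq] at h ⊢
  rw [Measure.volume_eq_prod] at h ⊢
  rw [setIntegral_prod _ h, intervalIntegral.integral_of_le two_pi_pos',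
    integral_Ioc_eq_integral_Ioo]
  congr 1
  funext x
  rw [intervalIntegral.integral_of_le zero_le_one, integral_Ioc_eq_integral_Ioo]

theorem setInt_iter' {g : ℝ × ℝ → ℝ} (hg : Continuous g) :
    ∫ x in Ω, g x = ∫ y in (0:ℝ)..1, ∫ x in (0:ℝ)..(2 * π), g (x, y) := by
  rw [setInt_iter hg]
  simp only [intervalIntegral.integral_of_le zero_le_one]
  apply intervalIntegral_integral_swap
  rw [Set.uIoc_of_le two_pi_pos']
  have := (hg.continuousOn.integrableOn_compact (μ := volume) Ωc_compact)
  rw [IntegrableOn, Measure.volume_eq_prod, ← Measure.prod_restrict] at this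
  refine this.mono_measure ?_
  apply Measure.prod_mono <;> exact Measure.restrict_mono Set.Ioc_subset_Icc_self le_rfl

theorem slice_cont (f : SF) (t : ℝ) : Continuous (fun x : ℝ × ℝ => f.1 (t, x)) :=
  f.cont.comp (by fun_prop)

/-- Integral over `Ω` of the time slice. -/
def I (t : ℝ) : SF →ₗ[ℝ] ℝ where
  toFun f := ∫ x in Ω, f.1 (t, x)
  map_add' := by
    intro f g
    exact integral_add (cont_integrableOn (slice_cont f t)) (cont_integrableOn (slice_cont g t))
  map_smul' := by
    intro c f
    exact integral_const_mul c _

theorem I_apply (t : ℝ) (f : SF) : I t f = ∫ x in Ω, f.1 (t, x) := rfl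

theorem I_mono {t : ℝ} {f g : SF} (h : ∀ x ∈ Ω, ev (t, x) f ≤ ev (t, x) g) : I t f ≤ I t g :=
  setIntegral_mono_on (cont_integrableOn (slice_cont f t)) (cont_integrableOn (slice_cont g t))
    Ω_meas h

theorem I_nonneg {t : ℝ} {f : SF} (h : ∀ x ∈ Ω, 0 ≤ ev (t, x) f) : 0 ≤ I t f :=
  setIntegral_nonneg Ω_meas h

theorem I_congr {t : ℝ} {f g : SF} (h : ∀ x ∈ Ω, ev (t, x) f = ev (t, x) g) : I t f = I t g :=
  setIntegral_congr_fun Ω_meas h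

def IsPer (f : SF) : Prop := ∀ t x y, f.1 (t, x + 2 * π, y) = f.1 (t, x, y)

theorem I_dX {f : SF} (hf : IsPer f) (t : ℝ) : I t (dX f) = 0 := by
  rw [I_apply, setInt_iter' (slice_cont _ t)]
  have : ∀ y : ℝ, ∫ x in (0:ℝ)..(2 * π), (dX f).1 (t, x, y) = 0 := by
    intro y
    rw [intervalIntegral.integral_eq_sub_of_hasDerivAt (fun x _ => hasDerivAt_X f t x y)]
    · have := hf t 0 y
      simp only [zero_add] at this
      rw [this, sub_self]
    · exact ((dX f).cont.comp (by fun_prop : Continuous fun x : ℝ => ((t, x, y) : E3))).intervalIntegrable _ _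
  simp [this]

theorem I_dY {f : SF} {t : ℝ} (h0 : ∀ x, f.1 (t, x, 0) = 0) (h1 : ∀ x, f.1 (t, x, 1) = 0) :
    I t (dY f) = 0 := by
  rw [I_apply, setInt_iter (slice_cont _ t)]
  have : ∀ x : ℝ, ∫ y in (0:ℝ)..1, (dY f).1 (t, x, y) = 0 := by
    intro x
    rw [intervalIntegral.integral_eq_sub_of_hasDerivAt (fun y _ => hasDerivAt_Y f t x y)]
    · rw [h0, h1, sub_self]
    · exact ((dY f).cont.comp (by fun_prop : Continuous fun y : ℝ => ((t, x, y) : E3))).intervalIntegrable _ _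
  simp [this]

theorem I_hasDerivAt (f : SF) (t : ℝ) : HasDerivAt (fun s => I s f) (I t (dT f)) t := by
  have hc : IsCompact (Set.Icc (t - 1) (t + 1) ×ˢ (Set.Icc (0:ℝ) (2 * π) ×ˢ Set.Icc (0:ℝ) 1)) :=
    isCompact_Icc.prod Ωc_compact
  obtain ⟨C, hC⟩ := hc.exists_bound_of_continuousOn (f := (dT f).1) (dT f).cont.continuousOn
  have hfin : IsFiniteMeasure (volume.restrict Ω) := by
    constructor
    rw [Measure.restrict_apply_univ]
    exact lt_of_le_of_lt (measure_mono Ω_sub) Ωc_compact.measure_lt_top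
  refine (hasDerivAt_integral_of_dominated_loc_of_deriv_le (μ := volume.restrict Ω)
    (F := fun s x => f.1 (s, x)) (F' := fun s x => (dT f).1 (s, x))
    (bound := fun _ => C) (x₀ := t) (s := Set.Icc (t - 1) (t + 1))
    (Icc_mem_nhds (by linarith) (by linarith)) ?_ ?_ ?_ ?_ ?_ ?_).2
  · exact Eventually.of_forall fun s => (cont_integrableOn (slice_cont f s)).aestronglyMeasurable
  · exact cont_integrableOn (slice_cont f t)
  · exact (cont_integrableOn (slice_cont (dT f) t)).aestronglyMeasurable
  · refine (ae_restrict_mem Ω_meas).mono fun x hx s hs => hC (s, x) ⟨hs, Ω_sub hx⟩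
  · exact integrable_const C
  · exact Eventually.of_forall fun x s _ => hasDerivAt_T f s x.1 x.2

theorem I_cont (f : SF) : Continuous (fun s => I s f) :=
  continuous_iff_continuousAt.2 fun t => (I_hasDerivAt f t).continuousAt

/-- Space-time integral. -/
def J (t : ℝ) : SF →ₗ[ℝ] ℝ where
  toFun f := ∫ s in (0:ℝ)..t, I s f
  map_add' := by
    intro f g
    simp only [map_add]
    exact intervalIntegral.integral_add ((I_cont f).intervalIntegrable _ _)
      ((I_cont g).intervalIntegrable _ _)
  map_smul' := by
    intro c f
    simp only [map_smul, smul_eq_mul, RingHom.id_apply]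
    exact intervalIntegral.integral_const_mul c _

theorem J_apply (t : ℝ) (f : SF) : J t f = ∫ s in (0:ℝ)..t, I s f := rfl

theorem J_mono_I {t : ℝ} (ht : 0 ≤ t) {f g : SF}
    (h : ∀ s ∈ Set.Ioo 0 t, I s f ≤ I s g) : J t f ≤ J t g :=
  intervalIntegral.integral_mono_on_of_le_Ioo ht ((I_cont f).intervalIntegrable _ _)
    ((I_cont g).intervalIntegrable _ _) h

theorem J_mono {t : ℝ} (ht : 0 ≤ t) {f g : SF}
    (h : ∀ s ∈ Set.Ioo 0 t, ∀ x ∈ Ω, ev (s, x) f ≤ ev (s, x) g) : J t f ≤ J t g :=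
  J_mono_I ht fun s hs => I_mono (h s hs)

theorem J_nonneg {t : ℝ} (ht : 0 ≤ t) {f : SF}
    (h : ∀ s x, 0 ≤ ev (s, x) f) : 0 ≤ J t f :=
  intervalIntegral.integral_nonneg ht fun s _ => I_nonneg fun x _ => h s x

theorem energy {G A B F1 F2 : SF} {T t : ℝ} (ht : t ∈ Set.Icc 0 T) (hF1 : IsPer F1)
    (h0 : ∀ s ∈ Set.Ioo 0 T, ∀ x, F2.1 (s, x, 0) = 0)
    (h1 : ∀ s ∈ Set.Ioo 0 T, ∀ x, F2.1 (s, x, 1) = 0)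
    (h : ∀ s ∈ Set.Ioo 0 T, ∀ x ∈ Ω,
      ev (s, x) (dT G) + ev (s, x) A ≤ ev (s, x) B + ev (s, x) (dX F1) + ev (s, x) (dY F2)) :
    I t G + J t A ≤ I 0 G + J t B := by
  have e : I t G - I 0 G = J t (dT G) := by
    rw [J_apply, intervalIntegral.integral_eq_sub_of_hasDerivAt (fun s _ => I_hasDerivAt G s)]
    exact (I_cont (dT G)).intervalIntegrable _ _
  have : J t (dT G + A) ≤ J t B := by
    apply J_mono_I ht.1
    intro s hs
    have hs' : s ∈ Set.Ioo 0 T := ⟨hs.1, hs.2.trans_le ht.2⟩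
    have h2 : I s (dT G + A) ≤ I s (B + dX F1 + dY F2) := by
      apply I_mono
      intro x hx
      simpa only [map_add] using h s hs' x hx
    simp only [map_add] at h2 ⊢
    rw [I_dX hF1, I_dY (h0 s hs') (h1 s hs')] at h2
    linarith
  rw [map_add] at this
  linarith

/-! ### One dimensional inequalities -/

theorem oneD_diff {g g' : ℝ → ℝ} {L : ℝ} (hL : 0 ≤ L) (hd : ∀ x, HasDerivAt g (g' x) x)
    (hc : Continuous g') {x y : ℝ} (hx : x ∈ Set.Icc 0 L) (hy : y ∈ Set.Icc 0 L) :
    |g x - g y| ≤ ∫ z in (0:ℝ)..L, |g' z| := by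
  have e : ∫ z in y..x, g' z = g x - g y :=
    intervalIntegral.integral_eq_sub_of_hasDerivAt (fun z _ => hd z) (hc.intervalIntegrable _ _)
  rw [← e]
  have h1 : abs (∫ z in y..x, g' z) ≤ abs (∫ z in y..x, abs (g' z)) := by
    have := intervalIntegral.norm_integral_le_abs_integral_norm (f := g') (a := y) (b := x)
      (μ := volume)
    simpa using this
  have h2 : abs (∫ z in y..x, abs (g' z)) ≤ abs (∫ z in (0:ℝ)..L, abs (g' z)) := by
    apply intervalIntegral.abs_integral_mono_interval
    · rw [Set.uIoc_of_le hL]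
      intro z hz
      rw [Set.mem_uIoc] at hz
      rcases hz with hz | hz
      · exact ⟨lt_of_le_of_lt hy.1 hz.1, hz.2.trans hx.2⟩
      · exact ⟨lt_of_le_of_lt hx.1 hz.1, hz.2.trans hy.2⟩
    · exact Eventually.of_forall fun z => abs_nonneg _
    · exact hc.abs.intervalIntegrable _ _
  have h3 : 0 ≤ ∫ z in (0:ℝ)..L, |g' z| :=
    intervalIntegral.integral_nonneg hL fun z _ => abs_nonneg _
  rw [abs_of_nonneg h3] at h2
  exact h1.trans h2

theorem oneD_sup {g g' : ℝ → ℝ} {L : ℝ} (hL : 1 ≤ L) (hd : ∀ x, HasDerivAt g (g' x) x)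
    (hc : Continuous g') {x : ℝ} (hx : x ∈ Set.Icc 0 L) :
    |g x| ≤ ∫ z in (0:ℝ)..L, (|g z| + |g' z|) := by
  have hgc : Continuous g := continuous_iff_continuousAt.2 fun z => (hd z).continuousAt
  obtain ⟨y, hy, hmin⟩ := (isCompact_Icc (a := (0:ℝ)) (b := L)).exists_isMinOn
    ⟨x, hx⟩ hgc.abs.continuousOn
  have hmin' : ∀ z ∈ Set.Icc 0 L, |g y| ≤ |g z| := fun z hz => hmin hz
  have h1 : ∫ z in (0:ℝ)..L, |g y| ≤ ∫ z in (0:ℝ)..L, |g z| :=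
    intervalIntegral.integral_mono_on (by linarith) (by simp) (hgc.abs.intervalIntegrable _ _)
      hmin'
  rw [intervalIntegral.integral_const, smul_eq_mul, sub_zero] at h1
  have h2 := oneD_diff (by linarith : (0:ℝ) ≤ L) hd hc hx hy
  rw [intervalIntegral.integral_add (hgc.abs.intervalIntegrable _ _)
    (hc.abs.intervalIntegrable _ _)]
  have h3 : |g x| ≤ |g y| + |g x - g y| := by
    have := abs_add_le (g y) (g x - g y)
    simpa using this
  nlinarith [abs_nonneg (g y)]

theorem oneD_cs {h : ℝ → ℝ} {L : ℝ} (hL : 0 < L) (hc : Continuous h) :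
    (∫ z in (0:ℝ)..L, h z) ^ 2 ≤ L * ∫ z in (0:ℝ)..L, (h z) ^ 2 := by
  set c := ∫ z in (0:ℝ)..L, h z with hcdef
  have h0 : 0 ≤ ∫ z in (0:ℝ)..L, (L * h z - c) ^ 2 :=
    intervalIntegral.integral_nonneg hL.le fun z _ => sq_nonneg _
  have e : ∫ z in (0:ℝ)..L, (L * h z - c) ^ 2
      = L ^ 2 * (∫ z in (0:ℝ)..L, (h z) ^ 2) - 2 * L * c * c + c ^ 2 * L := by
    have e1 : ∀ z, (L * h z - c) ^ 2 = L ^ 2 * (h z) ^ 2 - 2 * L * c * h z + c ^ 2 := by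
      intro z; ring
    simp only [e1]
    rw [intervalIntegral.integral_add, intervalIntegral.integral_sub,
      intervalIntegral.integral_const_mul, intervalIntegral.integral_const_mul,
      intervalIntegral.integral_const, ← hcdef]
    · simp; ring
    all_goals
      apply Continuous.intervalIntegrable
      fun_prop
  rw [e] at h0
  by_contra hcon
  push Not at hcon
  nlinarith

theorem oneD_poincare {f f' : ℝ → ℝ} {L : ℝ} (hL : 0 < L) (hd : ∀ x, HasDerivAt f (f' x) x)
    (hc : Continuous f') :
    ∫ z in (0:ℝ)..L, (f z) ^ 2
      ≤ L ^ 2 * (∫ z in (0:ℝ)..L, (f' z) ^ 2) + L⁻¹ * (∫ z in (0:ℝ)..L, f z) ^ 2 := by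
  have hfc : Continuous f := continuous_iff_continuousAt.2 fun z => (hd z).continuousAt
  have hF : ∀ x, HasDerivAt (fun x => ∫ z in (0:ℝ)..x, f z) (f x) x := fun x =>
    intervalIntegral.integral_hasDerivAt_right (hfc.intervalIntegrable _ _)
      hfc.stronglyMeasurable.stronglyMeasurableAtFilter hfc.continuousAt
  obtain ⟨y, hy, hyeq⟩ := exists_hasDerivAt_eq_slope _ f hL
    (fun x _ => (hF x).continuousAt.continuousWithinAt) (fun x _ => hF x)
  simp only [intervalIntegral.integral_same, sub_zero] at hyeq
  set M := ∫ z in (0:ℝ)..L, f z with hM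
  set Q := ∫ z in (0:ℝ)..L, (f' z) ^ 2 with hQ
  have hb : ∀ x ∈ Set.Icc 0 L, (f x - f y) ^ 2 ≤ L * Q := by
    intro x hx
    have h1 := oneD_diff hL.le hd hc hx ⟨hy.1.le, hy.2.le⟩
    have h2 := oneD_cs hL hc.abs
    simp only [sq_abs] at h2
    calc (f x - f y) ^ 2 = |f x - f y| ^ 2 := (sq_abs _).symm
      _ ≤ _ := by gcongr
      _ ≤ _ := h2
  have h3 : ∫ x in (0:ℝ)..L, (f x - f y) ^ 2 ≤ ∫ x in (0:ℝ)..L, L * Q :=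
    intervalIntegral.integral_mono_on hL.le (Continuous.intervalIntegrable (by fun_prop) _ _)
      (by simp) hb
  have e : ∫ x in (0:ℝ)..L, (f x - f y) ^ 2
      = (∫ z in (0:ℝ)..L, (f z) ^ 2) - 2 * f y * M + (f y) ^ 2 * L := by
    have e1 : ∀ z, (f z - f y) ^ 2 = (f z) ^ 2 - 2 * f y * f z + (f y) ^ 2 := by
      intro z; ring
    simp only [e1]
    rw [intervalIntegral.integral_add, intervalIntegral.integral_sub,
      intervalIntegral.integral_const_mul,
      intervalIntegral.integral_const, ← hM]
    · simp; ring
    all_goals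
      apply Continuous.intervalIntegrable
      fun_prop
  rw [e, intervalIntegral.integral_const, smul_eq_mul, sub_zero, hyeq] at h3
  have e2 : 2 * (M / L) * M = 2 * (L⁻¹ * M ^ 2) := by field_simp
  have e3 : (M / L) ^ 2 * L = L⁻¹ * M ^ 2 := by field_simp
  rw [e2, e3] at h3
  nlinarith

/-! ### Two dimensional inequalities -/

theorem one_le_two_pi : (1:ℝ) ≤ 2 * π := by linarith [Real.pi_gt_three]

theorem cont_Y {g : E3 → ℝ} (hg : Continuous g) (t x : ℝ) : Continuous fun y => g (t, x, y) :=
  hg.comp (by fun_prop)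
theorem cont_X {g : E3 → ℝ} (hg : Continuous g) (t y : ℝ) : Continuous fun x => g (t, x, y) :=
  hg.comp (by fun_prop)
theorem cont_XY {g : E3 → ℝ} (hg : Continuous g) (t : ℝ) :
    Continuous fun x : ℝ × ℝ => g (t, x) :=
  hg.comp (by fun_prop)

theorem cont_intY {g : ℝ × ℝ → ℝ} (hg : Continuous g) :
    Continuous fun x => ∫ y in (0:ℝ)..1, g (x, y) :=
  intervalIntegral.continuous_parametric_intervalIntegral_of_continuous' (f := fun x y => g (x, y))
    hg _ _

theorem cont_intX {g : ℝ × ℝ → ℝ} (hg : Continuous g) :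
    Continuous fun y => ∫ x in (0:ℝ)..(2 * π), g (x, y) :=
  intervalIntegral.continuous_parametric_intervalIntegral_of_continuous'
    (f := fun y x => g (x, y)) (hg.comp (by fun_prop)) _ _

theorem sup_X (f : SF) (t y : ℝ) {x : ℝ} (hx : x ∈ Set.Icc 0 (2 * π)) :
    |f.1 (t, x, y)| ≤ ∫ z in (0:ℝ)..(2 * π), (|f.1 (t, z, y)| + |(dX f).1 (t, z, y)|) :=
  oneD_sup one_le_two_pi (fun x => hasDerivAt_X f t x y) (cont_X (dX f).cont t y) hx

theorem sup_Y (f : SF) (t x : ℝ) {y : ℝ} (hy : y ∈ Set.Icc (0:ℝ) 1) :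
    |f.1 (t, x, y)| ≤ ∫ z in (0:ℝ)..1, (|f.1 (t, x, z)| + |(dY f).1 (t, x, z)|) :=
  oneD_sup le_rfl (fun y => hasDerivAt_Y f t x y) (cont_Y (dY f).cont t x) hy

theorem sup_XY (f : SF) (t : ℝ) {x : ℝ × ℝ} (hx : x ∈ Ω) :
    |f.1 (t, x)| ≤ ∫ z in Ω, (|f.1 (t, z)| + |(dX f).1 (t, z)| + |(dY f).1 (t, z)|
      + |(dX (dY f)).1 (t, z)|) := by
  obtain ⟨h1, h2⟩ := Ω_sub hx
  obtain ⟨a, b⟩ := x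
  have c0 := cont_XY f.cont.abs t
  have c1 := cont_XY (dX f).cont.abs t
  have c2 := cont_XY (dY f).cont.abs t
  have c3 := cont_XY (dX (dY f)).cont.abs t
  rw [setInt_iter (by fun_prop)]
  refine (sup_X f t b h1).trans ?_
  apply intervalIntegral.integral_mono_on two_pi_pos'
  · exact (Continuous.intervalIntegrable
      ((cont_X f.cont.abs t b).add (cont_X (dX f).cont.abs t b)) _ _)
  · exact (cont_intY (g := fun z => |f.1 (t, z)| + |(dX f).1 (t, z)| + |(dY f).1 (t, z)|
      + |(dX (dY f)).1 (t, z)|) (by fun_prop)).intervalIntegrable _ _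
  intro z _
  have e1 := sup_Y f t z h2
  have e2 := sup_Y (dX f) t z h2
  rw [dY_dX] at e2
  have := add_le_add e1 e2
  refine this.trans (le_of_eq ?_)
  rw [← intervalIntegral.integral_add]
  · congr 1; funext w; ring
  · exact (Continuous.intervalIntegrable
      ((cont_Y f.cont.abs t z).add (cont_Y (dY f).cont.abs t z)) _ _)
  · exact (Continuous.intervalIntegrable
      ((cont_Y (dX f).cont.abs t z).add (cont_Y (dX (dY f)).cont.abs t z)) _ _)

theorem sup_sq (f : SF) (t : ℝ) {a : ℝ} (ha : 0 < a) {x : ℝ × ℝ} (hx : x ∈ Ω) :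
    (ev (t, x) f) ^ 2 ≤ (3 + a) * I t (f ^ 2) + 2 * I t ((dX f) ^ 2) + 2 * I t ((dY f) ^ 2)
      + a⁻¹ * I t ((dX (dY f)) ^ 2) := by
  have h := sup_XY (f * f) t hx
  have e : (3 + a) * I t (f ^ 2) + 2 * I t ((dX f) ^ 2) + 2 * I t ((dY f) ^ 2)
      + a⁻¹ * I t ((dX (dY f)) ^ 2) = I t ((3 + a) • f ^ 2 + (2:ℝ) • (dX f) ^ 2
        + (2:ℝ) • (dY f) ^ 2 + a⁻¹ • (dX (dY f)) ^ 2) := by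
    simp only [map_add, map_smul, smul_eq_mul]
  rw [e]
  have h0 : (ev (t, x) f) ^ 2 ≤ |(f * f).1 (t, x)| := by
    have : (f * f).1 (t, x) = ev (t, x) f ^ 2 := by rw [sq]; rfl
    rw [this]; exact le_abs_self _
  refine h0.trans (h.trans ?_)
  rw [I_apply]
  apply setIntegral_mono_on _ (cont_integrableOn (slice_cont _ t)) Ω_meas
  · intro z _
    simp only [← ev_apply]
    simp only [Derivation.leibniz, map_add, map_smul, smul_eq_mul, map_mul, map_pow]
    set u := ev (t, z) f
    set u1 := ev (t, z) (dX f)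
    set u2 := ev (t, z) (dY f)
    set u12 := ev (t, z) (dX (dY f))
    have k0 : |u * u| ≤ u ^ 2 := by rw [← sq, abs_of_nonneg (sq_nonneg u)]
    have k1 : |u * u1 + u * u1| ≤ u ^ 2 + u1 ^ 2 := by
      rw [abs_le]; constructor <;> nlinarith [sq_nonneg (u + u1), sq_nonneg (u - u1)]
    have k2 : |u * u2 + u * u2| ≤ u ^ 2 + u2 ^ 2 := by
      rw [abs_le]; constructor <;> nlinarith [sq_nonneg (u + u2), sq_nonneg (u - u2)]
    have k4 : |2 * (u * u12)| ≤ a * u ^ 2 + a⁻¹ * u12 ^ 2 := by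
      have q1 : 0 ≤ a⁻¹ * (a * u + u12) ^ 2 := by positivity
      have q2 : 0 ≤ a⁻¹ * (a * u - u12) ^ 2 := by positivity
      have r1 : a⁻¹ * (a * u + u12) ^ 2 = a * u ^ 2 + 2 * (u * u12) + a⁻¹ * u12 ^ 2 := by
        field_simp
        ring
      have r2 : a⁻¹ * (a * u - u12) ^ 2 = a * u ^ 2 - 2 * (u * u12) + a⁻¹ * u12 ^ 2 := by
        field_simp
        ring
      rw [abs_le]; constructor <;> linarith
    have k3 : |u * u12 + u2 * u1 + (u * u12 + u2 * u1)|
        ≤ u1 ^ 2 + u2 ^ 2 + (a * u ^ 2 + a⁻¹ * u12 ^ 2) := by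
      have := abs_le.1 k4
      rw [abs_le]; constructor <;> nlinarith [sq_nonneg (u1 + u2), sq_nonneg (u1 - u2)]
    linarith
  · apply cont_integrableOn
    have c0 := cont_XY (f * f).cont.abs t
    have c1 := cont_XY (dX (f * f)).cont.abs t
    have c2 := cont_XY (dY (f * f)).cont.abs t
    have c3 := cont_XY (dX (dY (f * f))).cont.abs t
    fun_prop

theorem lady_aux (f : SF) (t : ℝ) :
    I t (f ^ 2) ≤ (∫ z in Ω, (|f.1 (t, z)| + |(dX f).1 (t, z)|))
      * (∫ z in Ω, (|f.1 (t, z)| + |(dY f).1 (t, z)|)) := by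
  have c0 := cont_XY f.cont.abs t
  have c1 := cont_XY (dX f).cont.abs t
  have c2 := cont_XY (dY f).cont.abs t
  have cA := cont_intX (g := fun z => |f.1 (t, z)| + |(dX f).1 (t, z)|) (by fun_prop)
  have cB := cont_intY (g := fun z => |f.1 (t, z)| + |(dY f).1 (t, z)|) (by fun_prop)
  rw [setInt_iter' (g := fun z => |f.1 (t, z)| + |(dX f).1 (t, z)|) (by fun_prop),
    setInt_iter (g := fun z => |f.1 (t, z)| + |(dY f).1 (t, z)|) (by fun_prop)]
  set A := fun y => ∫ x in (0:ℝ)..(2 * π), (|f.1 (t, x, y)| + |(dX f).1 (t, x, y)|)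
  set B := fun x => ∫ y in (0:ℝ)..1, (|f.1 (t, x, y)| + |(dY f).1 (t, x, y)|)
  have e : (∫ y in (0:ℝ)..1, A y) * (∫ x in (0:ℝ)..(2 * π), B x)
      = ∫ z in Ω, A z.2 * B z.1 := by
    rw [setInt_iter (g := fun z => A z.2 * B z.1) (by fun_prop)]
    simp only [intervalIntegral.integral_mul_const, intervalIntegral.integral_const_mul]
  show _ ≤ (∫ y in (0:ℝ)..1, A y) * (∫ x in (0:ℝ)..(2 * π), B x)
  rw [e, I_apply]
  apply setIntegral_mono_on (cont_integrableOn (slice_cont _ t))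
    (cont_integrableOn (by fun_prop)) Ω_meas
  intro z hz
  obtain ⟨h1, h2⟩ := Ω_sub hz
  have k1 := sup_X f t z.2 h1
  have k2 := sup_Y f t z.1 h2
  have : (f ^ 2).1 (t, z) = |f.1 (t, z)| * |f.1 (t, z)| := by
    rw [abs_mul_abs_self, ← sq]; rfl
  rw [this]
  exact mul_le_mul k1 k2 (abs_nonneg _) ((abs_nonneg _).trans k1)

theorem cs_aux (f g : SF) (t : ℝ) :
    (∫ z in Ω, |f.1 (t, z)| * |g.1 (t, z)|) ^ 2 ≤ I t (f ^ 2) * I t (g ^ 2) := by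
  have c0 := cont_XY f.cont.abs t
  have c1 := cont_XY g.cont.abs t
  have key : ∀ b : ℝ, 0 ≤ I t (f ^ 2) * (b * b)
      + (2 * ∫ z in Ω, |f.1 (t, z)| * |g.1 (t, z)|) * b + I t (g ^ 2) := by
    intro b
    have h0 : 0 ≤ ∫ z in Ω, (b * |f.1 (t, z)| + |g.1 (t, z)|) ^ 2 :=
      setIntegral_nonneg Ω_meas fun z _ => sq_nonneg _
    have e : ∀ z, (b * |f.1 (t, z)| + |g.1 (t, z)|) ^ 2 = (b * b) * (f ^ 2).1 (t, z)
        + (2 * b) * (|f.1 (t, z)| * |g.1 (t, z)|) + (g ^ 2).1 (t, z) := by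
      intro z
      have e1 : (f ^ 2).1 (t, z) = |f.1 (t, z)| ^ 2 := by rw [sq_abs]; rfl
      have e2 : (g ^ 2).1 (t, z) = |g.1 (t, z)| ^ 2 := by rw [sq_abs]; rfl
      rw [e1, e2]; ring
    simp only [e] at h0
    have d0 := slice_cont (f ^ 2) t
    have d1 := slice_cont (g ^ 2) t
    rw [integral_add, integral_add, integral_const_mul, integral_const_mul] at h0
    · rw [I_apply, I_apply]; linarith
    all_goals
      apply cont_integrableOn
      fun_prop
  have := discrim_le_zero key
  rw [discrim] at this
  nlinarith

theorem lady (f : SF) (t K : ℝ)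
    (hK : I t (f ^ 2) ≤ K * (I t ((dX f) ^ 2) + I t ((dY f) ^ 2))) :
    I t (f ^ 4) ≤ (2 * K + 8) * I t (f ^ 2) * (I t ((dX f) ^ 2) + I t ((dY f) ^ 2)) := by
  have h := lady_aux (f ^ 2) t
  have c0 := cont_XY f.cont.abs t
  have c1 := cont_XY (dX f).cont.abs t
  have c2 := cont_XY (dY f).cont.abs t
  have d0 := slice_cont (f ^ 2) t
  have hX : ∀ (D : Derivation ℝ SF SF), (∫ z in Ω, (|(f ^ 2).1 (t, z)| + |(D (f ^ 2)).1 (t, z)|))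
      = I t (f ^ 2) + 2 * ∫ z in Ω, |f.1 (t, z)| * |(D f).1 (t, z)| := by
    intro D
    have c3 := cont_XY (D f).cont.abs t
    rw [I_apply, ← integral_const_mul, ← integral_add]
    · congr 1
      funext z
      simp only [← ev_apply, Derivation.leibniz_pow, map_pow, map_ofNat, smul_eq_mul, map_mul,
        nsmul_eq_mul, Nat.cast_ofNat, abs_mul, abs_pow, sq_abs, Nat.add_one_sub_one, pow_one,
        abs_two]
    all_goals
      apply cont_integrableOn
      fun_prop
  rw [hX, hX] at h
  have e4 : (f ^ 2) ^ 2 = f ^ 4 := by ring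
  rw [e4] at h
  have k1 := cs_aux f (dX f) t
  have k2 := cs_aux f (dY f) t
  set m := I t (f ^ 2)
  set n1 := I t ((dX f) ^ 2)
  set n2 := I t ((dY f) ^ 2)
  set X := ∫ z in Ω, |f.1 (t, z)| * |(dX f).1 (t, z)|
  set Y := ∫ z in Ω, |f.1 (t, z)| * |(dY f).1 (t, z)|
  have hm : 0 ≤ m := I_nonneg fun x _ => by rw [map_pow]; positivity
  have hn1 : 0 ≤ n1 := I_nonneg fun x _ => by rw [map_pow]; positivity
  have hn2 : 0 ≤ n2 := I_nonneg fun x _ => by rw [map_pow]; positivity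
  have hmm : m * m ≤ m * (K * (n1 + n2)) := mul_le_mul_of_nonneg_left hK hm
  nlinarith [sq_nonneg (m + 2 * X - (m + 2 * Y)), sq_nonneg (m - 2 * X), sq_nonneg (m - 2 * Y),
    mul_nonneg hm hn1, mul_nonneg hm hn2]

theorem poincare_mean (f : SF) (t : ℝ) (h0 : I t f = 0) :
    I t (f ^ 2) ≤ 40 * (I t ((dX f) ^ 2) + I t ((dY f) ^ 2)) := by
  set L := 2 * π with hLdef
  have hL : 0 < L := by positivity
  have hL2 : L ^ 2 ≤ 40 := by
    have := Real.pi_lt_d2; have := Real.pi_pos; nlinarith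
  have d0 := slice_cont f t
  have d1 := slice_cont (f ^ 2) t
  have dx := slice_cont ((dX f) ^ 2) t
  have dy := slice_cont ((dY f) ^ 2) t
  have dy1 := slice_cont (dY f) t
  set M := fun y => ∫ x in (0:ℝ)..L, f.1 (t, x, y) with hM
  set M' := fun y => ∫ x in (0:ℝ)..L, (dY f).1 (t, x, y) with hM'
  have cM : Continuous M := cont_intX d0
  have cM' : Continuous M' := cont_intX dy1
  have hMd : ∀ y, HasDerivAt M (M' y) y := by
    intro y
    have hc : IsCompact (Set.Icc (0:ℝ) L ×ˢ Set.Icc (y - 1) (y + 1)) :=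
      isCompact_Icc.prod isCompact_Icc
    obtain ⟨C, hC⟩ := hc.exists_bound_of_continuousOn dy1.continuousOn
    refine (intervalIntegral.hasDerivAt_integral_of_dominated_loc_of_deriv_le (μ := volume)
      (F := fun y x => f.1 (t, x, y)) (F' := fun y x => (dY f).1 (t, x, y))
      (bound := fun _ => C) (x₀ := y) (s := Set.Icc (y - 1) (y + 1))
      (Icc_mem_nhds (by linarith) (by linarith)) ?_ ?_ ?_ ?_ ?_ ?_).2
    · exact Eventually.of_forall fun s => (cont_X f.cont t s).aestronglyMeasurable
    · exact (cont_X f.cont t y).intervalIntegrable _ _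
    · exact (cont_X (dY f).cont t y).aestronglyMeasurable
    · refine Eventually.of_forall fun x hx s hs => hC (x, s) ⟨?_, hs⟩
      rw [Set.uIoc_of_le hL.le] at hx
      exact ⟨hx.1.le, hx.2⟩
    · simp
    · exact Eventually.of_forall fun x _ s _ => hasDerivAt_Y f t x s
  have hM0 : ∫ y in (0:ℝ)..1, M y = 0 := by
    rw [I_apply, setInt_iter' d0] at h0; exact h0
  have hP := oneD_poincare one_pos hMd cM'
  rw [hM0] at hP
  have hM'b : ∫ y in (0:ℝ)..1, (M' y) ^ 2 ≤ L * I t ((dY f) ^ 2) := by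
    rw [I_apply, setInt_iter' dy, ← intervalIntegral.integral_const_mul]
    apply intervalIntegral.integral_mono_on zero_le_one
    · exact (cM'.pow 2).intervalIntegrable _ _
    · exact ((cont_intX dy).const_mul L).intervalIntegrable _ _
    intro y _
    exact oneD_cs hL (cont_X (dY f).cont t y)
  have hmain : I t (f ^ 2) ≤ L ^ 2 * I t ((dX f) ^ 2) + L⁻¹ * ∫ y in (0:ℝ)..1, (M y) ^ 2 := by
    rw [I_apply, I_apply, setInt_iter' d1, setInt_iter' dx, ← intervalIntegral.integral_const_mul,
      ← intervalIntegral.integral_const_mul, ← intervalIntegral.integral_add]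
    · apply intervalIntegral.integral_mono_on zero_le_one
      · exact (cont_intX d1).intervalIntegrable _ _
      · exact (((cont_intX dx).const_mul _).add ((cM.pow 2).const_mul _)).intervalIntegrable _ _
      intro y _
      exact oneD_poincare hL (fun x => hasDerivAt_X f t x y) (cont_X (dX f).cont t y)
    · exact ((cont_intX dx).const_mul _).intervalIntegrable _ _
    · exact ((cM.pow 2).const_mul _).intervalIntegrable _ _
  have hn1 : 0 ≤ I t ((dX f) ^ 2) := I_nonneg fun x _ => by rw [map_pow]; positivity
  have hn2 : 0 ≤ I t ((dY f) ^ 2) := I_nonneg fun x _ => by rw [map_pow]; positivity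
  have h5 : L⁻¹ * ∫ y in (0:ℝ)..1, (M y) ^ 2 ≤ L⁻¹ * (L * I t ((dY f) ^ 2)) := by
    gcongr
    linarith
  rw [inv_mul_cancel_left₀ hL.ne'] at h5
  nlinarith

/-- The coordinate function `x₂`. -/
def Yc : SF := ⟨fun z => z.2.2, by
  show ContDiff ℝ (⊤ : ℕ∞) (fun z : E3 => z.2.2)
  fun_prop⟩

theorem pdv_Yc (v : E3) : pdv v Yc = algebraMap ℝ SF v.2.2 := by
  apply Subtype.ext
  funext z
  show fderiv ℝ (fun z : E3 => z.2.2) z v = v.2.2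
  have : HasFDerivAt (fun z : E3 => z.2.2)
      ((ContinuousLinearMap.snd ℝ ℝ ℝ).comp (ContinuousLinearMap.snd ℝ ℝ (ℝ × ℝ))) z :=
    ((ContinuousLinearMap.snd ℝ ℝ ℝ).comp (ContinuousLinearMap.snd ℝ ℝ (ℝ × ℝ))).hasFDerivAt
  rw [this.fderiv]; rfl

theorem dT_Yc : dT Yc = 0 := by rw [dT, pdv_Yc]; exact map_zero _
theorem dX_Yc : dX Yc = 0 := by rw [dX, pdv_Yc]; exact map_zero _
theorem dY_Yc : dY Yc = 1 := by rw [dY, pdv_Yc]; exact map_one _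
theorem ev_Yc (z : E3) : ev z Yc = z.2.2 := rfl

theorem poincare_dir (f : SF) (t : ℝ) (h0 : ∀ x, f.1 (t, x, 0) = 0) (h1 : ∀ x, f.1 (t, x, 1) = 0) :
    I t (f ^ 2) ≤ 4 * I t ((dY f) ^ 2) := by
  have h : I t (dY (Yc * f * f)) = 0 := by
    apply I_dY <;> intro x
    · show _ * f.1 (t, x, 0) = 0
      rw [h0, mul_zero]
    · show _ * f.1 (t, x, 1) = 0
      rw [h1, mul_zero]
  have h2 : I t (f ^ 2 - (4:ℝ) • (dY f) ^ 2) ≤ I t ((2:ℝ) • dY (Yc * f * f)) := by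
    apply I_mono
    rintro ⟨x, y⟩ hx
    have hy : 0 < y ∧ y < 1 := hx.2
    simp only [Derivation.leibniz, dY_Yc, map_add, map_sub, map_smul, smul_eq_mul, map_mul,
      map_pow, map_one, ev_Yc]
    set u := ev (t, x, y) f
    set v := ev (t, x, y) (dY f)
    nlinarith [sq_nonneg (u + 2 * y * v), mul_nonneg (sub_nonneg.2 hy.2.le) (add_nonneg zero_le_one hy.1.le), mul_nonneg (mul_nonneg (sub_nonneg.2 hy.2.le) (add_nonneg zero_le_one hy.1.le)) (sq_nonneg v)]
  simp only [map_sub, map_smul, smul_eq_mul, h] at h2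
  linarith

/-! ### The abstract system -/

/-- Parameters of the abstract system. -/
structure Par where
  μ : ℝ
  lam : ℝ
  r : ℝ
  κ : ℝ
  g : ℝ
  e : ℝ
  K : ℝ
  T : ℝ

/-- Fields of the abstract system. -/
structure Fld where
  φ : SF
  p : SF
  q : SF
  θ : SF
  τ : SF
  σ : SF

def Fld.D (f : Fld) : SF := dX f.p + dY f.q

def Fld.mass (f : Fld) : SF :=
  dT f.φ + (Yc + f.p) * dX f.φ + f.q * dY f.φ + (f.σ + f.φ) * (dX f.p + dY f.q) + f.q * dY f.σ

def Fld.Q (f : Fld) (P : Par) : SF :=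
  (2 * P.μ) • (dX f.p * dX f.p + dY f.q * dY f.q)
    + P.μ • ((dX f.q + dY f.p) * (dX f.q + dY f.p))
    + (2 * P.μ) • (dX f.q + dY f.p)
    + (P.r * P.μ) • ((dX f.p + dY f.q) * (dX f.p + dY f.q))

structure Sys (P : Par) (f : Fld) : Prop where
  hμ : 0 < P.μ
  hlam : 0 < P.lam
  hκ : 0 < P.κ
  hg : 0 < P.g
  hK : 1 ≤ P.K
  he : 100 * P.K ≤ P.e
  mass : ∀ s ∈ Set.Icc 0 P.T, ∀ x ∈ Ω, ev (s, x) f.mass = 0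
  mom1 : ∀ s ∈ Set.Icc 0 P.T, ∀ x ∈ Ω, ev (s, x)
    ((f.σ + f.φ) * (dT f.p + (Yc + f.p) * dX f.p + f.q * dY f.p + f.q)
      + (P.e ^ 2) • ((f.τ + f.θ) * dX f.φ + (f.σ + f.φ) * dX f.θ)
      - P.μ • (dX (dX f.p) + dY (dY f.p)) - P.lam • (dX (dX f.p) + dX (dY f.q))) = 0
  mom2 : ∀ s ∈ Set.Icc 0 P.T, ∀ x ∈ Ω, ev (s, x)
    ((f.σ + f.φ) * (dT f.q + (Yc + f.p) * dX f.q + f.q * dY f.q)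
      + (P.e ^ 2) • ((f.τ + f.θ) * dY f.φ + (f.σ + f.φ) * dY f.θ + dY f.σ * f.θ + f.φ * dY f.τ)
      - P.μ • (dX (dX f.q) + dY (dY f.q)) - P.lam • (dX (dY f.p) + dY (dY f.q))) = 0
  ener : ∀ s ∈ Set.Icc 0 P.T, ∀ x ∈ Ω, ev (s, x)
    ((P.e ^ 2 * P.g) • ((f.σ + f.φ) * (dT f.θ + (Yc + f.p) * dX f.θ + f.q * dY f.θ
        + f.q * dY f.τ))
      + (P.e ^ 2) • ((f.σ + f.φ) * (f.τ + f.θ) * (dX f.p + dY f.q))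
      - (P.κ * P.e ^ 2) • (dX (dX f.θ) + dY (dY f.θ)) - f.Q P) = 0
  dTσ : dT f.σ = 0
  dXσ : dX f.σ = 0
  dTτ : dT f.τ = 0
  dXτ : dX f.τ = 0
  perφ : IsPer f.φ
  perp : IsPer f.p
  perq : IsPer f.q
  perθ : IsPer f.θ
  bp : ∀ s ∈ Set.Icc 0 P.T, ∀ x y, (y = 0 ∨ y = 1) → ev (s, x, y) f.p = 0
  bq : ∀ s ∈ Set.Icc 0 P.T, ∀ x y, (y = 0 ∨ y = 1) → ev (s, x, y) f.q = 0
  bθ : ∀ s ∈ Set.Icc 0 P.T, ∀ x y, (y = 0 ∨ y = 1) → ev (s, x, y) f.θ = 0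
  mean : I 0 f.φ = 0
  φL2 : ∀ s ∈ Set.Icc 0 P.T, P.e ^ 4 * I s (f.φ ^ 2) ≤ P.K
  bdφ : ∀ s ∈ Set.Icc 0 P.T, ∀ x ∈ Ω, P.e * |ev (s, x) f.φ| ≤ P.K
  bdθ : ∀ s ∈ Set.Icc 0 P.T, ∀ x ∈ Ω, P.e * |ev (s, x) f.θ| ≤ P.K
  bdp : ∀ s ∈ Set.Icc 0 P.T, ∀ x ∈ Ω, |ev (s, x) f.p| ≤ P.K
  bdq : ∀ s ∈ Set.Icc 0 P.T, ∀ x ∈ Ω, |ev (s, x) f.q| ≤ P.K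
  bdφ1 : ∀ s ∈ Set.Icc 0 P.T, ∀ x ∈ Ω, |ev (s, x) (dX f.φ)| ≤ P.K
  bdφ2 : ∀ s ∈ Set.Icc 0 P.T, ∀ x ∈ Ω, |ev (s, x) (dY f.φ)| ≤ P.K
  bdp1 : ∀ s ∈ Set.Icc 0 P.T, ∀ x ∈ Ω, |ev (s, x) (dX f.p)| ≤ P.K * P.e
  bdp2 : ∀ s ∈ Set.Icc 0 P.T, ∀ x ∈ Ω, |ev (s, x) (dY f.p)| ≤ P.K * P.e
  bdq1 : ∀ s ∈ Set.Icc 0 P.T, ∀ x ∈ Ω, |ev (s, x) (dX f.q)| ≤ P.K * P.e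
  bdq2 : ∀ s ∈ Set.Icc 0 P.T, ∀ x ∈ Ω, |ev (s, x) (dY f.q)| ≤ P.K * P.e
  bdτ : ∀ s, ∀ x ∈ Ω, P.e * |ev (s, x) f.τ - 1| ≤ P.K
  bdσ : ∀ s, ∀ x ∈ Ω, P.e * |ev (s, x) f.σ - 1| ≤ P.K
  bdτ2 : ∀ s, ∀ x ∈ Ω, P.e * |ev (s, x) (dY f.τ)| ≤ P.K
  bdσ2 : ∀ s, ∀ x ∈ Ω, P.e * |ev (s, x) (dY f.σ)| ≤ P.K
  bdσ22 : ∀ s, ∀ x ∈ Ω, P.e * |ev (s, x) (dY (dY f.σ))| ≤ P.K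

/-! ### Periodicity calculus -/

theorem IsPer.add {f g : SF} (hf : IsPer f) (hg : IsPer g) : IsPer (f + g) := fun t x y => by
  show f.1 _ + g.1 _ = f.1 _ + g.1 _
  rw [hf, hg]
theorem IsPer.sub {f g : SF} (hf : IsPer f) (hg : IsPer g) : IsPer (f - g) := fun t x y => by
  show f.1 _ - g.1 _ = f.1 _ - g.1 _
  rw [hf, hg]
theorem IsPer.mul {f g : SF} (hf : IsPer f) (hg : IsPer g) : IsPer (f * g) := fun t x y => by
  show f.1 _ * g.1 _ = f.1 _ * g.1 _
  rw [hf, hg]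
theorem IsPer.smul {f : SF} (c : ℝ) (hf : IsPer f) : IsPer (c • f) := fun t x y => by
  show c * f.1 _ = c * f.1 _
  rw [hf]
theorem IsPer.pdv {f : SF} (v : E3) (hf : IsPer f) : IsPer (pdv v f) := fun t x y => by
  show fderiv ℝ f.1 _ v = fderiv ℝ f.1 _ v
  have h : (fun z : E3 => f.1 (z + (0, 2 * π, 0))) = f.1 := by
    funext z
    have := hf z.1 z.2.1 z.2.2
    have e : z + (0, 2 * π, 0) = (z.1, z.2.1 + 2 * π, z.2.2) := by ext <;> simp
    simpa only [e] using this
  conv_rhs => rw [← h]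
  rw [fderiv_comp_add_right]
  simp
theorem IsPer.dT {f : SF} (hf : IsPer f) : IsPer (dT f) := hf.pdv _
theorem IsPer.dX {f : SF} (hf : IsPer f) : IsPer (dX f) := hf.pdv _
theorem IsPer.dY {f : SF} (hf : IsPer f) : IsPer (dY f) := hf.pdv _
theorem IsPer.Yc : IsPer Yc := fun _ _ _ => rfl
theorem IsPer.of_dX {f : SF} (hf : Couette.dX f = 0) : IsPer f := fun t x y => by
  have h : ∀ a, HasDerivAt (fun s => f.1 (t, s, y)) 0 a := by
    intro a
    have := hasDerivAt_X f t a y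
    rw [hf] at this
    exact this
  exact is_const_of_deriv_eq_zero (fun a => (h a).differentiableAt) (fun a => (h a).deriv) _ _

/-! ### Localization -/

theorem ev_pdv_zero {f : SF} {T : ℝ} (v : E3) (h : ∀ s ∈ Set.Icc 0 T, ∀ x ∈ Ω, ev (s, x) f = 0)
    {s : ℝ} (hs : s ∈ Set.Ioo 0 T) {x : ℝ × ℝ} (hx : x ∈ Ω) : ev (s, x) (pdv v f) = 0 := by
  show fderiv ℝ f.1 (s, x) v = 0
  have : f.1 =ᶠ[𝓝 (s, x)] fun _ => 0 := by
    have hU : (Set.Ioo 0 T) ×ˢ Ω ∈ 𝓝 (s, x) := (isOpen_Ioo.prod Ω_open).mem_nhds ⟨hs, hx⟩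
    filter_upwards [hU] with z hz
    exact h z.1 ⟨hz.1.1.le, hz.1.2.le⟩ z.2 hz.2
  rw [this.fderiv_eq]; simp

theorem bdry_dX {f : SF} {s y : ℝ} (h : ∀ x, ev (s, x, y) f = 0) (x : ℝ) :
    ev (s, x, y) (dX f) = 0 := by
  have h1 := hasDerivAt_X f s x y
  have h2 : (fun a => f.1 (s, a, y)) = fun _ => 0 := funext h
  rw [h2] at h1
  exact h1.unique (hasDerivAt_const x (0:ℝ))

theorem bdry_dT {f : SF} {T x y : ℝ} (h : ∀ s ∈ Set.Icc 0 T, ev (s, x, y) f = 0) {s : ℝ}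
    (hs : s ∈ Set.Ioo 0 T) : ev (s, x, y) (dT f) = 0 := by
  have h1 := hasDerivAt_T f s x y
  have h2 : (fun a => f.1 (a, x, y)) =ᶠ[𝓝 s] fun _ => 0 := by
    filter_upwards [isOpen_Ioo.mem_nhds hs] with a ha
    exact h a ⟨ha.1.le, ha.2.le⟩
  exact (h1.congr_of_eventuallyEq h2.symm).unique (hasDerivAt_const s (0:ℝ))

/-! ### Elementary inequalities -/

theorem yng {a A x y : ℝ} (h : |a| ≤ A) : a * (x * y) ≤ A * (x ^ 2 + y ^ 2) / 2 := by
  have h1 : a * (x * y) ≤ |a| * (|x| * |y|) := by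
    rw [← abs_mul, ← abs_mul]; exact le_abs_self _
  have h2 : |x| * |y| ≤ (x ^ 2 + y ^ 2) / 2 := by
    nlinarith [sq_nonneg (|x| - |y|), sq_abs x, sq_abs y]
  have h3 : |a| * (|x| * |y|) ≤ A * ((x ^ 2 + y ^ 2) / 2) :=
    mul_le_mul h h2 (by positivity) ((abs_nonneg a).trans h)
  linarith

theorem yngd {a A d : ℝ} (x y : ℝ) (hd : 0 < d) (h : |a| ≤ A) :
    a * (x * y) ≤ d * x ^ 2 + A ^ 2 / (4 * d) * y ^ 2 := by
  have h1 : a ^ 2 ≤ A ^ 2 := by rw [← sq_abs]; gcongr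
  have e1 : d * x ^ 2 + A ^ 2 / (4 * d) * y ^ 2 - a * (x * y)
     = (d * x - a * y / 2) ^ 2 / d + (A ^ 2 - a ^ 2) * y ^ 2 / (4 * d) := by
    field_simp; ring
  have e2 : 0 ≤ (d * x - a * y / 2) ^ 2 / d := by positivity
  have e3 : 0 ≤ (A ^ 2 - a ^ 2) * y ^ 2 / (4 * d) := by
    have := sub_nonneg.2 h1; positivity
  linarith

theorem am {a b A B : ℝ} (ha : |a| ≤ A) (hb : |b| ≤ B) : |a * b| ≤ A * B := by
  rw [abs_mul]; exact mul_le_mul ha hb (abs_nonneg _) ((abs_nonneg _).trans ha)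

theorem yS {a A x y S : ℝ} (h : |a| ≤ A) (hx : x ^ 2 ≤ S) (hy : y ^ 2 ≤ S) :
    a * (x * y) ≤ A * S := by
  have hA := (abs_nonneg a).trans h
  have := yng (x := x) (y := y) h
  have : A * (x ^ 2 + y ^ 2) ≤ A * (S + S) := by gcongr
  linarith

theorem yS' {a A x y S : ℝ} (h : |a| ≤ A) (hx : x ^ 2 ≤ S) (hy : y ^ 2 ≤ S) :
    -(a * (x * y)) ≤ A * S := by
  have := yS (a := -a) (A := A) (by rwa [abs_neg]) hx hy
  linarith

theorem yD {a A d x y S : ℝ} (hd : 0 < d) (h : |a| ≤ A) (hy : y ^ 2 ≤ S) :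
    a * (x * y) ≤ d * x ^ 2 + A ^ 2 / (4 * d) * S := by
  have := yngd x y hd h
  have : A ^ 2 / (4 * d) * y ^ 2 ≤ A ^ 2 / (4 * d) * S := by gcongr
  linarith

theorem yD' {a A d x y S : ℝ} (hd : 0 < d) (h : |a| ≤ A) (hy : y ^ 2 ≤ S) :
    -(a * (x * y)) ≤ d * x ^ 2 + A ^ 2 / (4 * d) * S := by
  have := yD (x := x) (a := -a) (A := A) hd (by rwa [abs_neg]) hy
  linarith

/-- Pointwise consequences of the a priori bounds. -/
structure PtB (e K δ σ τ φ θ p q σ' τ' y : ℝ) : Prop where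
  he : 0 < e
  hK : 1 ≤ K
  hδe : δ * e = K
  hδ : δ ≤ 1 / 100
  σ1 : |σ - 1| ≤ δ
  τ1 : |τ - 1| ≤ δ
  φ1 : |φ| ≤ δ
  θ1 : |θ| ≤ δ
  σ2 : |σ'| ≤ δ
  τ2 : |τ'| ≤ δ
  pb : |p| ≤ K
  qb : |q| ≤ K
  yb : |y| ≤ 1

namespace PtB
variable {e K δ σ τ φ θ p q σ' τ' y : ℝ}
theorem eδ (h : PtB e K δ σ τ φ θ p q σ' τ' y) {a c : ℝ} (ha : |a| ≤ c * δ) : |e * a| ≤ c * K := by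
  rw [abs_mul, abs_of_pos h.he, ← h.hδe]
  have := mul_le_mul_of_nonneg_left ha h.he.le
  linarith
theorem δ0 (h : PtB e K δ σ τ φ θ p q σ' τ' y) : 0 ≤ δ := (abs_nonneg _).trans h.φ1
theorem σhi (h : PtB e K δ σ τ φ θ p q σ' τ' y) : |σ| ≤ 2 := by
  have := abs_le.1 h.σ1; have := h.hδ; rw [abs_le]; constructor <;> linarith
theorem τhi (h : PtB e K δ σ τ φ θ p q σ' τ' y) : |τ| ≤ 2 := by
  have := abs_le.1 h.τ1; have := h.hδ; rw [abs_le]; constructor <;> linarith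
theorem ρhi (h : PtB e K δ σ τ φ θ p q σ' τ' y) : |σ + φ| ≤ 2 := by
  have := abs_le.1 h.σ1; have := abs_le.1 h.φ1; have := h.hδ; rw [abs_le]; constructor <;> linarith
theorem Thi (h : PtB e K δ σ τ φ θ p q σ' τ' y) : |τ + θ| ≤ 2 := by
  have := abs_le.1 h.τ1; have := abs_le.1 h.θ1; have := h.hδ; rw [abs_le]; constructor <;> linarith
theorem ρlo (h : PtB e K δ σ τ φ θ p q σ' τ' y) : 1 / 2 ≤ σ + φ := by
  have := abs_le.1 h.σ1; have := abs_le.1 h.φ1; have := h.hδ; linarith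
theorem σlo (h : PtB e K δ σ τ φ θ p q σ' τ' y) : 1 / 2 ≤ σ := by
  have := abs_le.1 h.σ1; have := h.hδ; linarith
theorem τlo (h : PtB e K δ σ τ φ θ p q σ' τ' y) : 1 / 2 ≤ τ := by
  have := abs_le.1 h.τ1; have := h.hδ; linarith
theorem ρ1 (h : PtB e K δ σ τ φ θ p q σ' τ' y) : |e * (σ + φ - 1)| ≤ 2 * K := by
  apply h.eδ
  have := abs_le.1 h.σ1; have := abs_le.1 h.φ1; rw [abs_le]; constructor <;> linarith
theorem T1 (h : PtB e K δ σ τ φ θ p q σ' τ' y) : |e * (τ + θ - 1)| ≤ 2 * K := by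
  apply h.eδ
  have := abs_le.1 h.τ1; have := abs_le.1 h.θ1; rw [abs_le]; constructor <;> linarith
theorem σT (h : PtB e K δ σ τ φ θ p q σ' τ' y) : |e * (σ - τ - θ)| ≤ 3 * K := by
  apply h.eδ
  have := abs_le.1 h.σ1; have := abs_le.1 h.τ1; have := abs_le.1 h.θ1
  rw [abs_le]; constructor <;> linarith
theorem eσ' (h : PtB e K δ σ τ φ θ p q σ' τ' y) : |e * σ'| ≤ 1 * K := h.eδ (by linarith [h.σ2])
theorem eτ' (h : PtB e K δ σ τ φ θ p q σ' τ' y) : |e * τ'| ≤ 1 * K := h.eδ (by linarith [h.τ2])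
theorem eφ (h : PtB e K δ σ τ φ θ p q σ' τ' y) : |e * φ| ≤ 1 * K := h.eδ (by linarith [h.φ1])
theorem eθ (h : PtB e K δ σ τ φ θ p q σ' τ' y) : |e * θ| ≤ 1 * K := h.eδ (by linarith [h.θ1])
theorem yp (h : PtB e K δ σ τ φ θ p q σ' τ' y) : |y + p| ≤ 1 + K := (abs_add_le _ _).trans (add_le_add h.yb h.pb)
theorem e1 (h : PtB e K δ σ τ φ θ p q σ' τ' y) : 1 ≤ e := by
  have := h.hδ; have := h.hδe; have := h.hK; have := h.he; have := h.δ0; nlinarith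
end PtB

theorem Sys.pt {P : Par} {f : Fld} (h : Sys P f) {s : ℝ} (hs : s ∈ Set.Icc 0 P.T) {x : ℝ × ℝ}
    (hx : x ∈ Ω) : PtB P.e P.K (P.K / P.e) (ev (s, x) f.σ) (ev (s, x) f.τ) (ev (s, x) f.φ)
      (ev (s, x) f.θ) (ev (s, x) f.p) (ev (s, x) f.q) (ev (s, x) (dY f.σ)) (ev (s, x) (dY f.τ))
      (ev (s, x) Yc) := by
  have hK := h.hK
  have he := h.he
  have e0 : 0 < P.e := by linarith
  have key : ∀ {a : ℝ}, P.e * |a| ≤ P.K → |a| ≤ P.K / P.e := by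
    intro a ha; rw [le_div_iff₀ e0]; linarith
  refine ⟨e0, hK, by field_simp, ?_, key (h.bdσ s x hx), key (h.bdτ s x hx), key (h.bdφ s hs x hx),
    key (h.bdθ s hs x hx), key (h.bdσ2 s x hx), key (h.bdτ2 s x hx), h.bdp s hs x hx,
    h.bdq s hs x hx, ?_⟩
  · rw [div_le_iff₀ e0]; linarith
  · rw [ev_Yc, abs_of_pos hx.2.1]; exact hx.2.2.le

/-- The constant in the basic estimate. -/
def M0 (P : Par) : ℝ :=
  20 + 40 * P.K + 4 * P.g * P.K + 40 * ((P.μ + P.lam + |P.r| * P.μ) * (P.K / P.e))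

theorem E0_real {μ lam r g e K δ σ σ' τ τ' φ p q θ p1 p2 q1 q2 y S : ℝ}
    (h : PtB e K δ σ τ φ θ p q σ' τ' y) (hμ : 0 < μ) (hlam : 0 < lam) (hg : 0 < g)
    (hS : S = p ^ 2 + q ^ 2 + p1 ^ 2 + p2 ^ 2 + q1 ^ 2 + q2 ^ 2 + (e * θ) ^ 2
      + (e ^ 2 * φ ^ 2) ^ 2) :
    - σ * (σ + φ) * p * q - μ * σ' * (p * p2 + q * q2) - lam * σ' * q * (p1 + q2)
      + 1 / 2 * (σ + φ) * q * σ' * (p ^ 2 + q ^ 2)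
      + e ^ 2 * (σ + φ) * θ * (σ * (p1 + q2) + σ' * q)
      - 1 / 2 * e ^ 2 * τ * φ ^ 2 * (p1 + q2) + 1 / 2 * e ^ 2 * φ ^ 2 * q * τ'
      - e ^ 2 * g * (σ + φ) * q * τ' * θ - e ^ 2 * (σ + φ) * (τ + θ) * θ * (p1 + q2)
      + θ * (2 * μ * (p1 * p1 + q2 * q2) + μ * ((q1 + p2) * (q1 + p2)) + 2 * μ * (q1 + p2)
        + r * μ * ((p1 + q2) * (p1 + q2)))
    ≤ (20 + 40 * K + 4 * g * K + 40 * ((μ + lam + |r| * μ) * δ)) * S := by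
  have n1 := sq_nonneg p
  have n2 := sq_nonneg q
  have n3 := sq_nonneg p1
  have n4 := sq_nonneg p2
  have n5 := sq_nonneg q1
  have n6 := sq_nonneg q2
  have n7 := sq_nonneg (e * θ)
  have n8 := sq_nonneg (e ^ 2 * φ ^ 2)
  have hp : p ^ 2 ≤ S := by linarith
  have hq : q ^ 2 ≤ S := by linarith
  have hp1 : p1 ^ 2 ≤ S := by linarith
  have hp2 : p2 ^ 2 ≤ S := by linarith
  have hq1 : q1 ^ 2 ≤ S := by linarith
  have hq2 : q2 ^ 2 ≤ S := by linarith
  have hθ : (e * θ) ^ 2 ≤ S := by linarith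
  have hφ : (e ^ 2 * φ ^ 2) ^ 2 ≤ S := by linarith
  have hS0 : 0 ≤ S := by linarith
  have K0 : 0 ≤ K := by linarith [h.hK]
  have δ0 := h.δ0
  have aμ : |μ| ≤ μ := (abs_of_pos hμ).le
  have al : |lam| ≤ lam := (abs_of_pos hlam).le
  have ag : |g| ≤ g := (abs_of_pos hg).le
  have t1 := yS' (am h.σhi h.ρhi) hp hq
  have t2 := yS' (am aμ h.σ2) hp hp2
  have t3 := yS' (am aμ h.σ2) hq hq2
  have t4 := yS' (am al h.σ2) hq hp1
  have t5 := yS' (am al h.σ2) hq hq2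
  have s4 := am (am h.ρhi h.qb) h.σ2
  have t6 := yS s4 hp hp
  have t7 := yS s4 hq hq
  have t8 := yS (am h.ρhi h.σT) hθ hp1
  have t9 := yS (am h.ρhi h.σT) hθ hq2
  have t10 := yS (am h.ρhi h.eσ') hθ hq
  have t11 := yS' h.τhi hφ hp1
  have t12 := yS' h.τhi hφ hq2
  have t13 := yS h.τ2 hφ hq
  have t14 := yS' (am (am ag h.ρhi) h.eτ') hq hθ
  have aμθ := am aμ h.θ1
  have t15 := yS aμθ hp1 hp1
  have t16 := yS aμθ hq2 hq2
  have t17 := yS aμθ hq1 hq1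
  have t18 := yS aμθ hp2 hp2
  have t19 := yS aμθ hq1 hp2
  have ie : |e⁻¹| ≤ δ := by
    have e0 := h.he
    rw [abs_of_pos (by positivity), inv_le_iff_one_le_mul₀ e0, h.hδe]; exact h.hK
  have t20 := yS (am aμ ie) hθ hq1
  have t21 := yS (am aμ ie) hθ hp2
  have ar : |r * μ * θ| ≤ |r| * μ * δ := am (am le_rfl aμ) h.θ1
  have t22 := yS ar hp1 hp1
  have t23 := yS ar hq2 hq2
  have t24 := yS ar hp1 hq2
  have ee : e⁻¹ * e = 1 := inv_mul_cancel₀ h.he.ne'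
  have t20' : μ * (θ * q1) ≤ μ * δ * S := by
    refine le_trans (le_of_eq ?_) t20
    linear_combination (-(μ * (θ * q1))) * ee
  have t21' : μ * (θ * p2) ≤ μ * δ * S := by
    refine le_trans (le_of_eq ?_) t21
    linear_combination (-(μ * (θ * p2))) * ee
  have m1 : 0 ≤ μ * δ * S := by positivity
  have m2 : 0 ≤ lam * δ * S := by positivity
  have m3 : 0 ≤ |r| * μ * δ * S := by positivity
  have m4 : 0 ≤ K * S := by positivity
  have m6 : 0 ≤ g * K * S := by positivity
  have m5 : K * δ * S ≤ K * 1 * S := by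
    have := h.hδ
    gcongr; linarith
  have m7 : δ * S ≤ 1 * S := by
    have := h.hδ
    gcongr; linarith
  clear ee ie n1 n2 n3 n4 n5 n6 n7 n8 hp hq hp1 hp2 hq1 hq2 hθ hφ K0 δ0 hS t20 t21 ar aμθ s4 aμ al ag
  linarith

/-! ### The basic estimate -/

def Fld.G0 (f : Fld) (P : Par) : SF :=
  (1 / 2 : ℝ) • ((f.σ + f.φ) * f.σ * (f.p * f.p + f.q * f.q))
    + (P.e ^ 2 / 2) • (f.τ * (f.φ * f.φ)) + (P.e ^ 2 * P.g / 2) • ((f.σ + f.φ) * (f.θ * f.θ))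

def Fld.gψ (f : Fld) : SF := (dX f.p) ^ 2 + (dY f.p) ^ 2 + (dX f.q) ^ 2 + (dY f.q) ^ 2
def Fld.gθ (f : Fld) : SF := (dX f.θ) ^ 2 + (dY f.θ) ^ 2
def Fld.gφ (f : Fld) : SF := (dX f.φ) ^ 2 + (dY f.φ) ^ 2

def Fld.Pr (f : Fld) : SF := f.τ * f.φ + f.σ * f.θ + f.φ * f.θ

def Fld.S0 (f : Fld) (P : Par) : SF :=
  f.p ^ 2 + f.q ^ 2 + f.gψ + (P.e ^ 2) • f.θ ^ 2 + (P.e ^ 4) • f.φ ^ 4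

theorem Sys.bd0 {P : Par} {f : Fld} (h : Sys P f) {s : ℝ} (hs : s ∈ Set.Icc 0 P.T) {x y : ℝ}
    (hy : y = 0 ∨ y = 1) : ev (s, x, y) f.p = 0 ∧ ev (s, x, y) f.q = 0 ∧ ev (s, x, y) f.θ = 0 :=
  ⟨h.bp s hs x y hy, h.bq s hs x y hy, h.bθ s hs x y hy⟩

theorem Sys.bdX {P : Par} {f : Fld} (h : Sys P f) {s : ℝ} (hs : s ∈ Set.Icc 0 P.T) {x y : ℝ}
    (hy : y = 0 ∨ y = 1) : ev (s, x, y) (dX f.p) = 0 ∧ ev (s, x, y) (dX f.q) = 0 :=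
  ⟨bdry_dX (fun x => h.bp s hs x y hy) x, bdry_dX (fun x => h.bq s hs x y hy) x⟩

theorem Sys.bdT {P : Par} {f : Fld} (h : Sys P f) {s : ℝ} (hs : s ∈ Set.Ioo 0 P.T) {x y : ℝ}
    (hy : y = 0 ∨ y = 1) : ev (s, x, y) (dT f.p) = 0 ∧ ev (s, x, y) (dT f.q) = 0
      ∧ ev (s, x, y) (dT f.θ) = 0 :=
  ⟨bdry_dT (fun s hs => h.bp s hs x y hy) hs, bdry_dT (fun s hs => h.bq s hs x y hy) hs,
    bdry_dT (fun s hs => h.bθ s hs x y hy) hs⟩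

theorem icc_of_ioo {s T : ℝ} (hs : s ∈ Set.Ioo 0 T) : s ∈ Set.Icc 0 T := ⟨hs.1.le, hs.2.le⟩

theorem Sys.perσ {P : Par} {f : Fld} (h : Sys P f) : IsPer f.σ := .of_dX h.dXσ
theorem Sys.perτ {P : Par} {f : Fld} (h : Sys P f) : IsPer f.τ := .of_dX h.dXτ

theorem Sys.mean0 {P : Par} {f : Fld} (h : Sys P f) {t : ℝ} (ht : t ∈ Set.Icc 0 P.T) :
    I t f.φ = 0 := by
  have key : ∀ s ∈ Set.Ioo 0 P.T, ∀ x ∈ Ω, ev (s, x) (dT f.φ)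
      = ev (s, x) (dX (-((Yc + f.p) * (f.σ + f.φ)))) + ev (s, x) (dY (-(f.q * (f.σ + f.φ)))) := by
    intro s hs x hx
    have hm := h.mass s (icc_of_ioo hs) x hx
    simp only [Fld.mass, Derivation.leibniz, map_add, map_neg, smul_eq_mul, map_mul, dX_Yc, h.dXσ,
      map_zero] at hm ⊢
    linear_combination hm
  have p1 : IsPer (-((Yc + f.p) * (f.σ + f.φ))) := by
    have := ((IsPer.Yc.add h.perp).mul (h.perσ.add h.perφ)).smul (-1)
    simpa using this
  have p1' : IsPer ((Yc + f.p) * (f.σ + f.φ)) := (IsPer.Yc.add h.perp).mul (h.perσ.add h.perφ)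
  have bz : ∀ s ∈ Set.Ioo 0 P.T, ∀ x y, (y = 0 ∨ y = 1) →
      (f.q * (f.σ + f.φ)).1 (s, x, y) = 0 := by
    intro s hs x y hy
    rw [← ev_apply, map_mul, h.bq s (icc_of_ioo hs) x y hy, zero_mul]
  have bz' : ∀ s ∈ Set.Ioo 0 P.T, ∀ x y, (y = 0 ∨ y = 1) →
      (-(f.q * (f.σ + f.φ))).1 (s, x, y) = 0 := by
    intro s hs x y hy
    rw [← ev_apply, map_neg, map_mul, h.bq s (icc_of_ioo hs) x y hy, zero_mul, neg_zero]
  have a1 := energy (G := f.φ) (A := 0) (B := 0) ht p1 (fun s hs x => bz' s hs x 0 (.inl rfl))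
    (fun s hs x => bz' s hs x 1 (.inr rfl)) (fun s hs x hx => by
      rw [key s hs x hx, map_zero]; linarith)
  have a2 := energy (G := -f.φ) (A := 0) (B := 0) ht p1' (fun s hs x => bz s hs x 0 (.inl rfl))
    (fun s hs x => bz s hs x 1 (.inr rfl)) (fun s hs x hx => by
      rw [map_neg, map_neg, key s hs x hx, map_zero]; simp only [map_neg]; linarith)
  simp only [map_neg, map_zero, h.mean] at a1 a2
  linarith

set_option linter.unusedSimpArgs false in
set_option maxHeartbeats 1000000 in
theorem Sys.E0 {P : Par} {f : Fld} (h : Sys P f) {t : ℝ} (ht : t ∈ Set.Icc 0 P.T) :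
    I t (f.G0 P) + J t ((P.μ / 2) • f.gψ + (P.κ * P.e ^ 2) • f.gθ)
      ≤ I 0 (f.G0 P) + J t (M0 P • f.S0 P) := by
  have pσ := h.perσ
  have pτ := h.perτ
  have pφ := h.perφ
  have pp := h.perp
  have pq := h.perq
  have pθ := h.perθ
  refine energy ht
    (F1 := P.μ • (f.σ * (f.p * dX f.p + f.q * dX f.q)) + P.lam • (f.σ * (f.p * (dX f.p + dY f.q)))
      + (P.κ * P.e ^ 2) • (f.θ * dX f.θ) - (Yc + f.p) * f.G0 P - (P.e ^ 2) • (f.σ * (f.p * f.Pr)))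
    (F2 := P.μ • (f.σ * (f.p * dY f.p + f.q * dY f.q)) + P.lam • (f.σ * (f.q * (dX f.p + dY f.q)))
      + (P.κ * P.e ^ 2) • (f.θ * dY f.θ) - f.q * f.G0 P - (P.e ^ 2) • (f.σ * (f.q * f.Pr)))
    ?_ ?_ ?_ ?_
  · unfold Fld.G0 Fld.Pr
    repeat' first
      | assumption
      | exact IsPer.Yc
      | apply IsPer.add
      | apply IsPer.sub
      | apply IsPer.smul
      | apply IsPer.mul
      | apply IsPer.dX
      | apply IsPer.dY
  · intro s hs x
    obtain ⟨h1, h2, h3⟩ := h.bd0 (icc_of_ioo hs) (x := x) (y := 0) (.inl rfl)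
    rw [← ev_apply]
    simp only [map_add, map_sub, map_smul, map_mul, h1, h2, h3, zero_mul, mul_zero, add_zero,
      smul_zero, sub_zero]
  · intro s hs x
    obtain ⟨h1, h2, h3⟩ := h.bd0 (icc_of_ioo hs) (x := x) (y := 1) (.inr rfl)
    rw [← ev_apply]
    simp only [map_add, map_sub, map_smul, map_mul, h1, h2, h3, zero_mul, mul_zero, add_zero,
      smul_zero, sub_zero]
  · intro s hs x hx
    have hs' := icc_of_ioo hs
    have hpt := h.pt hs' hx
    have hm := h.mass s hs' x hx
    have hm1 := h.mom1 s hs' x hx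
    have hm2 := h.mom2 s hs' x hx
    have hen := h.ener s hs' x hx
    have b := E0_real (r := P.r) (p1 := ev (s, x) (dX f.p)) (p2 := ev (s, x) (dY f.p))
      (q1 := ev (s, x) (dX f.q)) (q2 := ev (s, x) (dY f.q)) hpt h.hμ h.hlam h.hg rfl
    have k1 : 0 ≤ (ev (s, x) f.σ - 1 / 2) * P.μ * (ev (s, x) (dX f.p) ^ 2 + ev (s, x) (dY f.p) ^ 2
      + ev (s, x) (dX f.q) ^ 2 + ev (s, x) (dY f.q) ^ 2) :=
      mul_nonneg (mul_nonneg (by linarith [hpt.σlo]) h.hμ.le) (by positivity)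
    have k2 : 0 ≤ ev (s, x) f.σ * P.lam * (ev (s, x) (dX f.p) + ev (s, x) (dY f.q)) ^ 2 :=
      mul_nonneg (mul_nonneg (by linarith [hpt.σlo]) h.hlam.le) (by positivity)
    simp only [Fld.mass, Fld.Q, Fld.G0, Fld.Pr, Fld.gψ, Fld.gθ, Fld.S0, M0, Derivation.leibniz,
      map_add, map_sub, Derivation.map_smul, map_smul, smul_eq_mul, map_mul, map_pow, dX_Yc, dT_Yc, dY_Yc, h.dXσ,
      h.dTσ, h.dXτ, h.dTτ, map_zero, map_one, dX_dT, dY_dT, dY_dX] at hm hm1 hm2 hen ⊢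
    linear_combination (ev (s, x) f.σ * ev (s, x) f.p) * hm1 + (ev (s, x) f.σ * ev (s, x) f.q) * hm2
      + (1 / 2 * ev (s, x) f.σ * (ev (s, x) f.p ^ 2 + ev (s, x) f.q ^ 2)
        + P.e ^ 2 * ev (s, x) f.τ * ev (s, x) f.φ
        + 1 / 2 * P.e ^ 2 * P.g * ev (s, x) f.θ ^ 2) * hm + ev (s, x) f.θ * hen + b + k1 + k2

/-! ### Pointwise bounds for the higher order estimates -/

theorem sq_le_e {e a S : ℝ} (he : 1 ≤ e) (h : (e * a) ^ 2 ≤ S) : a ^ 2 ≤ S := by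
  have : 1 * a ^ 2 ≤ e ^ 2 * a ^ 2 := by
    gcongr
    nlinarith
  rw [mul_pow] at h
  linarith

def A1c (μ r g K : ℝ) : ℝ := 4 + 4 * g * K + 4 * μ + 2 * |r| * μ

theorem E1θ_real {μ r g e K δ σ σ' τ τ' φ p q θ p1 p2 q1 q2 θ1 θ2 θt y S : ℝ}
    (h : PtB e K δ σ τ φ θ p q σ' τ' y) (hμ : 0 < μ) (hg : 0 < g)
    (bp1 : |p1| ≤ K * e) (bp2 : |p2| ≤ K * e) (bq1 : |q1| ≤ K * e) (bq2 : |q2| ≤ K * e)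
    (hS : S = (e * θ1) ^ 2 + (e * θ2) ^ 2 + (e * q) ^ 2 + (e * p1) ^ 2 + (e * p2) ^ 2
      + (e * q1) ^ 2 + (e * q2) ^ 2) :
    - e ^ 2 * θt * (g * (σ + φ) * ((y + p) * θ1 + q * θ2 + q * τ')
        + (σ + φ) * (τ + θ) * (p1 + q2))
      + θt * (2 * μ * (p1 * p1 + q2 * q2) + μ * ((q1 + p2) * (q1 + p2)) + 2 * μ * (q1 + p2)
        + r * μ * ((p1 + q2) * (p1 + q2)))
    ≤ g / 4 * (e * θt) ^ 2 + 13 * ((A1c μ r g K) ^ 2 / (4 * (g / 52))) * S := by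
  have K1 := h.hK
  have K0 : 0 ≤ K := by linarith
  have δ0 := h.δ0
  have e0 := h.he
  have d0 : 0 < g / 52 := by positivity
  have n3 := sq_nonneg (e * θ1)
  have n4 := sq_nonneg (e * θ2)
  have n5 := sq_nonneg (e * q)
  have n6 := sq_nonneg (e * p1)
  have n7 := sq_nonneg (e * p2)
  have n8 := sq_nonneg (e * q1)
  have n9 := sq_nonneg (e * q2)
  have hθ1 : (e * θ1) ^ 2 ≤ S := by linarith
  have hθ2 : (e * θ2) ^ 2 ≤ S := by linarith
  have hq : (e * q) ^ 2 ≤ S := by linarith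
  have hp1 : (e * p1) ^ 2 ≤ S := by linarith
  have hp2 : (e * p2) ^ 2 ≤ S := by linarith
  have hq1 : (e * q1) ^ 2 ≤ S := by linarith
  have hq2 : (e * q2) ^ 2 ≤ S := by linarith
  have aμ : |μ| ≤ μ := (abs_of_pos hμ).le
  have ag : |g| ≤ g := (abs_of_pos hg).le
  have gK : g ≤ g * K := by nlinarith
  have rμ : 0 ≤ |r| * μ := by positivity
  -- small quantities
  have hu : (e ^ 2)⁻¹ * (K * e) ≤ 1 := by
    have e1 : (e ^ 2)⁻¹ * (K * e) = δ := by
      rw [← h.hδe]; field_simp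
    rw [e1]; linarith [h.hδ]
  have hu0 : 0 ≤ (e ^ 2)⁻¹ := by positivity
  have hsm : ∀ {a : ℝ}, |a| ≤ K * e → |(e ^ 2)⁻¹ * a| ≤ 1 := by
    intro a ha
    rw [abs_mul, abs_of_nonneg hu0]
    exact (mul_le_mul_of_nonneg_left ha hu0).trans hu
  have hu1 : |(e ^ 2)⁻¹| ≤ 1 := by
    have := hsm (a := 1) (by rw [abs_one]; nlinarith [h.e1])
    simpa using this
  have ar : |r * μ| ≤ |r| * μ := am le_rfl aμ
  set A := A1c μ r g K with hA
  unfold A1c at hA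
  have hgK0 : 0 ≤ g * K := by positivity
  have t1 := yD' (A := A) (x := e * θt) d0 (le_trans (am (am ag h.ρhi) h.yp) (by linarith)) hθ1
  have t2 := yD' (A := A) (x := e * θt) d0 (le_trans (am (am ag h.ρhi) h.qb) (by linarith)) hθ2
  have t3 := yD' (A := A) (x := e * θt) d0 (le_trans (am (am ag h.ρhi)
    (h.τ2.trans (by linarith [h.hδ] : δ ≤ 1))) (by linarith)) hq
  have t4 := yD' (A := A) (x := e * θt) d0 (le_trans (am h.ρhi h.Thi) (by linarith)) hp1
  have t5 := yD' (A := A) (x := e * θt) d0 (le_trans (am h.ρhi h.Thi) (by linarith)) hq2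
  have a2 : |(2:ℝ)| ≤ 2 := by norm_num
  have t6 := yD (A := A) (x := e * θt) d0 (le_trans (am (am a2 aμ) (hsm bp1)) (by linarith)) hp1
  have t7 := yD (A := A) (x := e * θt) d0 (le_trans (am (am a2 aμ) (hsm bq2)) (by linarith)) hq2
  have s1 : |(e ^ 2)⁻¹ * q1 + (e ^ 2)⁻¹ * p2| ≤ 1 + 1 :=
    (abs_add_le _ _).trans (add_le_add (hsm bq1) (hsm bp2))
  have s2 : |(e ^ 2)⁻¹ * p1 + (e ^ 2)⁻¹ * q2| ≤ 1 + 1 :=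
    (abs_add_le _ _).trans (add_le_add (hsm bp1) (hsm bq2))
  have t8 := yD (A := A) (x := e * θt) d0 (le_trans (am aμ s1) (by linarith)) hq1
  have t9 := yD (A := A) (x := e * θt) d0 (le_trans (am aμ s1) (by linarith)) hp2
  have t10 := yD (A := A) (x := e * θt) d0 (le_trans (am (am a2 aμ) hu1) (by linarith)) hq1
  have t11 := yD (A := A) (x := e * θt) d0 (le_trans (am (am a2 aμ) hu1) (by linarith)) hp2
  have t12 := yD (A := A) (x := e * θt) d0 (le_trans (am ar s2) (by linarith)) hp1
  have t13 := yD (A := A) (x := e * θt) d0 (le_trans (am ar s2) (by linarith)) hq2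
  have key : ∀ b : ℝ, (e ^ 2)⁻¹ * (e * (e * b)) = b := by intro b; field_simp
  have key2 : ∀ c b : ℝ, c = (e ^ 2)⁻¹ * (e * (e * c)) := by intro c b; field_simp
  have hw : (e ^ 2)⁻¹ * e ^ 2 = 1 := by field_simp
  generalize A ^ 2 / (4 * (g / 52)) = k at *
  generalize (e ^ 2)⁻¹ = w at *
  linear_combination t1 + t2 + t3 + t4 + t5 + t6 + t7 + t8 + t9 + t10 + t11 + t12 + t13
    + (-(θt * (2 * μ * (p1 * p1 + q2 * q2) + μ * ((q1 + p2) * (q1 + p2)) + 2 * μ * (q1 + p2)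
        + r * μ * ((p1 + q2) * (p1 + q2))))) * hw

theorem E1ψ_real {e K δ σ σ' τ τ' φ p q θ p1 p2 q1 q2 φ1 φ2 θt pt qt y S : ℝ}
    (h : PtB e K δ σ τ φ θ p q σ' τ' y)
    (hS : S = (e * φ1) ^ 2 + (e * φ2) ^ 2 + (e * θt) ^ 2 + (e * q) ^ 2 + (e * p1) ^ 2
      + (e * p2) ^ 2 + (e * q1) ^ 2 + (e * q2) ^ 2) :
    - (σ + φ) * pt * ((y + p) * p1 + q * p2 + q) - (σ + φ) * qt * ((y + p) * q1 + q * q2)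
      - e ^ 2 * ((σ + φ) * θt - (τ + θ) * ((y + p) * φ1 + q * φ2 + (σ + φ) * (p1 + q2) + q * σ'))
        * (p1 + q2)
    ≤ 1 / 4 * (pt ^ 2 + qt ^ 2) + (5 * ((4 * K) ^ 2 / (4 * (1 / 12))) + 14 * (4 * K)) * S := by
  have K1 := h.hK
  have K0 : 0 ≤ K := by linarith
  have d0 : (0:ℝ) < 1 / 12 := by positivity
  have n1 := sq_nonneg (e * φ1)
  have n2 := sq_nonneg (e * φ2)
  have n3 := sq_nonneg (e * θt)
  have n5 := sq_nonneg (e * q)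
  have n6 := sq_nonneg (e * p1)
  have n7 := sq_nonneg (e * p2)
  have n8 := sq_nonneg (e * q1)
  have n9 := sq_nonneg (e * q2)
  have hφ1 : (e * φ1) ^ 2 ≤ S := by linarith
  have hφ2 : (e * φ2) ^ 2 ≤ S := by linarith
  have hθ : (e * θt) ^ 2 ≤ S := by linarith
  have hq : (e * q) ^ 2 ≤ S := by linarith
  have hp1 : (e * p1) ^ 2 ≤ S := by linarith
  have hp2 : (e * p2) ^ 2 ≤ S := by linarith
  have hq1 : (e * q1) ^ 2 ≤ S := by linarith
  have hq2 : (e * q2) ^ 2 ≤ S := by linarith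
  have E := h.e1
  have aσ : |σ'| ≤ 1 := h.σ2.trans (by linarith [h.hδ])
  have t1 := yD' (A := 4 * K) (x := pt) d0 (le_trans (am h.ρhi h.yp) (by linarith)) (sq_le_e E hp1)
  have t2 := yD' (A := 4 * K) (x := pt) d0 (le_trans (am h.ρhi h.qb) (by linarith)) (sq_le_e E hp2)
  have t3 := yD' (A := 4 * K) (x := pt) d0 (le_trans h.ρhi (by linarith)) (sq_le_e E hq)
  have t4 := yD' (A := 4 * K) (x := qt) d0 (le_trans (am h.ρhi h.yp) (by linarith)) (sq_le_e E hq1)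
  have t5 := yD' (A := 4 * K) (x := qt) d0 (le_trans (am h.ρhi h.qb) (by linarith)) (sq_le_e E hq2)
  have a1 : |(τ + θ) * (y + p)| ≤ 4 * K := le_trans (am h.Thi h.yp) (by linarith)
  have a2 : |(τ + θ) * q| ≤ 4 * K := le_trans (am h.Thi h.qb) (by linarith)
  have a3 : |(τ + θ) * (σ + φ)| ≤ 4 * K := le_trans (am h.Thi h.ρhi) (by linarith)
  have a4 : |(τ + θ) * σ'| ≤ 4 * K := le_trans (am h.Thi aσ) (by linarith)
  have a5 : |σ + φ| ≤ 4 * K := le_trans h.ρhi (by linarith)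
  have u1 := yS a1 hφ1 hp1
  have u2 := yS a1 hφ1 hq2
  have u3 := yS a2 hφ2 hp1
  have u4 := yS a2 hφ2 hq2
  have u5 := yS a3 hp1 hp1
  have u6 := yS a3 hp1 hq2
  have u7 := yS a3 hq2 hq2
  have u8 := yS a4 hq hp1
  have u9 := yS a4 hq hq2
  have u10 := yS' a5 hθ hp1
  have u11 := yS' a5 hθ hq2
  have m : 0 ≤ (4 * K) * S := by
    have : 0 ≤ S := by linarith
    positivity
  have m2 := sq_nonneg qt
  generalize (4 * K) ^ 2 / (4 * (1 / 12)) = k at *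
  linear_combination t1 + t2 + t3 + t4 + t5 + u1 + u2 + u3 + u4 + u5 + 2 * u6 + u7 + u8 + u9
    + u10 + u11 + 2 * m + 1 / 12 * m2

theorem E2_real {μ e K δ σ σ' τ τ' φ p q θ p1 p2 q1 q2 φ1 φ2 θ1 pt qt p11 q11 q12 y S : ℝ}
    (h : PtB e K δ σ τ φ θ p q σ' τ' y) (hμ : 0 < μ) (bφ1 : |φ1| ≤ K)
    (hS : S = (e * φ1) ^ 2 + (e * φ2) ^ 2 + (e ^ 2 * θ1) ^ 2 + pt ^ 2 + qt ^ 2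
      + (e * q) ^ 2 + (e * p1) ^ 2
      + (e * p2) ^ 2 + (e * q1) ^ 2 + (e * q2) ^ 2) :
    e ^ 2 * ((τ + θ - 1) * φ1 + (σ + φ) * θ1) * (p11 + q12)
      + (σ + φ) * (pt + (y + p) * p1 + q * p2 + q) * p11
      + (σ + φ) * (qt + (y + p) * q1 + q * q2) * q11
      - e ^ 2 * (σ + φ - 1) * φ1 * (p11 + q12)
      - e ^ 2 * φ1 * (p1 * φ1 + q1 * φ2 + φ1 * (p1 + q2) + q1 * σ')
      + 1 / 2 * e ^ 2 * φ1 ^ 2 * (p1 + q2)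
    ≤ μ / 2 * (p11 ^ 2 + q11 ^ 2 + q12 ^ 2)
      + (13 * ((4 * K) ^ 2 / (4 * (μ / 14))) + 7 * (4 * K)) * S := by
  have K1 := h.hK
  have K0 : 0 ≤ K := by linarith
  have d0 : 0 < μ / 14 := by positivity
  have n1 := sq_nonneg (e * φ1)
  have n2 := sq_nonneg (e * φ2)
  have n3 := sq_nonneg (e ^ 2 * θ1)
  have n4 := sq_nonneg pt
  have n4' := sq_nonneg qt
  have n5 := sq_nonneg (e * q)
  have n6 := sq_nonneg (e * p1)
  have n7 := sq_nonneg (e * p2)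
  have n8 := sq_nonneg (e * q1)
  have n9 := sq_nonneg (e * q2)
  have hφ1 : (e * φ1) ^ 2 ≤ S := by linarith
  have hφ2 : (e * φ2) ^ 2 ≤ S := by linarith
  have hθ : (e ^ 2 * θ1) ^ 2 ≤ S := by linarith
  have hpt : pt ^ 2 ≤ S := by linarith
  have hqt : qt ^ 2 ≤ S := by linarith
  have hq : (e * q) ^ 2 ≤ S := by linarith
  have hp1 : (e * p1) ^ 2 ≤ S := by linarith
  have hp2 : (e * p2) ^ 2 ≤ S := by linarith
  have hq1 : (e * q1) ^ 2 ≤ S := by linarith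
  have hq2 : (e * q2) ^ 2 ≤ S := by linarith
  have E := h.e1
  have aσ : |σ'| ≤ 4 * K := h.σ2.trans (by linarith [h.hδ])
  have b1 : |e * (τ + θ - 1)| ≤ 4 * K := h.T1.trans (by linarith)
  have b2 : |σ + φ| ≤ 4 * K := le_trans h.ρhi (by linarith)
  have b3 : |(σ + φ) * (y + p)| ≤ 4 * K := le_trans (am h.ρhi h.yp) (by linarith)
  have b4 : |(σ + φ) * q| ≤ 4 * K := le_trans (am h.ρhi h.qb) (by linarith)
  have b5 : |e * (σ + φ - 1)| ≤ 4 * K := h.ρ1.trans (by linarith)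
  have b6 : |φ1| ≤ 4 * K := bφ1.trans (by linarith)
  have t1 := yD (x := p11) d0 b1 hφ1
  have t2 := yD (x := q12) d0 b1 hφ1
  have t3 := yD (x := p11) d0 b2 hθ
  have t4 := yD (x := q12) d0 b2 hθ
  have t5 := yD (x := p11) d0 b2 hpt
  have t6 := yD (x := p11) d0 b3 (sq_le_e E hp1)
  have t7 := yD (x := p11) d0 b4 (sq_le_e E hp2)
  have t8 := yD (x := p11) d0 b2 (sq_le_e E hq)
  have t9 := yD (x := q11) d0 b2 hqt
  have t10 := yD (x := q11) d0 b3 (sq_le_e E hq1)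
  have t11 := yD (x := q11) d0 b4 (sq_le_e E hq2)
  have t12 := yD' (x := p11) d0 b5 hφ1
  have t13 := yD' (x := q12) d0 b5 hφ1
  have u1 := yS' b6 hp1 hφ1
  have u2 := yS' b6 hq1 hφ2
  have u4 := yS' b6 hφ1 hq2
  have u5 := yS' aσ hφ1 hq1
  have m : 0 ≤ (4 * K) * S := by
    have : 0 ≤ S := by linarith
    positivity
  have m1 : 0 ≤ μ * q11 ^ 2 := by positivity
  have m2 : 0 ≤ μ * q12 ^ 2 := by positivity
  generalize (4 * K) ^ 2 / (4 * (μ / 14)) = k at *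
  linear_combination t1 + t2 + t3 + t4 + t5 + t6 + t7 + t8 + t9 + t10 + t11 + t12 + t13
    + 3 / 2 * u1 + u2 + 1 / 2 * u4 + u5 + 3 * m + 4 / 14 * m1 + 4 / 14 * m2

theorem E3_real {μ e K δ σ σ' σ'' τ τ' φ p q θ p1 p2 q1 q2 φ1 φ2 θ2 qt q11 p12 w y S : ℝ}
    (h : PtB e K δ σ τ φ θ p q σ' τ' y) (hμ : 0 < μ) (bφ1 : |φ1| ≤ K) (bφ2 : |φ2| ≤ K)
    (bσ'' : |σ''| ≤ K)
    (hS : S = (e * φ1) ^ 2 + (e * φ2) ^ 2 + (e ^ 2 * θ2) ^ 2 + qt ^ 2 + q11 ^ 2 + p12 ^ 2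
      + (e * φ) ^ 2 + (e * θ) ^ 2
      + (e * q) ^ 2 + (e * p1) ^ 2
      + (e * p2) ^ 2 + (e * q1) ^ 2 + (e * q2) ^ 2) :
    w * (e ^ 2 * ((τ + θ - 1) * φ2 + σ' * θ + (σ + φ) * θ2 + φ * τ')
        + (σ + φ) * (qt + (y + p) * q1 + q * q2) + μ * (p12 - q11))
      - e ^ 2 * (σ + φ - 1) * φ2 * w
      - e ^ 2 * φ2 * ((1 + p2) * φ1 + q2 * φ2 + (σ' + φ2) * (p1 + q2) + q2 * σ' + q * σ'')
      + 1 / 2 * e ^ 2 * φ2 ^ 2 * (p1 + q2)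
    ≤ μ / 2 * w ^ 2
      + (10 * ((4 * K + μ) ^ 2 / (4 * (μ / 20))) + 11 * (4 * K + μ)) * S := by
  have K1 := h.hK
  have K0 : 0 ≤ K := by linarith
  have d0 : 0 < μ / 20 := by positivity
  have n1 := sq_nonneg (e * φ1)
  have n2 := sq_nonneg (e * φ2)
  have n3 := sq_nonneg (e ^ 2 * θ2)
  have n4 := sq_nonneg qt
  have n4' := sq_nonneg q11
  have n4'' := sq_nonneg p12
  have n10 := sq_nonneg (e * φ)
  have n11 := sq_nonneg (e * θ)
  have n5 := sq_nonneg (e * q)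
  have n6 := sq_nonneg (e * p1)
  have n7 := sq_nonneg (e * p2)
  have n8 := sq_nonneg (e * q1)
  have n9 := sq_nonneg (e * q2)
  have hφ1 : (e * φ1) ^ 2 ≤ S := by linarith
  have hφ2 : (e * φ2) ^ 2 ≤ S := by linarith
  have hθ2 : (e ^ 2 * θ2) ^ 2 ≤ S := by linarith
  have hqt : qt ^ 2 ≤ S := by linarith
  have hq11 : q11 ^ 2 ≤ S := by linarith
  have hp12 : p12 ^ 2 ≤ S := by linarith
  have hφ : (e * φ) ^ 2 ≤ S := by linarith
  have hθ : (e * θ) ^ 2 ≤ S := by linarith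
  have hq : (e * q) ^ 2 ≤ S := by linarith
  have hp1 : (e * p1) ^ 2 ≤ S := by linarith
  have hp2 : (e * p2) ^ 2 ≤ S := by linarith
  have hq1 : (e * q1) ^ 2 ≤ S := by linarith
  have hq2 : (e * q2) ^ 2 ≤ S := by linarith
  have E := h.e1
  have hA : 4 * K ≤ 4 * K + μ := by linarith
  have aμ : |μ| ≤ 4 * K + μ := by rw [abs_of_pos hμ]; linarith
  have aσ : |σ'| ≤ 4 * K + μ := h.σ2.trans (by linarith [h.hδ])
  have b1 : |e * (τ + θ - 1)| ≤ 4 * K + μ := h.T1.trans (by linarith)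
  have b2 : |σ + φ| ≤ 4 * K + μ := le_trans h.ρhi (by linarith)
  have b3 : |(σ + φ) * (y + p)| ≤ 4 * K + μ := le_trans (am h.ρhi h.yp) (by linarith)
  have b4 : |(σ + φ) * q| ≤ 4 * K + μ := le_trans (am h.ρhi h.qb) (by linarith)
  have b5 : |e * (σ + φ - 1)| ≤ 4 * K + μ := h.ρ1.trans (by linarith)
  have b6 : |φ2| ≤ 4 * K + μ := bφ2.trans (by linarith)
  have b6' : |φ1| ≤ 4 * K + μ := bφ1.trans (by linarith)
  have b7 : |e * σ'| ≤ 4 * K + μ := h.eσ'.trans (by linarith)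
  have b8 : |e * τ'| ≤ 4 * K + μ := h.eτ'.trans (by linarith)
  have b9 : |(1:ℝ)| ≤ 4 * K + μ := by rw [abs_one]; linarith
  have b10 : |σ''| ≤ 4 * K + μ := bσ''.trans (by linarith)
  have t1 := yD (x := w) d0 b1 hφ2
  have t2 := yD (x := w) d0 b7 hθ
  have t3 := yD (x := w) d0 b2 hθ2
  have t4 := yD (x := w) d0 b8 hφ
  have t5 := yD (x := w) d0 b2 hqt
  have t6 := yD (x := w) d0 b3 (sq_le_e E hq1)
  have t7 := yD (x := w) d0 b4 (sq_le_e E hq2)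
  have t8 := yD (x := w) d0 aμ hp12
  have t9 := yD' (x := w) d0 aμ hq11
  have t10 := yD' (x := w) d0 b5 hφ2
  have u1 := yS' b9 hφ2 hφ1
  have u2 := yS' b6' hφ2 hp2
  have u3 := yS' b6 hq2 hφ2
  have u4 := yS' aσ hφ2 hp1
  have u5 := yS' aσ hφ2 hq2
  have u6 := yS' b6 hφ2 hp1
  have u8 := yS' b10 hφ2 hq
  have m : 0 ≤ (4 * K + μ) * S := by
    have : 0 ≤ S := by linarith
    positivity
  generalize (4 * K + μ) ^ 2 / (4 * (μ / 20)) = k at *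
  linear_combination t1 + t2 + t3 + t4 + t5 + t6 + t7 + t8 + t9 + t10
    + u1 + u2 + 3 / 2 * u3 + u4 + 2 * u5 + 1 / 2 * u6 + u8 + 3 * m

/-! ### Higher order energy inequalities -/

def cθ (P : Par) : ℝ := 13 * ((A1c P.μ P.r P.g P.K) ^ 2 / (4 * (P.g / 52)))
def cψ (P : Par) : ℝ := 5 * ((4 * P.K) ^ 2 / (4 * (1 / 12))) + 14 * (4 * P.K)
def c2 (P : Par) : ℝ := 13 * ((4 * P.K) ^ 2 / (4 * (P.μ / 14))) + 7 * (4 * P.K)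
def c3 (P : Par) : ℝ := 10 * ((4 * P.K + P.μ) ^ 2 / (4 * (P.μ / 20))) + 11 * (4 * P.K + P.μ)

def Fld.G1 (f : Fld) : SF := dX f.θ * dX f.θ + dY f.θ * dY f.θ
def Fld.Gψ (f : Fld) (P : Par) : SF :=
  (P.μ / 2) • (dX f.p * dX f.p + dY f.p * dY f.p + dX f.q * dX f.q + dY f.q * dY f.q)
    + (P.lam / 2) • (f.D * f.D) - (P.e ^ 2) • (f.Pr * f.D)
def Fld.Sθ (f : Fld) (P : Par) : SF := (P.e ^ 2) • (f.gθ + f.q ^ 2 + f.gψ)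
def Fld.Sψ (f : Fld) (P : Par) : SF := (P.e ^ 2) • (f.gφ + dT f.θ ^ 2 + f.q ^ 2 + f.gψ)
def Fld.S2 (f : Fld) (P : Par) : SF :=
  (P.e ^ 2) • (f.gφ + f.q ^ 2 + f.gψ) + (P.e ^ 4) • (dX f.θ ^ 2) + dT f.p ^ 2 + dT f.q ^ 2
def Fld.S3 (f : Fld) (P : Par) : SF :=
  (P.e ^ 2) • (f.gφ + f.q ^ 2 + f.gψ + f.φ ^ 2 + f.θ ^ 2) + (P.e ^ 4) • (dY f.θ ^ 2) + dT f.q ^ 2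
    + dX (dX f.q) ^ 2 + dX (dY f.p) ^ 2

set_option linter.unusedSimpArgs false in
set_option maxHeartbeats 1000000 in
theorem Sys.E1θ {P : Par} {f : Fld} (h : Sys P f) {t : ℝ} (ht : t ∈ Set.Icc 0 P.T) :
    I t ((P.κ * P.e ^ 2 / 2) • f.G1) + J t ((P.g * P.e ^ 2 / 4) • dT f.θ ^ 2)
      ≤ I 0 ((P.κ * P.e ^ 2 / 2) • f.G1) + J t (cθ P • f.Sθ P) := by
  have pθ := h.perθ
  refine energy ht
    (F1 := (P.κ * P.e ^ 2) • (dT f.θ * dX f.θ))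
    (F2 := (P.κ * P.e ^ 2) • (dT f.θ * dY f.θ))
    ?_ ?_ ?_ ?_
  · repeat' first
      | assumption
      | apply IsPer.smul
      | apply IsPer.mul
      | apply IsPer.dX
      | apply IsPer.dT
  · intro s hs x
    obtain ⟨h1, h2, h3⟩ := h.bdT hs (x := x) (y := 0) (.inl rfl)
    rw [← ev_apply]
    simp only [map_smul, map_mul, h3, zero_mul, smul_zero]
  · intro s hs x
    obtain ⟨h1, h2, h3⟩ := h.bdT hs (x := x) (y := 1) (.inr rfl)
    rw [← ev_apply]
    simp only [map_smul, map_mul, h3, zero_mul, smul_zero]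
  · intro s hs x hx
    have hs' := icc_of_ioo hs
    have hpt := h.pt hs' hx
    have hen := h.ener s hs' x hx
    have b := E1θ_real (r := P.r) (θ1 := ev (s, x) (dX f.θ)) (θ2 := ev (s, x) (dY f.θ))
      (θt := ev (s, x) (dT f.θ)) hpt h.hμ h.hg (h.bdp1 s hs' x hx) (h.bdp2 s hs' x hx)
      (h.bdq1 s hs' x hx) (h.bdq2 s hs' x hx) rfl
    have k1 : 0 ≤ (ev (s, x) f.σ + ev (s, x) f.φ - 1 / 2) * (P.g * P.e ^ 2 * ev (s, x) (dT f.θ) ^ 2) :=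
      mul_nonneg (by linarith [hpt.ρlo]) (mul_nonneg (mul_nonneg h.hg.le (by positivity)) (by positivity))
    simp only [Fld.Q, Fld.G1, Fld.gψ, Fld.gθ, Fld.Sθ, cθ, Derivation.leibniz,
      map_add, map_sub, Derivation.map_smul, map_smul, smul_eq_mul, map_mul, map_pow, dX_Yc, dT_Yc,
      dY_Yc, h.dXσ, h.dTσ, h.dXτ, h.dTτ, map_zero, map_one, dX_dT, dY_dT, dY_dX] at hen ⊢
    generalize 13 * ((A1c P.μ P.r P.g P.K) ^ 2 / (4 * (P.g / 52))) = k at *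
    linear_combination ev (s, x) (dT f.θ) * hen + b + k1

set_option linter.unusedSimpArgs false in
set_option maxHeartbeats 1000000 in
theorem Sys.E1ψ {P : Par} {f : Fld} (h : Sys P f) {t : ℝ} (ht : t ∈ Set.Icc 0 P.T) :
    I t (f.Gψ P) + J t ((1 / 4 : ℝ) • (dT f.p ^ 2 + dT f.q ^ 2))
      ≤ I 0 (f.Gψ P) + J t (cψ P • f.Sψ P) := by
  have pσ := h.perσ
  have pτ := h.perτ
  have pφ := h.perφ
  have pp := h.perp
  have pq := h.perq
  have pθ := h.perθ
  refine energy ht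
    (F1 := P.μ • (dT f.p * dX f.p + dT f.q * dX f.q) + (P.lam • f.D - (P.e ^ 2) • f.Pr) * dT f.p)
    (F2 := P.μ • (dT f.p * dY f.p + dT f.q * dY f.q) + (P.lam • f.D - (P.e ^ 2) • f.Pr) * dT f.q)
    ?_ ?_ ?_ ?_
  · unfold Fld.D Fld.Pr
    repeat' first
      | assumption
      | exact IsPer.Yc
      | apply IsPer.add
      | apply IsPer.sub
      | apply IsPer.smul
      | apply IsPer.mul
      | apply IsPer.dX
      | apply IsPer.dY
      | apply IsPer.dT
  · intro s hs x
    obtain ⟨h1, h2, h3⟩ := h.bdT hs (x := x) (y := 0) (.inl rfl)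
    rw [← ev_apply]
    simp only [map_add, map_sub, map_smul, map_mul, h1, h2, h3, zero_mul, mul_zero, add_zero,
      smul_zero, sub_zero]
  · intro s hs x
    obtain ⟨h1, h2, h3⟩ := h.bdT hs (x := x) (y := 1) (.inr rfl)
    rw [← ev_apply]
    simp only [map_add, map_sub, map_smul, map_mul, h1, h2, h3, zero_mul, mul_zero, add_zero,
      smul_zero, sub_zero]
  · intro s hs x hx
    have hs' := icc_of_ioo hs
    have hpt := h.pt hs' hx
    have hm := h.mass s hs' x hx
    have hm1 := h.mom1 s hs' x hx
    have hm2 := h.mom2 s hs' x hx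
    have b := E1ψ_real (p1 := ev (s, x) (dX f.p)) (p2 := ev (s, x) (dY f.p))
      (q1 := ev (s, x) (dX f.q)) (q2 := ev (s, x) (dY f.q)) (φ1 := ev (s, x) (dX f.φ))
      (φ2 := ev (s, x) (dY f.φ)) (θt := ev (s, x) (dT f.θ))
      (pt := ev (s, x) (dT f.p)) (qt := ev (s, x) (dT f.q)) hpt rfl
    have k1 : 0 ≤ (ev (s, x) f.σ + ev (s, x) f.φ - 1 / 2) *
        (ev (s, x) (dT f.p) ^ 2 + ev (s, x) (dT f.q) ^ 2) :=
      mul_nonneg (by linarith [hpt.ρlo]) (by positivity)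
    simp only [Fld.mass, Fld.D, Fld.Pr, Fld.gψ, Fld.gφ, Fld.Gψ, Fld.Sψ, cψ, Derivation.leibniz,
      map_add, map_sub, Derivation.map_smul, map_smul, smul_eq_mul, map_mul, map_pow, dX_Yc, dT_Yc,
      dY_Yc, h.dXσ, h.dTσ, h.dXτ, h.dTτ, map_zero, map_one, dX_dT, dY_dT, dY_dX] at hm hm1 hm2 ⊢
    generalize 5 * ((4 * P.K) ^ 2 / (4 * (1 / 12))) + 14 * (4 * P.K) = k at *
    linear_combination ev (s, x) (dT f.p) * hm1 + ev (s, x) (dT f.q) * hm2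
      - (P.e ^ 2 * (ev (s, x) f.τ + ev (s, x) f.θ) * (ev (s, x) (dX f.p) + ev (s, x) (dY f.q))) * hm
      + b + k1

set_option linter.unusedSimpArgs false in
set_option maxHeartbeats 1000000 in
theorem Sys.E2 {P : Par} {f : Fld} (h : Sys P f) {t : ℝ} (ht : t ∈ Set.Icc 0 P.T) :
    I t ((P.e ^ 2 / 2) • (dX f.φ * dX f.φ))
      + J t ((P.μ / 2) • (dX (dX f.p) ^ 2 + dX (dY f.p) ^ 2 + dX (dX f.q) ^ 2 + dX (dY f.q) ^ 2))
      ≤ I 0 ((P.e ^ 2 / 2) • (dX f.φ * dX f.φ)) + J t (c2 P • f.S2 P) := by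
  have pσ := h.perσ
  have pτ := h.perτ
  have pφ := h.perφ
  have pp := h.perp
  have pq := h.perq
  have pθ := h.perθ
  refine energy ht
    (F1 := (P.e ^ 2) • (dX f.q * dY f.Pr) - (P.e ^ 2 / 2) • (dX f.φ * dX f.φ * (Yc + f.p))
      - P.μ • (dX f.p * dY (dY f.p) + dX f.q * dY (dY f.q))
      - P.lam • (dX f.q * dY f.D))
    (F2 := P.μ • (dX f.p * dX (dY f.p) + dX f.q * dX (dY f.q)) + P.lam • (dX f.q * dX f.D)
      - (P.e ^ 2) • (dX f.q * dX f.Pr) - (P.e ^ 2 / 2) • (dX f.φ * dX f.φ * f.q))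
    ?_ ?_ ?_ ?_
  · unfold Fld.D Fld.Pr
    repeat' first
      | assumption
      | exact IsPer.Yc
      | apply IsPer.add
      | apply IsPer.sub
      | apply IsPer.smul
      | apply IsPer.mul
      | apply IsPer.dX
      | apply IsPer.dY
      | apply IsPer.dT
  · intro s hs x
    obtain ⟨h1, h2, h3⟩ := h.bd0 (icc_of_ioo hs) (x := x) (y := 0) (.inl rfl)
    obtain ⟨h4, h5⟩ := h.bdX (icc_of_ioo hs) (x := x) (y := 0) (.inl rfl)
    rw [← ev_apply]
    simp only [map_add, map_sub, map_smul, map_mul, h1, h2, h3, h4, h5, zero_mul, mul_zero, add_zero,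
      smul_zero, sub_zero]
  · intro s hs x
    obtain ⟨h1, h2, h3⟩ := h.bd0 (icc_of_ioo hs) (x := x) (y := 1) (.inr rfl)
    obtain ⟨h4, h5⟩ := h.bdX (icc_of_ioo hs) (x := x) (y := 1) (.inr rfl)
    rw [← ev_apply]
    simp only [map_add, map_sub, map_smul, map_mul, h1, h2, h3, h4, h5, zero_mul, mul_zero, add_zero,
      smul_zero, sub_zero]
  · intro s hs x hx
    have hs' := icc_of_ioo hs
    have hpt := h.pt hs' hx
    have hxσ : dX (dY f.σ) = 0 := by rw [← dY_dX, h.dXσ, map_zero]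
    have hxτ : dX (dY f.τ) = 0 := by rw [← dY_dX, h.dXτ, map_zero]
    have hm : ev (s, x) (dX f.mass) = 0 := ev_pdv_zero _ h.mass hs hx
    have hm1 := h.mom1 s hs' x hx
    have hm2 := h.mom2 s hs' x hx
    have b := E2_real (p1 := ev (s, x) (dX f.p)) (p2 := ev (s, x) (dY f.p))
      (q1 := ev (s, x) (dX f.q)) (q2 := ev (s, x) (dY f.q)) (φ1 := ev (s, x) (dX f.φ))
      (φ2 := ev (s, x) (dY f.φ)) (θ1 := ev (s, x) (dX f.θ))
      (pt := ev (s, x) (dT f.p)) (qt := ev (s, x) (dT f.q)) (p11 := ev (s, x) (dX (dX f.p)))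
      (q11 := ev (s, x) (dX (dX f.q))) (q12 := ev (s, x) (dX (dY f.q)))
      hpt h.hμ (h.bdφ1 s hs' x hx) rfl
    have k1 : 0 ≤ P.lam * (ev (s, x) (dX (dX f.p)) + ev (s, x) (dX (dY f.q))) ^ 2 :=
      mul_nonneg h.hlam.le (by positivity)
    have k2 : 0 ≤ P.μ / 2 * ev (s, x) (dX (dY f.p)) ^ 2 := by have := h.hμ; positivity
    simp only [Fld.mass, Fld.D, Fld.Pr, Fld.gψ, Fld.gφ, Fld.S2, c2, Derivation.leibniz,
      map_add, map_sub, Derivation.map_smul, map_smul, smul_eq_mul, map_mul, map_pow, dX_Yc, dT_Yc,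
      dY_Yc, hxσ, hxτ, h.dXσ, h.dTσ, h.dXτ, h.dTτ, map_zero, map_one, dX_dT, dY_dT, dY_dX] at hm hm1 hm2 ⊢
    generalize 13 * ((4 * P.K) ^ 2 / (4 * (P.μ / 14))) + 7 * (4 * P.K) = k at *
    linear_combination (P.e ^ 2 * ev (s, x) (dX f.φ)) * hm - ev (s, x) (dX (dX f.p)) * hm1
      - ev (s, x) (dX (dX f.q)) * hm2 + b + k1 + k2

set_option linter.unusedSimpArgs false in
set_option maxHeartbeats 1000000 in
theorem Sys.E3 {P : Par} {f : Fld} (h : Sys P f) {t : ℝ} (ht : t ∈ Set.Icc 0 P.T) :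
    I t ((P.e ^ 2 / 2) • (dY f.φ * dY f.φ)) + J t ((P.μ / 2) • (dY f.D) ^ 2)
      ≤ I 0 ((P.e ^ 2 / 2) • (dY f.φ * dY f.φ)) + J t (c3 P • f.S3 P) := by
  have pφ := h.perφ
  have pp := h.perp
  refine energy ht
    (F1 := (-P.e ^ 2 / 2) • (dY f.φ * dY f.φ * (Yc + f.p)))
    (F2 := (-P.e ^ 2 / 2) • (dY f.φ * dY f.φ * f.q))
    ?_ ?_ ?_ ?_
  · repeat' first
      | assumption
      | exact IsPer.Yc
      | apply IsPer.add
      | apply IsPer.smul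
      | apply IsPer.mul
      | apply IsPer.dY
  · intro s hs x
    obtain ⟨h1, h2, h3⟩ := h.bd0 (icc_of_ioo hs) (x := x) (y := 0) (.inl rfl)
    rw [← ev_apply]
    simp only [map_smul, map_mul, h2, mul_zero, smul_zero]
  · intro s hs x
    obtain ⟨h1, h2, h3⟩ := h.bd0 (icc_of_ioo hs) (x := x) (y := 1) (.inr rfl)
    rw [← ev_apply]
    simp only [map_smul, map_mul, h2, mul_zero, smul_zero]
  · intro s hs x hx
    have hs' := icc_of_ioo hs
    have hpt := h.pt hs' hx
    have hm : ev (s, x) (dY f.mass) = 0 := ev_pdv_zero _ h.mass hs hx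
    have hm2 := h.mom2 s hs' x hx
    have bσ : |ev (s, x) (dY (dY f.σ))| ≤ P.K := by
      have h1 := h.bdσ22 s x hx
      have h2 : 1 * |ev (s, x) (dY (dY f.σ))| ≤ P.e * |ev (s, x) (dY (dY f.σ))| :=
        mul_le_mul_of_nonneg_right (by linarith [h.hK, h.he]) (abs_nonneg _)
      linarith
    have b := E3_real (p1 := ev (s, x) (dX f.p)) (p2 := ev (s, x) (dY f.p))
      (q1 := ev (s, x) (dX f.q)) (q2 := ev (s, x) (dY f.q)) (φ1 := ev (s, x) (dX f.φ))
      (φ2 := ev (s, x) (dY f.φ)) (θ2 := ev (s, x) (dY f.θ))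
      (qt := ev (s, x) (dT f.q)) (p12 := ev (s, x) (dX (dY f.p)))
      (q11 := ev (s, x) (dX (dX f.q))) (w := ev (s, x) (dX (dY f.p)) + ev (s, x) (dY (dY f.q)))
      hpt h.hμ (h.bdφ1 s hs' x hx) (h.bdφ2 s hs' x hx) bσ rfl
    have k1 : 0 ≤ P.lam * (ev (s, x) (dX (dY f.p)) + ev (s, x) (dY (dY f.q))) ^ 2 :=
      mul_nonneg h.hlam.le (by positivity)
    simp only [Fld.mass, Fld.D, Fld.Pr, Fld.gψ, Fld.gφ, Fld.S3, c3, Derivation.leibniz,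
      map_add, map_sub, Derivation.map_smul, map_smul, smul_eq_mul, map_mul, map_pow, dX_Yc, dT_Yc,
      dY_Yc, h.dXσ, h.dTσ, h.dXτ, h.dTτ, map_zero, map_one, dX_dT, dY_dT, dY_dX] at hm hm2 ⊢
    generalize 10 * ((4 * P.K + P.μ) ^ 2 / (4 * (P.μ / 20))) + 11 * (4 * P.K + P.μ) = k at *
    linear_combination (P.e ^ 2 * ev (s, x) (dY f.φ)) * hm
      - (ev (s, x) (dX (dY f.p)) + ev (s, x) (dY (dY f.q))) * hm2 + b + k1

/-! ### Combination of the energy inequalities -/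

def Fld.X0 (f : Fld) (P : Par) : SF :=
  f.p ^ 2 + f.q ^ 2 + (P.e ^ 2) • f.φ ^ 2 + (P.e ^ 2) • f.θ ^ 2

def Rq (P : Par) (f : Fld) (t : ℝ) : ℝ :=
  I 0 f.gψ + P.e ^ 2 * I 0 f.gθ + P.e ^ 2 * I 0 (f.X0 P) + P.e ^ 2 * I 0 f.gφ
    + P.e ^ 2 * J t f.gφ

structure Adm (a P : Par) (f : Fld) : Prop where
  sys : Sys P f
  μ : P.μ = a.μ
  lam : P.lam = a.lam
  r : P.r = a.r
  κ : P.κ = a.κ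
  g : P.g = a.g
  K : P.K = a.K
  sμ : 40 * M0 P ≤ P.μ
  sκ : 40 * M0 P ≤ P.κ

def UB (a : Par) (Q : Par → Fld → ℝ → ℝ) : Prop :=
  ∃ C : ℝ, 0 ≤ C ∧ ∀ P f, Adm a P f → ∀ t ∈ Set.Icc 0 P.T, Q P f t ≤ C * Rq P f t

theorem I_sq_nonneg (t : ℝ) (f : SF) : 0 ≤ I t (f ^ 2) :=
  I_nonneg fun x _ => by rw [map_pow]; positivity
theorem J_sq_nonneg {t : ℝ} (ht : 0 ≤ t) (f : SF) : 0 ≤ J t (f ^ 2) :=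
  J_nonneg ht fun s x => by rw [map_pow]; positivity
theorem I_gψ_nonneg (t : ℝ) (f : Fld) : 0 ≤ I t f.gψ := by
  simp only [Fld.gψ, map_add]
  have := I_sq_nonneg t (dX f.p); have := I_sq_nonneg t (dY f.p)
  have := I_sq_nonneg t (dX f.q); have := I_sq_nonneg t (dY f.q)
  linarith
theorem I_gθ_nonneg (t : ℝ) (f : Fld) : 0 ≤ I t f.gθ := by
  simp only [Fld.gθ, map_add]
  have := I_sq_nonneg t (dX f.θ); have := I_sq_nonneg t (dY f.θ)
  linarith
theorem I_gφ_nonneg (t : ℝ) (f : Fld) : 0 ≤ I t f.gφ := by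
  simp only [Fld.gφ, map_add]
  have := I_sq_nonneg t (dX f.φ); have := I_sq_nonneg t (dY f.φ)
  linarith
theorem J_of_I {t : ℝ} (ht : 0 ≤ t) {f : SF} (h : ∀ s, 0 ≤ I s f) : 0 ≤ J t f :=
  intervalIntegral.integral_nonneg ht fun s _ => h s
theorem I_X0_nonneg (t : ℝ) (f : Fld) (P : Par) : 0 ≤ I t (f.X0 P) := by
  simp only [Fld.X0, map_add, map_smul, smul_eq_mul]
  have := I_sq_nonneg t f.p; have := I_sq_nonneg t f.q
  have := mul_nonneg (sq_nonneg P.e) (I_sq_nonneg t f.φ)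
  have := mul_nonneg (sq_nonneg P.e) (I_sq_nonneg t f.θ)
  linarith

theorem Rq_parts (P : Par) (f : Fld) {t : ℝ} (ht : 0 ≤ t) :
    0 ≤ Rq P f t ∧ I 0 f.gψ ≤ Rq P f t ∧ P.e ^ 2 * I 0 f.gθ ≤ Rq P f t ∧
    P.e ^ 2 * I 0 (f.X0 P) ≤ Rq P f t ∧ P.e ^ 2 * I 0 f.gφ ≤ Rq P f t ∧
    P.e ^ 2 * J t f.gφ ≤ Rq P f t := by
  have e := sq_nonneg P.e
  have h1 := I_gψ_nonneg 0 f
  have h2 := mul_nonneg e (I_gθ_nonneg 0 f)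
  have h3 := mul_nonneg e (I_X0_nonneg 0 f P)
  have h4 := mul_nonneg e (I_gφ_nonneg 0 f)
  have h5 := mul_nonneg e (J_of_I ht fun s => I_gφ_nonneg s f)
  unfold Rq
  refine ⟨?_, ?_, ?_, ?_, ?_, ?_⟩ <;> linarith

theorem UB.add {a : Par} {Q Q' : Par → Fld → ℝ → ℝ} (h : UB a Q) (h' : UB a Q') :
    UB a (fun P f t => Q P f t + Q' P f t) := by
  obtain ⟨C, hC, h⟩ := h
  obtain ⟨C', hC', h'⟩ := h'
  refine ⟨C + C', by positivity, fun P f ha t ht => ?_⟩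
  have := h P f ha t ht
  have := h' P f ha t ht
  linarith

theorem UB.lin {a : Par} {Q Q' : Par → Fld → ℝ → ℝ} (h : UB a Q) (c d : ℝ) (hc : 0 ≤ c) (hd : 0 ≤ d)
    (hQ : ∀ P f, Adm a P f → ∀ t ∈ Set.Icc 0 P.T, Q' P f t ≤ c * Q P f t + d * Rq P f t) :
    UB a Q' := by
  obtain ⟨C, hC, h⟩ := h
  refine ⟨c * C + d, by positivity, fun P f ha t ht => ?_⟩
  have h1 := h P f ha t ht
  have h2 := hQ P f ha t ht
  have := mul_le_mul_of_nonneg_left h1 hc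
  linarith

theorem UB.zero (a : Par) : UB a (fun _ _ _ => 0) :=
  ⟨0, le_rfl, fun P f _ t _ => by simp⟩

theorem Sys.e1 {P : Par} {f : Fld} (h : Sys P f) : 1 ≤ P.e := by linarith [h.hK, h.he]
theorem Sys.E1' {P : Par} {f : Fld} (h : Sys P f) : 1 ≤ P.e ^ 2 := one_le_pow₀ h.e1

theorem Sys.poin {P : Par} {f : Fld} (h : Sys P f) {s : ℝ} (hs : s ∈ Set.Icc 0 P.T) :
    I s (f.p ^ 2) + I s (f.q ^ 2) ≤ 4 * I s f.gψ ∧ I s (f.θ ^ 2) ≤ 4 * I s f.gθ ∧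
      I s (f.φ ^ 2) ≤ 40 * I s f.gφ := by
  have h1 := poincare_dir f.p s (fun x => h.bp s hs x 0 (.inl rfl)) (fun x => h.bp s hs x 1 (.inr rfl))
  have h2 := poincare_dir f.q s (fun x => h.bq s hs x 0 (.inl rfl)) (fun x => h.bq s hs x 1 (.inr rfl))
  have h3 := poincare_dir f.θ s (fun x => h.bθ s hs x 0 (.inl rfl)) (fun x => h.bθ s hs x 1 (.inr rfl))
  have h4 := poincare_mean f.φ s (h.mean0 hs)
  have := I_sq_nonneg s (dX f.p); have := I_sq_nonneg s (dX f.q); have := I_sq_nonneg s (dX f.θ)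
  simp only [Fld.gψ, Fld.gθ, Fld.gφ, map_add]
  refine ⟨by linarith, by linarith, h4⟩

theorem Sys.phi4 {P : Par} {f : Fld} (h : Sys P f) {s : ℝ} (hs : s ∈ Set.Icc 0 P.T) :
    P.e ^ 4 * I s (f.φ ^ 4) ≤ 88 * P.K * I s f.gφ := by
  have h4 := lady f.φ s 40 (poincare_mean f.φ s (h.mean0 hs))
  have h5 := h.φL2 s hs
  have h6 := I_gφ_nonneg s f
  have h7 : I s (dX f.φ ^ 2) + I s (dY f.φ ^ 2) = I s f.gφ := by simp only [Fld.gφ, map_add]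
  rw [h7] at h4
  have h8 := mul_le_mul_of_nonneg_right h5 h6
  have h9 := mul_le_mul_of_nonneg_left h4 (by positivity : 0 ≤ P.e ^ 4)
  linarith

theorem Sys.JS0 {P : Par} {f : Fld} (h : Sys P f) {t : ℝ} (ht : t ∈ Set.Icc 0 P.T) :
    J t (f.S0 P) ≤ 5 * J t f.gψ + 4 * P.e ^ 2 * J t f.gθ + 88 * P.K * J t f.gφ := by
  have : J t (f.S0 P) ≤ J t ((5:ℝ) • f.gψ + (4 * P.e ^ 2) • f.gθ + (88 * P.K) • f.gφ) := by
    apply J_mono_I ht.1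
    intro s hs
    have hs' : s ∈ Set.Icc 0 P.T := ⟨hs.1.le, hs.2.le.trans ht.2⟩
    obtain ⟨a1, a2, a3⟩ := h.poin hs'
    have a4 := h.phi4 hs'
    have a5 := mul_le_mul_of_nonneg_left a2 (sq_nonneg P.e)
    simp only [Fld.S0, map_add, map_smul, smul_eq_mul]
    linarith
  simpa only [map_add, map_smul, smul_eq_mul] using this

theorem M0_nonneg {P : Par} {f : Fld} (h : Sys P f) : 0 ≤ M0 P := by
  have := h.hμ; have := h.hlam; have := h.hg; have := h.e1
  have : 0 ≤ P.K := by linarith [h.hK]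
  unfold M0
  positivity

theorem Sys.G0_lo {P : Par} {f : Fld} (h : Sys P f) {s : ℝ} (hs : s ∈ Set.Icc 0 P.T) :
    P.e ^ 2 / 4 * I s (f.φ ^ 2) + P.e ^ 2 * P.g / 4 * I s (f.θ ^ 2) ≤ I s (f.G0 P) := by
  have : I s ((P.e ^ 2 / 4) • f.φ ^ 2 + (P.e ^ 2 * P.g / 4) • f.θ ^ 2) ≤ I s (f.G0 P) := by
    apply I_mono
    intro x hx
    have hp := h.pt hs hx
    have a1 := hp.ρlo
    have a2 := hp.σlo
    have a3 := hp.τlo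
    have hg := h.hg
    simp only [Fld.G0, map_add, map_smul, smul_eq_mul, map_mul, map_pow]
    have k1 : 0 ≤ (ev (s, x) f.σ + ev (s, x) f.φ) * ev (s, x) f.σ *
        (ev (s, x) f.p ^ 2 + ev (s, x) f.q ^ 2) :=
      mul_nonneg (mul_nonneg (by linarith) (by linarith)) (by positivity)
    have k2 : 0 ≤ (ev (s, x) f.τ - 1 / 2) * (P.e ^ 2 * ev (s, x) f.φ ^ 2) :=
      mul_nonneg (by linarith) (by positivity)
    have k3 : 0 ≤ (ev (s, x) f.σ + ev (s, x) f.φ - 1 / 2) * (P.e ^ 2 * P.g * ev (s, x) f.θ ^ 2) :=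
      mul_nonneg (by linarith) (by positivity)
    linarith
  simpa only [map_add, map_smul, smul_eq_mul] using this

theorem Sys.G0_hi {P : Par} {f : Fld} (h : Sys P f) {s : ℝ} (hs : s ∈ Set.Icc 0 P.T) :
    I s (f.G0 P) ≤ (2 + P.g) * I s (f.X0 P) := by
  have : I s (f.G0 P) ≤ I s ((2 + P.g) • f.X0 P) := by
    apply I_mono
    intro x hx
    have hp := h.pt hs hx
    have a1 := (abs_le.1 hp.ρhi).2
    have a2 := (abs_le.1 hp.σhi).2
    have a3 := (abs_le.1 hp.τhi).2
    have a4 := hp.ρlo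
    have a5 := hp.σlo
    have hg := h.hg
    simp only [Fld.G0, Fld.X0, map_add, map_smul, smul_eq_mul, map_mul, map_pow]
    have k0 : (ev (s, x) f.σ + ev (s, x) f.φ) * ev (s, x) f.σ ≤ 2 * 2 :=
      mul_le_mul a1 a2 (by linarith) (by norm_num)
    have k1 : 0 ≤ (4 - (ev (s, x) f.σ + ev (s, x) f.φ) * ev (s, x) f.σ) *
        (ev (s, x) f.p ^ 2 + ev (s, x) f.q ^ 2) :=
      mul_nonneg (by linarith) (by positivity)
    have k2 : 0 ≤ (2 - ev (s, x) f.τ) * (P.e ^ 2 * ev (s, x) f.φ ^ 2) :=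
      mul_nonneg (by linarith) (by positivity)
    have k3 : 0 ≤ (2 - (ev (s, x) f.σ + ev (s, x) f.φ)) * (P.e ^ 2 * P.g * ev (s, x) f.θ ^ 2) :=
      mul_nonneg (by linarith) (by positivity)
    have k4 : 0 ≤ P.g * (ev (s, x) f.p ^ 2 + ev (s, x) f.q ^ 2 + P.e ^ 2 * ev (s, x) f.φ ^ 2) := by
      positivity
    have k5 : 0 ≤ P.e ^ 2 * ev (s, x) f.φ ^ 2 := by positivity
    have k6 : 0 ≤ P.e ^ 2 * ev (s, x) f.θ ^ 2 := by positivity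
    linarith
  simpa only [map_smul, smul_eq_mul] using this

theorem step0 (a : Par) (hK : 0 ≤ a.K) (hμ : 0 ≤ a.μ) (hg : 0 ≤ a.g) :
    UB a (fun P f t => P.e ^ 2 * (I t (f.G0 P) + P.μ / 4 * J t f.gψ
      + P.κ / 2 * P.e ^ 2 * J t f.gθ)) := by
  refine ⟨2 + a.g + a.μ * (88 * a.K), by positivity, fun P f ha t ht => ?_⟩
  have h := ha.sys
  have b1 := h.E0 ht
  have b2 := h.JS0 ht
  have b3 := h.G0_hi (s := 0) ⟨le_rfl, ht.1.trans ht.2⟩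
  have hM := M0_nonneg h
  have n1 := J_of_I ht.1 fun s => I_gψ_nonneg s f
  have n2 := J_of_I ht.1 fun s => I_gθ_nonneg s f
  have n3 := J_of_I ht.1 fun s => I_gφ_nonneg s f
  obtain ⟨-, -, -, r3, -, r5⟩ := Rq_parts P f ht.1
  simp only [map_add, map_smul, smul_eq_mul] at b1
  have c1 := mul_le_mul_of_nonneg_left b2 hM
  have c2 := mul_le_mul_of_nonneg_right ha.sμ n1
  have n2' : 0 ≤ P.e ^ 2 * J t f.gθ := by positivity
  have c3 := mul_le_mul_of_nonneg_right ha.sκ n2'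
  have hK' : 0 ≤ P.K := ha.K ▸ hK
  have n3' : 0 ≤ 88 * P.K * J t f.gφ := by positivity
  have c4 := mul_le_mul_of_nonneg_right ha.sμ n3'
  have hM2 : 0 ≤ M0 P * (88 * P.K * J t f.gφ) := by positivity
  have k1 := mul_nonneg h.hμ.le n1
  have k2 := mul_nonneg h.hκ.le n2'
  have d : I t (f.G0 P) + P.μ / 4 * J t f.gψ + P.κ / 2 * P.e ^ 2 * J t f.gθ
      ≤ (2 + P.g) * I 0 (f.X0 P) + P.μ * (88 * P.K) * J t f.gφ := by linarith
  have d2 := mul_le_mul_of_nonneg_left d (sq_nonneg P.e)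
  have hg' : 0 ≤ P.g := ha.g ▸ hg
  have hμ' : 0 ≤ P.μ := ha.μ ▸ hμ
  have d3 := mul_le_mul_of_nonneg_left r3 (by positivity : 0 ≤ 2 + P.g)
  have d4 := mul_le_mul_of_nonneg_left r5 (by positivity : 0 ≤ P.μ * (88 * P.K))
  rw [← ha.g, ← ha.μ, ← ha.K]
  linarith

structure Pos (a : Par) : Prop where
  K : 1 ≤ a.K
  μ : 0 < a.μ
  lam : 0 < a.lam
  g : 0 < a.g
  κ : 0 < a.κ

theorem Pos.K0 {a : Par} (h : Pos a) : 0 ≤ a.K := by linarith [h.K]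

theorem G0_nonneg {P : Par} {f : Fld} (h : Sys P f) {t : ℝ} (ht : t ∈ Set.Icc 0 P.T) :
    0 ≤ I t (f.G0 P) := by
  have h1 := h.G0_lo ht
  have := I_sq_nonneg t f.φ
  have := I_sq_nonneg t f.θ
  have := h.hg
  have : 0 ≤ P.e ^ 2 / 4 * I t (f.φ ^ 2) + P.e ^ 2 * P.g / 4 * I t (f.θ ^ 2) := by positivity
  linarith

theorem ub_φθ {a : Par} (ha : Pos a) :
    UB a (fun P f t => P.e ^ 4 * (I t (f.φ ^ 2) + I t (f.θ ^ 2))) := by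
  have hg := ha.g
  refine (step0 a ha.K0 ha.μ.le ha.g.le).lin (4 + 4 / a.g) 0 (by positivity) le_rfl ?_
  intro P f hA t ht
  have h := hA.sys
  have h1 := h.G0_lo ht
  have n1 := J_of_I ht.1 fun s => I_gψ_nonneg s f
  have n2 := J_of_I ht.1 fun s => I_gθ_nonneg s f
  have m1 := I_sq_nonneg t f.φ
  have m2 := I_sq_nonneg t f.θ
  have hμ := h.hμ
  have hκ := h.hκ
  rw [← hA.g] at hg ⊢
  have k : 0 ≤ P.e ^ 2 * (P.μ / 4 * J t f.gψ + P.κ / 2 * P.e ^ 2 * J t f.gθ) := by positivity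
  have k1 : P.e ^ 4 * (I t (f.φ ^ 2) + I t (f.θ ^ 2)) ≤ (4 + 4 / P.g) * (P.e ^ 2 *
      (P.e ^ 2 / 4 * I t (f.φ ^ 2) + P.e ^ 2 * P.g / 4 * I t (f.θ ^ 2))) := by
    have : (4 + 4 / P.g) * (P.e ^ 2 * (P.e ^ 2 / 4 * I t (f.φ ^ 2) + P.e ^ 2 * P.g / 4 * I t (f.θ ^ 2)))
      = P.e ^ 4 * (I t (f.φ ^ 2) + I t (f.θ ^ 2)) + P.e ^ 4 * (P.g * I t (f.θ ^ 2))
        + P.e ^ 4 * (I t (f.φ ^ 2) / P.g) := by field_simp; ring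
    have : 0 ≤ P.e ^ 4 * (P.g * I t (f.θ ^ 2)) := by positivity
    have : 0 ≤ P.e ^ 4 * (I t (f.φ ^ 2) / P.g) := by positivity
    linarith
  have k2 : P.e ^ 2 * (P.e ^ 2 / 4 * I t (f.φ ^ 2) + P.e ^ 2 * P.g / 4 * I t (f.θ ^ 2)) ≤
      P.e ^ 2 * (I t (f.G0 P) + P.μ / 4 * J t f.gψ + P.κ / 2 * P.e ^ 2 * J t f.gθ) := by
    have := mul_le_mul_of_nonneg_left h1 (sq_nonneg P.e)
    linarith
  have := mul_le_mul_of_nonneg_left k2 (by positivity : 0 ≤ 4 + 4 / P.g)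
  linarith

theorem ub_Jψ {a : Par} (ha : Pos a) : UB a (fun P f t => P.e ^ 2 * J t f.gψ) := by
  have hμ := ha.μ
  refine (step0 a ha.K0 ha.μ.le ha.g.le).lin (4 / a.μ) 0 (by positivity) le_rfl ?_
  intro P f hA t ht
  have h := hA.sys
  have n1 := J_of_I ht.1 fun s => I_gψ_nonneg s f
  have n2 := J_of_I ht.1 fun s => I_gθ_nonneg s f
  have n3 := G0_nonneg h ht
  have hκ := h.hκ
  rw [← hA.μ] at hμ ⊢
  have e : (4 / P.μ) * (P.e ^ 2 * (I t (f.G0 P) + P.μ / 4 * J t f.gψ + P.κ / 2 * P.e ^ 2 * J t f.gθ))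
    = P.e ^ 2 * J t f.gψ + (4 / P.μ) * (P.e ^ 2 * (I t (f.G0 P) + P.κ / 2 * P.e ^ 2 * J t f.gθ)) := by
    field_simp; ring
  have : 0 ≤ (4 / P.μ) * (P.e ^ 2 * (I t (f.G0 P) + P.κ / 2 * P.e ^ 2 * J t f.gθ)) := by positivity
  linarith

theorem ub_Jθ {a : Par} (ha : Pos a) : UB a (fun P f t => P.e ^ 4 * J t f.gθ) := by
  have hκ := ha.κ
  refine (step0 a ha.K0 ha.μ.le ha.g.le).lin (2 / a.κ) 0 (by positivity) le_rfl ?_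
  intro P f hA t ht
  have h := hA.sys
  have n1 := J_of_I ht.1 fun s => I_gψ_nonneg s f
  have n2 := J_of_I ht.1 fun s => I_gθ_nonneg s f
  have n3 := G0_nonneg h ht
  have hμ := h.hμ
  rw [← hA.κ] at hκ ⊢
  have e : (2 / P.κ) * (P.e ^ 2 * (I t (f.G0 P) + P.μ / 4 * J t f.gψ + P.κ / 2 * P.e ^ 2 * J t f.gθ))
    = P.e ^ 4 * J t f.gθ + (2 / P.κ) * (P.e ^ 2 * (I t (f.G0 P) + P.μ / 4 * J t f.gψ)) := by
    field_simp; ring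
  have : 0 ≤ (2 / P.κ) * (P.e ^ 2 * (I t (f.G0 P) + P.μ / 4 * J t f.gψ)) := by positivity
  linarith

theorem Sys.poinJ {P : Par} {f : Fld} (h : Sys P f) {t : ℝ} (ht : t ∈ Set.Icc 0 P.T) :
    J t (f.q ^ 2) ≤ 4 * J t f.gψ ∧ J t (f.θ ^ 2) ≤ 4 * J t f.gθ ∧ J t (f.φ ^ 2) ≤ 40 * J t f.gφ := by
  have key : ∀ s ∈ Set.Ioo 0 t, s ∈ Set.Icc 0 P.T := fun s hs => ⟨hs.1.le, hs.2.le.trans ht.2⟩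
  refine ⟨?_, ?_, ?_⟩
  · have : J t (f.q ^ 2) ≤ J t ((4:ℝ) • f.gψ) := J_mono_I ht.1 fun s hs => by
      have := (h.poin (key s hs)).1
      have := I_sq_nonneg s f.p
      rw [map_smul, smul_eq_mul]; linarith
    simpa only [map_smul, smul_eq_mul] using this
  · have : J t (f.θ ^ 2) ≤ J t ((4:ℝ) • f.gθ) := J_mono_I ht.1 fun s hs => by
      have := (h.poin (key s hs)).2.1
      rw [map_smul, smul_eq_mul]; linarith
    simpa only [map_smul, smul_eq_mul] using this
  · have : J t (f.φ ^ 2) ≤ J t ((40:ℝ) • f.gφ) := J_mono_I ht.1 fun s hs => by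
      have := (h.poin (key s hs)).2.2
      rw [map_smul, smul_eq_mul]; linarith
    simpa only [map_smul, smul_eq_mul] using this

theorem G1_eq (f : Fld) : f.G1 = f.gθ := by unfold Fld.G1 Fld.gθ; ring

theorem ub_Jθt {a : Par} (ha : Pos a) : UB a (fun P f t => P.e ^ 2 * J t (dT f.θ ^ 2)) := by
  have hκ := ha.κ
  have hg := ha.g
  have hc : 0 ≤ cθ a := by unfold cθ; positivity
  refine ((ub_Jψ ha).add (ub_Jθ ha)).lin (4 / a.g * (5 * cθ a)) (4 / a.g * (a.κ / 2)) (by positivity)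
    (by positivity) ?_
  intro P f hA t ht
  have h := hA.sys
  have b1 := h.E1θ ht
  have b2 := (h.poinJ ht).1
  have n1 := J_of_I ht.1 fun s => I_gψ_nonneg s f
  have n2 := J_of_I ht.1 fun s => I_gθ_nonneg s f
  have n3 := I_gθ_nonneg t f
  obtain ⟨-, -, r2, -, -, -⟩ := Rq_parts P f ht.1
  have ec : cθ P = cθ a := by unfold cθ; rw [hA.μ, hA.r, hA.g, hA.K]
  simp only [Fld.Sθ, G1_eq, map_add, map_smul, smul_eq_mul, ec] at b1
  rw [hA.κ, hA.g] at b1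
  have E := h.E1'
  have c1 := mul_le_mul_of_nonneg_left r2 hκ.le
  have c0 : 0 ≤ a.κ * P.e ^ 2 / 2 * I t f.gθ := by positivity
  have c2 : P.e ^ 2 * J t f.gθ ≤ P.e ^ 4 * J t f.gθ := by
    have := mul_le_mul_of_nonneg_right E (by positivity : 0 ≤ P.e ^ 2 * J t f.gθ)
    linarith
  have n2' : 0 ≤ P.e ^ 4 * J t f.gθ := by positivity
  have c3 : P.e ^ 2 * (J t f.gθ + J t (f.q ^ 2) + J t f.gψ) ≤
      5 * (P.e ^ 2 * J t f.gψ + P.e ^ 4 * J t f.gθ) := by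
    have := mul_le_mul_of_nonneg_left b2 (by positivity : 0 ≤ P.e ^ 2)
    linarith
  have c4 := mul_le_mul_of_nonneg_left c3 hc
  have c5 : a.g * P.e ^ 2 / 4 * J t (dT f.θ ^ 2) ≤ cθ a * (5 * (P.e ^ 2 * J t f.gψ + P.e ^ 4 * J t f.gθ))
      + a.κ / 2 * Rq P f t := by linarith
  have c6 := mul_le_mul_of_nonneg_left c5 (by positivity : 0 ≤ 4 / a.g)
  have e6 : 4 / a.g * (a.g * P.e ^ 2 / 4 * J t (dT f.θ ^ 2)) = P.e ^ 2 * J t (dT f.θ ^ 2) := by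
    field_simp
  linarith

theorem Gψ_real {μ lam e p1 p2 q1 q2 Z φ θ : ℝ} (hμ : 0 < μ) (hlam : 0 < lam)
    (hZ : |Z| ≤ 2 * |φ| + 2 * |θ|) :
    μ / 4 * (p1 ^ 2 + p2 ^ 2 + q1 ^ 2 + q2 ^ 2) - 16 / μ * e ^ 4 * (φ ^ 2 + θ ^ 2)
      ≤ μ / 2 * (p1 * p1 + p2 * p2 + q1 * q1 + q2 * q2) + lam / 2 * ((p1 + q2) * (p1 + q2))
        - e ^ 2 * (Z * (p1 + q2)) ∧
    μ / 2 * (p1 * p1 + p2 * p2 + q1 * q1 + q2 * q2) + lam / 2 * ((p1 + q2) * (p1 + q2))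
        - e ^ 2 * (Z * (p1 + q2)) ≤
    (μ + lam) * (p1 ^ 2 + p2 ^ 2 + q1 ^ 2 + q2 ^ 2) + 16 / μ * e ^ 4 * (φ ^ 2 + θ ^ 2) := by
  have h1 : Z ^ 2 ≤ 8 * (φ ^ 2 + θ ^ 2) := by
    have : Z ^ 2 ≤ (2 * |φ| + 2 * |θ|) ^ 2 := by
      rw [← sq_abs Z]; gcongr
    have e1 := sq_abs φ
    have e2 := sq_abs θ
    nlinarith [sq_nonneg (|φ| - |θ|)]
  set D := p1 + q2 with hD
  have hD2 : D ^ 2 ≤ 2 * (p1 ^ 2 + p2 ^ 2 + q1 ^ 2 + q2 ^ 2) := by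
    rw [hD]; nlinarith [sq_nonneg (p1 - q2), sq_nonneg p2, sq_nonneg q1]
  have h2 : ∀ z : ℝ, z ^ 2 = Z ^ 2 → e ^ 2 * (z * D) ≤ μ / 8 * D ^ 2 + 2 / μ * e ^ 4 * Z ^ 2 := by
    intro z hz
    have k : 0 ≤ (μ * D - 4 * e ^ 2 * z) ^ 2 / (8 * μ) := by positivity
    have k2 : (μ * D - 4 * e ^ 2 * z) ^ 2 / (8 * μ) = μ / 8 * D ^ 2 + 2 / μ * e ^ 4 * z ^ 2
      - e ^ 2 * (z * D) := by field_simp; ring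
    rw [← hz]; linarith
  have h3 : 2 / μ * e ^ 4 * Z ^ 2 ≤ 16 / μ * e ^ 4 * (φ ^ 2 + θ ^ 2) := by
    have := mul_le_mul_of_nonneg_left h1 (by positivity : 0 ≤ 2 / μ * e ^ 4)
    have e1 : 2 / μ * e ^ 4 * (8 * (φ ^ 2 + θ ^ 2)) = 16 / μ * e ^ 4 * (φ ^ 2 + θ ^ 2) := by ring
    linarith
  have a1 := h2 Z rfl
  have a2 := h2 (-Z) (by ring)
  have a3 := mul_le_mul_of_nonneg_left hD2 hμ.le
  have a4 := mul_le_mul_of_nonneg_left hD2 hlam.le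
  have a5 : 0 ≤ lam * D ^ 2 := by positivity
  have a6 : 0 ≤ μ * (p1 ^ 2 + p2 ^ 2 + q1 ^ 2 + q2 ^ 2) := by positivity
  constructor <;> linarith

theorem Sys.Gψ_bd {P : Par} {f : Fld} (h : Sys P f) {s : ℝ} (hs : s ∈ Set.Icc 0 P.T) :
    P.μ / 4 * I s f.gψ - 16 / P.μ * (P.e ^ 4 * (I s (f.φ ^ 2) + I s (f.θ ^ 2))) ≤ I s (f.Gψ P) ∧
    I s (f.Gψ P) ≤ (P.μ + P.lam) * I s f.gψ
      + 16 / P.μ * (P.e ^ 4 * (I s (f.φ ^ 2) + I s (f.θ ^ 2))) := by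
  have key : ∀ x ∈ Ω, |ev (s, x) f.Pr| ≤ 2 * |ev (s, x) f.φ| + 2 * |ev (s, x) f.θ| := by
    intro x hx
    have hp := h.pt hs hx
    have e : ev (s, x) f.Pr = ev (s, x) f.τ * ev (s, x) f.φ
        + (ev (s, x) f.σ + ev (s, x) f.φ) * ev (s, x) f.θ := by
      simp only [Fld.Pr, map_add, map_mul]; ring
    rw [e]
    refine (abs_add_le _ _).trans ?_
    rw [abs_mul, abs_mul]
    exact add_le_add (mul_le_mul_of_nonneg_right hp.τhi (abs_nonneg _))
      (mul_le_mul_of_nonneg_right hp.ρhi (abs_nonneg _))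
  constructor
  · have : I s ((P.μ / 4) • f.gψ - (16 / P.μ * P.e ^ 4) • (f.φ ^ 2 + f.θ ^ 2)) ≤ I s (f.Gψ P) := by
      apply I_mono
      intro x hx
      have := (Gψ_real (e := P.e) (p1 := ev (s, x) (dX f.p)) (p2 := ev (s, x) (dY f.p))
        (q1 := ev (s, x) (dX f.q)) (q2 := ev (s, x) (dY f.q)) h.hμ h.hlam (key x hx)).1
      simpa only [Fld.Gψ, Fld.gψ, Fld.D, map_add, map_sub, map_smul, smul_eq_mul, map_mul,
        map_pow] using this
    simp only [map_add, map_sub, map_smul, smul_eq_mul] at this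
    linarith
  · have : I s (f.Gψ P) ≤ I s ((P.μ + P.lam) • f.gψ + (16 / P.μ * P.e ^ 4) • (f.φ ^ 2 + f.θ ^ 2)) := by
      apply I_mono
      intro x hx
      have := (Gψ_real (e := P.e) (p1 := ev (s, x) (dX f.p)) (p2 := ev (s, x) (dY f.p))
        (q1 := ev (s, x) (dX f.q)) (q2 := ev (s, x) (dY f.q)) h.hμ h.hlam (key x hx)).2
      simpa only [Fld.Gψ, Fld.gψ, Fld.D, map_add, map_sub, map_smul, smul_eq_mul, map_mul,
        map_pow] using this
    simp only [map_add, map_sub, map_smul, smul_eq_mul] at this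
    linarith

theorem ub_ψ {a : Par} (ha : Pos a) : UB a (fun P f t => P.μ / 4 * I t f.gψ
    + 1 / 4 * (J t (dT f.p ^ 2) + J t (dT f.q ^ 2))) := by
  have hμ := ha.μ
  have hlam := ha.lam
  have hK := ha.K0
  have hc : 0 ≤ cψ a := by unfold cψ; positivity
  refine ((ub_Jψ ha).add ((ub_φθ ha).add (ub_Jθt ha))).lin (5 * cψ a + 16 / a.μ)
    (a.μ + a.lam + 16 / a.μ + cψ a) (by positivity) (by positivity) ?_
  intro P f hA t ht
  have h := hA.sys
  have b1 := h.E1ψ ht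
  have b2 := (h.poinJ ht).1
  have b3 := (h.Gψ_bd ht).1
  have b4 := (h.Gψ_bd (s := 0) ⟨le_rfl, ht.1.trans ht.2⟩).2
  have n1 := J_of_I ht.1 fun s => I_gψ_nonneg s f
  have n2 := J_sq_nonneg ht.1 (dT f.θ)
  have n3 := I_sq_nonneg t f.φ
  have n4 := I_sq_nonneg t f.θ
  obtain ⟨r0, r1, -, r3, -, r5⟩ := Rq_parts P f ht.1
  have ec : cψ P = cψ a := by unfold cψ; rw [hA.K]
  simp only [Fld.Sψ, map_add, map_smul, smul_eq_mul, ec] at b1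
  have r3' : P.e ^ 4 * (I 0 (f.φ ^ 2) + I 0 (f.θ ^ 2)) ≤ Rq P f t := by
    have m1 := mul_nonneg (sq_nonneg P.e) (I_sq_nonneg 0 f.p)
    have m2 := mul_nonneg (sq_nonneg P.e) (I_sq_nonneg 0 f.q)
    simp only [Fld.X0, map_add, map_smul, smul_eq_mul] at r3
    linarith
  have q : 0 ≤ 16 / a.μ := by positivity
  rw [hA.μ] at b3 b4 ⊢
  rw [hA.lam] at b4
  have c1 := mul_le_mul_of_nonneg_left r1 (by positivity : 0 ≤ a.μ + a.lam)
  have c2 := mul_le_mul_of_nonneg_left r3' q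
  have c3 := mul_le_mul_of_nonneg_left b2 (by positivity : 0 ≤ P.e ^ 2)
  have z1 : 0 ≤ P.e ^ 2 * J t f.gψ := by positivity
  have z2 : 0 ≤ P.e ^ 2 * J t (dT f.θ ^ 2) := by positivity
  have z3 : 0 ≤ P.e ^ 4 * (I t (f.φ ^ 2) + I t (f.θ ^ 2)) := by positivity
  have c4 : P.e ^ 2 * (J t f.gφ + J t (dT f.θ ^ 2) + J t (f.q ^ 2) + J t f.gψ) ≤
      Rq P f t + 5 * (P.e ^ 2 * J t f.gψ + (P.e ^ 4 * (I t (f.φ ^ 2) + I t (f.θ ^ 2)) + P.e ^ 2 * J t (dT f.θ ^ 2))) := by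
    linarith
  have c5 := mul_le_mul_of_nonneg_left c4 hc
  have c6 : 16 / a.μ * (P.e ^ 4 * (I t (f.φ ^ 2) + I t (f.θ ^ 2))) ≤ 16 / a.μ *
      (P.e ^ 2 * J t f.gψ + (P.e ^ 4 * (I t (f.φ ^ 2) + I t (f.θ ^ 2)) + P.e ^ 2 * J t (dT f.θ ^ 2))) :=
    mul_le_mul_of_nonneg_left (by linarith) q
  linarith

theorem ub_2 {a : Par} (ha : Pos a) : UB a (fun P f t => P.e ^ 2 / 2 * I t (dX f.φ ^ 2)
    + P.μ / 2 * (J t (dX (dX f.p) ^ 2) + J t (dX (dY f.p) ^ 2) + J t (dX (dX f.q) ^ 2)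
      + J t (dX (dY f.q) ^ 2))) := by
  have hμ := ha.μ
  have hK := ha.K0
  have hc : 0 ≤ c2 a := by unfold c2; positivity
  refine ((ub_Jψ ha).add ((ub_Jθ ha).add (ub_ψ ha))).lin (5 * c2 a)
    (1 + c2 a) (by positivity) (by positivity) ?_
  intro P f hA t ht
  have h := hA.sys
  have b1 := h.E2 ht
  have b2 := (h.poinJ ht).1
  have n1 := J_of_I ht.1 fun s => I_gψ_nonneg s f
  have n2 := I_gψ_nonneg t f
  have n3 := J_sq_nonneg ht.1 (dX f.θ)
  have n3' := J_sq_nonneg ht.1 (dY f.θ)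
  have n4 := J_sq_nonneg ht.1 (dT f.p)
  have n5 := J_sq_nonneg ht.1 (dT f.q)
  have n6 := I_sq_nonneg 0 (dY f.φ)
  obtain ⟨r0, -, -, -, r4, r5⟩ := Rq_parts P f ht.1
  have ec : c2 P = c2 a := by unfold c2; rw [hA.K, hA.μ]
  simp only [Fld.S2, ← pow_two, map_add, map_smul, smul_eq_mul, ec] at b1
  have r4' : P.e ^ 2 / 2 * I 0 (dX f.φ ^ 2) ≤ Rq P f t := by
    have m1 := mul_nonneg (sq_nonneg P.e) (I_sq_nonneg 0 (dY f.φ))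
    have m2 := mul_nonneg (sq_nonneg P.e) (I_sq_nonneg 0 (dX f.φ))
    simp only [Fld.gφ, map_add] at r4
    linarith
  have hμ' := h.hμ
  have c3 := mul_le_mul_of_nonneg_left b2 (by positivity : 0 ≤ P.e ^ 2)
  have z1 : 0 ≤ P.μ / 4 * I t f.gψ := by positivity
  have z2 : 0 ≤ P.e ^ 2 * J t f.gψ := by positivity
  have z3 : 0 ≤ P.e ^ 4 * J t (dX f.θ ^ 2) := by positivity
  have z4 : 0 ≤ P.e ^ 4 * J t (dY f.θ ^ 2) := by positivity
  have c4 : P.e ^ 2 * (J t f.gφ + J t (f.q ^ 2) + J t f.gψ) + P.e ^ 4 * J t (dX f.θ ^ 2)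
      + J t (dT f.p ^ 2) + J t (dT f.q ^ 2) ≤ Rq P f t + 5 * (P.e ^ 2 * J t f.gψ +
        (P.e ^ 4 * J t f.gθ + (P.μ / 4 * I t f.gψ + 1 / 4 * (J t (dT f.p ^ 2) + J t (dT f.q ^ 2))))) := by
    simp only [Fld.gθ, map_add]
    linarith
  have c5 := mul_le_mul_of_nonneg_left c4 hc
  linarith

theorem ub_3 {a : Par} (ha : Pos a) : UB a (fun P f t => P.e ^ 2 / 2 * I t (dY f.φ ^ 2)
    + P.μ / 2 * J t ((dY f.D) ^ 2)) := by
  have hμ := ha.μ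
  have hK := ha.K0
  have hc : 0 ≤ c3 a := by unfold c3; positivity
  refine ((ub_Jψ ha).add ((ub_Jθ ha).add ((ub_ψ ha).add (ub_2 ha)))).lin ((9 + 2 / a.μ) * c3 a)
    (1 + 41 * c3 a) (by positivity) (by positivity) ?_
  intro P f hA t ht
  have h := hA.sys
  have b1 := h.E3 ht
  obtain ⟨b2, b3, b4⟩ := h.poinJ ht
  have n1 := J_of_I ht.1 fun s => I_gψ_nonneg s f
  have n2 := I_gψ_nonneg t f
  have n3 := J_sq_nonneg ht.1 (dX f.θ)
  have n3' := J_sq_nonneg ht.1 (dY f.θ)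
  have n4 := J_sq_nonneg ht.1 (dT f.p)
  have n5 := J_sq_nonneg ht.1 (dT f.q)
  have n6 := J_sq_nonneg ht.1 (dX (dX f.p))
  have n7 := J_sq_nonneg ht.1 (dX (dX f.q))
  have n8 := J_sq_nonneg ht.1 (dX (dY f.p))
  have n9 := J_sq_nonneg ht.1 (dX (dY f.q))
  have n10 := I_sq_nonneg t (dX f.φ)
  have n11 := J_of_I ht.1 fun s => I_gθ_nonneg s f
  obtain ⟨r0, -, -, -, r4, r5⟩ := Rq_parts P f ht.1
  have ec : c3 P = c3 a := by unfold c3; rw [hA.K, hA.μ]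
  simp only [Fld.S3, ← pow_two, map_add, map_smul, smul_eq_mul, ec] at b1
  have r4' : P.e ^ 2 / 2 * I 0 (dY f.φ ^ 2) ≤ Rq P f t := by
    have m1 := mul_nonneg (sq_nonneg P.e) (I_sq_nonneg 0 (dY f.φ))
    have m2 := mul_nonneg (sq_nonneg P.e) (I_sq_nonneg 0 (dX f.φ))
    simp only [Fld.gφ, map_add] at r4
    linarith
  have hμ' := h.hμ
  have E := h.E1'
  have x2 := mul_le_mul_of_nonneg_left b2 (by positivity : 0 ≤ P.e ^ 2)
  have x3 := mul_le_mul_of_nonneg_left b3 (by positivity : 0 ≤ P.e ^ 2)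
  have x4 := mul_le_mul_of_nonneg_left b4 (by positivity : 0 ≤ P.e ^ 2)
  have z0 : P.e ^ 2 * J t f.gθ ≤ P.e ^ 4 * J t f.gθ := by
    have := mul_le_mul_of_nonneg_right E (by positivity : 0 ≤ P.e ^ 2 * J t f.gθ)
    linarith
  have z1 : 0 ≤ P.μ / 4 * I t f.gψ := by positivity
  have z2 : 0 ≤ P.e ^ 2 * J t f.gψ := by positivity
  have z3 : 0 ≤ P.e ^ 4 * J t (dX f.θ ^ 2) := by positivity
  have z4 : 0 ≤ P.e ^ 4 * J t (dY f.θ ^ 2) := by positivity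
  have z6 : 0 ≤ P.e ^ 4 * J t f.gθ := by positivity
  have z5 : 0 ≤ P.e ^ 2 / 2 * I t (dX f.φ ^ 2) := by positivity
  set Q1 := P.e ^ 2 * J t f.gψ with hQ1
  set Q2 := P.e ^ 4 * J t f.gθ with hQ2
  set Q3 := P.μ / 4 * I t f.gψ + 1 / 4 * (J t (dT f.p ^ 2) + J t (dT f.q ^ 2)) with hQ3
  set Q4 := P.e ^ 2 / 2 * I t (dX f.φ ^ 2)
    + P.μ / 2 * (J t (dX (dX f.p) ^ 2) + J t (dX (dY f.p) ^ 2) + J t (dX (dX f.q) ^ 2)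
      + J t (dX (dY f.q) ^ 2)) with hQ4
  have m3 : 0 ≤ Q3 := by positivity
  have m4 : 0 ≤ Q4 := by positivity
  have w1 : J t (dX (dX f.q) ^ 2) + J t (dX (dY f.p) ^ 2) ≤ 2 / P.μ * Q4 := by
    have : 2 / P.μ * Q4 = 2 / P.μ * (P.e ^ 2 / 2 * I t (dX f.φ ^ 2)) + (J t (dX (dX f.p) ^ 2) + J t (dX (dY f.p) ^ 2) + J t (dX (dX f.q) ^ 2)
      + J t (dX (dY f.q) ^ 2)) := by rw [hQ4]; field_simp
    have : 0 ≤ 2 / P.μ * (P.e ^ 2 / 2 * I t (dX f.φ ^ 2)) := by positivity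
    linarith
  have w2 : P.e ^ 4 * J t (dY f.θ ^ 2) ≤ Q2 := by
    rw [hQ2]; simp only [Fld.gθ, map_add]; linarith
  have w3 : J t (dT f.q ^ 2) ≤ 4 * Q3 := by linarith
  rw [hA.μ] at w1
  have q : 0 ≤ 2 / a.μ := by positivity
  have w4 : 0 ≤ 2 / a.μ * (Q1 + (Q2 + Q3)) := by positivity
  have c4 : P.e ^ 2 * (J t f.gφ + J t (f.q ^ 2) + J t f.gψ + J t (f.φ ^ 2) + J t (f.θ ^ 2))
      + P.e ^ 4 * J t (dY f.θ ^ 2) + J t (dT f.q ^ 2)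
      + J t (dX (dX f.q) ^ 2) + J t (dX (dY f.p) ^ 2) ≤ 41 * Rq P f t + (9 + 2 / a.μ) * (Q1 + (Q2 + (Q3 + Q4))) := by
    linarith
  have c5 := mul_le_mul_of_nonneg_left c4 hc
  linarith

theorem ub_final {a : Par} (ha : Pos a) : UB a (fun P f t => P.e ^ 2 * I t f.gφ
    + (I t (dX f.p ^ 2) + I t (dX f.q ^ 2)) + J t (dX f.D ^ 2 + dY f.D ^ 2)) := by
  have hμ := ha.μ
  refine ((ub_ψ ha).add ((ub_2 ha).add (ub_3 ha))).lin (2 + 4 / a.μ) 0 (by positivity) le_rfl ?_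
  intro P f hA t ht
  have h := hA.sys
  have hμ' := h.hμ
  have n2 := I_sq_nonneg t (dY f.p)
  have n3 := I_sq_nonneg t (dY f.q)
  have n2' := I_sq_nonneg t (dX f.p)
  have n3' := I_sq_nonneg t (dX f.q)
  have n4 := J_sq_nonneg ht.1 (dT f.p)
  have n5 := J_sq_nonneg ht.1 (dT f.q)
  have n6 := J_sq_nonneg ht.1 (dX (dX f.p))
  have n7 := J_sq_nonneg ht.1 (dX (dX f.q))
  have n8 := J_sq_nonneg ht.1 (dX (dY f.p))
  have n9 := J_sq_nonneg ht.1 (dX (dY f.q))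
  have n10 := I_sq_nonneg t (dX f.φ)
  have n12 := I_sq_nonneg t (dY f.φ)
  have n11 := J_sq_nonneg ht.1 (dY f.D)
  have k : J t (dX f.D ^ 2) ≤ 2 * (J t (dX (dX f.p) ^ 2) + J t (dX (dY f.q) ^ 2)) := by
    have : J t (dX f.D ^ 2) ≤ J t ((2:ℝ) • (dX (dX f.p) ^ 2 + dX (dY f.q) ^ 2)) := by
      apply J_mono ht.1
      intro s _ x _
      simp only [Fld.D, map_add, map_smul, smul_eq_mul, map_pow]
      nlinarith [sq_nonneg (ev (s, x) (dX (dX f.p)) - ev (s, x) (dX (dY f.q)))]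
    simpa only [map_add, map_smul, smul_eq_mul] using this
  simp only [Fld.gφ, Fld.gψ, map_add]
  rw [hA.μ] at *
  generalize J t (dX f.D ^ 2) = D1 at *
  generalize J t (dY f.D ^ 2) = D2 at *
  generalize J t (dX (dX f.p) ^ 2) = y1 at *
  generalize J t (dX (dX f.q) ^ 2) = y2 at *
  generalize J t (dX (dY f.p) ^ 2) = y3 at *
  generalize J t (dX (dY f.q) ^ 2) = y4 at *
  generalize J t (dT f.p ^ 2) = y5 at *
  generalize J t (dT f.q ^ 2) = y6 at *
  generalize I t (dX f.φ ^ 2) = x1 at *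
  generalize I t (dY f.φ ^ 2) = x2 at *
  generalize I t (dX f.p ^ 2) = x3 at *
  generalize I t (dY f.p ^ 2) = x4 at *
  generalize I t (dX f.q ^ 2) = x5 at *
  generalize I t (dY f.q ^ 2) = x6 at *
  have e : (2 + 4 / a.μ) * (a.μ / 4 * (x3 + x4 + x5 + x6) + 1 / 4 * (y5 + y6) +
    (P.e ^ 2 / 2 * x1 + a.μ / 2 * (y1 + y3 + y2 + y4) + (P.e ^ 2 / 2 * x2 + a.μ / 2 * D2)))
    = P.e ^ 2 * (x1 + x2) + (x3 + x4 + x5 + x6) + 2 * (y1 + y3 + y2 + y4) + 2 * D2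
      + (4 / a.μ) * (P.e ^ 2 / 2 * (x1 + x2) + 1 / 4 * (y5 + y6))
      + 2 * (a.μ / 4 * (x3 + x4 + x5 + x6) + 1 / 4 * (y5 + y6) + a.μ / 2 * (y1 + y3 + y2 + y4)
        + a.μ / 2 * D2) := by
    field_simp; ring
  rw [e]
  have p1 : 0 ≤ (4 / a.μ) * (P.e ^ 2 / 2 * (x1 + x2) + 1 / 4 * (y5 + y6)) := by positivity
  have p2 : 0 ≤ 2 * (a.μ / 4 * (x3 + x4 + x5 + x6) + 1 / 4 * (y5 + y6) + a.μ / 2 * (y1 + y3 + y2 + y4)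
        + a.μ / 2 * D2) := by positivity
  linarith

/-! ### Slices and Sobolev norms -/

theorem iter_slice {V : Type*} [NormedAddCommGroup V] [NormedSpace ℝ V] {G : E3 → V}
    (hG : ContDiff ℝ (⊤ : ℕ∞) G) (j : ℕ) (s : ℝ) (x : ℝ × ℝ) :
    iteratedFDeriv ℝ j (fun x => G (s, x)) x
      = (iteratedFDeriv ℝ j G (s, x)).compContinuousLinearMap
          (fun _ => ContinuousLinearMap.inr ℝ ℝ (ℝ × ℝ)) := by
  have e : (fun x => G (s, x))
      = (fun z => G ((s, 0) + z)) ∘ (ContinuousLinearMap.inr ℝ ℝ (ℝ × ℝ)) := by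
    funext x; simp
  have hG' : ContDiff ℝ (⊤ : ℕ∞) (fun z => G ((s, 0) + z)) :=
    hG.comp (contDiff_const.add contDiff_id)
  have hj : (j : WithTop ℕ∞) ≤ ((⊤ : ℕ∞) : WithTop ℕ∞) := by exact_mod_cast le_top
  rw [e, ContinuousLinearMap.iteratedFDeriv_comp_right _ hG' x hj, iteratedFDeriv_comp_add_left]
  simp

theorem iter_slice_cont {V : Type*} [NormedAddCommGroup V] [NormedSpace ℝ V] {G : E3 → V}
    (hG : ContDiff ℝ (⊤ : ℕ∞) G) (j : ℕ) :
    Continuous (fun z : E3 => ‖iteratedFDeriv ℝ j (fun x => G (z.1, x)) z.2‖ ^ 2) := by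
  have h : (fun z : E3 => ‖iteratedFDeriv ℝ j (fun x => G (z.1, x)) z.2‖ ^ 2)
      = fun z : E3 => ‖(iteratedFDeriv ℝ j G z).compContinuousLinearMap
          (fun _ => ContinuousLinearMap.inr ℝ ℝ (ℝ × ℝ))‖ ^ 2 := by
    funext z; rw [iter_slice hG]
  rw [h]
  have hj : (j : WithTop ℕ∞) ≤ ((⊤ : ℕ∞) : WithTop ℕ∞) := by exact_mod_cast le_top
  have h1 : Continuous (iteratedFDeriv ℝ j G) := hG.continuous_iteratedFDeriv hj
  have h2 : Continuous (fun z : E3 => (iteratedFDeriv ℝ j G z).compContinuousLinearMap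
          (fun _ => ContinuousLinearMap.inr ℝ ℝ (ℝ × ℝ))) :=
    (ContinuousMultilinearMap.compContinuousLinearMapL (𝕜 := ℝ) (F := V)
      (fun _ : Fin j => ContinuousLinearMap.inr ℝ ℝ (ℝ × ℝ))).continuous.comp h1
  exact h2.norm.pow 2

theorem slice_c {g : E3 → ℝ} (hg : Continuous g) (s : ℝ) :
    Continuous (fun x : ℝ × ℝ => g (s, x)) := by fun_prop

theorem param_cont {g : E3 → ℝ} (hg : Continuous g) :
    Continuous (fun s : ℝ => ∫ x in Ω, g (s, x)) := by
  have e : (fun s : ℝ => ∫ x in Ω, g (s, x))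
      = fun s => ∫ x in (0:ℝ)..(2 * π), ∫ y in (0:ℝ)..1, g (s, x, y) := by
    funext s
    exact setInt_iter (g := fun x => g (s, x)) (by fun_prop)
  rw [e]
  apply intervalIntegral.continuous_parametric_intervalIntegral_of_continuous'
    (f := fun s x => ∫ y in (0:ℝ)..1, g (s, x, y))
  exact intervalIntegral.continuous_parametric_intervalIntegral_of_continuous'
    (f := fun (z : ℝ × ℝ) y => g (z.1, z.2, y)) (by
      show Continuous fun w : (ℝ × ℝ) × ℝ => g (w.1.1, w.1.2, w.2)
      fun_prop) _ _

theorem dSq_cont {V : Type*} [NormedAddCommGroup V] [NormedSpace ℝ V] {G : E3 → V}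
    (hG : ContDiff ℝ (⊤ : ℕ∞) G) (j : ℕ) :
    Continuous (fun s => dSq j (fun x => G (s, x))) :=
  param_cont (iter_slice_cont hG j)

theorem dSq_nonneg {V : Type*} [NormedAddCommGroup V] [NormedSpace ℝ V] (j : ℕ)
    (f : ℝ × ℝ → V) : 0 ≤ dSq j f :=
  integral_nonneg fun _ => by positivity

theorem HSq_nonneg {V : Type*} [NormedAddCommGroup V] [NormedSpace ℝ V] (j : ℕ)
    (f : ℝ × ℝ → V) : 0 ≤ HSq j f :=
  Finset.sum_nonneg fun _ _ => dSq_nonneg _ _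

theorem L2Sq_nonneg {V : Type*} [NormedAddCommGroup V] [NormedSpace ℝ V]
    (f : ℝ × ℝ → V) : 0 ≤ L2Sq f := dSq_nonneg _ _

theorem dSq_le_I {V : Type*} [NormedAddCommGroup V] [NormedSpace ℝ V] {G : E3 → V}
    (hG : ContDiff ℝ (⊤ : ℕ∞) G) (j : ℕ) (s : ℝ) (f : SF)
    (h : ∀ x ∈ Ω, ‖iteratedFDeriv ℝ j (fun x => G (s, x)) x‖ ^ 2 ≤ ev (s, x) f) :
    dSq j (fun x => G (s, x)) ≤ I s f := by
  have hc : Continuous (fun x : ℝ × ℝ => ‖iteratedFDeriv ℝ j (fun x => G (s, x)) x‖ ^ 2) :=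
    slice_c (iter_slice_cont hG j) s
  exact setIntegral_mono_on (cont_integrableOn hc) (cont_integrableOn (slice_cont f s)) Ω_meas h

theorem I_le_dSq {V : Type*} [NormedAddCommGroup V] [NormedSpace ℝ V] {G : E3 → V}
    (hG : ContDiff ℝ (⊤ : ℕ∞) G) (j : ℕ) (s c : ℝ) (f : SF)
    (h : ∀ x ∈ Ω, ev (s, x) f ≤ c * ‖iteratedFDeriv ℝ j (fun x => G (s, x)) x‖ ^ 2) :
    I s f ≤ c * dSq j (fun x => G (s, x)) := by
  rw [dSq, ← integral_const_mul]
  have hc : Continuous (fun x : ℝ × ℝ => ‖iteratedFDeriv ℝ j (fun x => G (s, x)) x‖ ^ 2) :=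
    slice_c (iter_slice_cont hG j) s
  exact setIntegral_mono_on (cont_integrableOn (slice_cont f s))
    (cont_integrableOn (hc.const_mul c)) Ω_meas h

/-- iterated partial derivatives as values of the iterated derivative -/
theorem pdv_iter {f g : SF} {n : ℕ} {m : Fin n → E3}
    (h : ∀ z, g.1 z = iteratedFDeriv ℝ n f.1 z m) (v : E3) (z : E3) :
    (pdv v g).1 z = iteratedFDeriv ℝ (n + 1) f.1 z (Fin.cons v m) := by
  rw [iteratedFDeriv_succ_apply_left, pdv_apply]
  have e : g.1 = fun z => iteratedFDeriv ℝ n f.1 z m := funext h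
  have hn : (n : WithTop ℕ∞) < ((⊤ : ℕ∞) : WithTop ℕ∞) := by
    exact_mod_cast ENat.natCast_lt_top n
  have hd : DifferentiableAt ℝ (iteratedFDeriv ℝ n f.1) z :=
    (f.smooth.differentiable_iteratedFDeriv hn) z
  rw [e]
  have := ((ContinuousMultilinearMap.apply ℝ (fun _ : Fin n => E3) ℝ m).hasFDerivAt.comp z
    hd.hasFDerivAt).fderiv
  simp only [Function.comp_def, ContinuousMultilinearMap.apply_apply] at this
  rw [this]; simp

theorem iter_bd (f : SF) {n : ℕ} (m : Fin n → ℝ × ℝ) (hm : ∀ i, ‖m i‖ ≤ 1) (s : ℝ) (x : ℝ × ℝ) :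
    (iteratedFDeriv ℝ n f.1 (s, x) (fun i => (0, m i))) ^ 2
      ≤ ‖iteratedFDeriv ℝ n (fun x => f.1 (s, x)) x‖ ^ 2 := by
  have h1 : iteratedFDeriv ℝ n f.1 (s, x) (fun i => (0, m i))
      = iteratedFDeriv ℝ n (fun x => f.1 (s, x)) x m := by
    rw [iter_slice f.smooth]; simp
  rw [h1]
  have h2 := (iteratedFDeriv ℝ n (fun x => f.1 (s, x)) x).le_opNorm m
  have h3 : ∏ i, ‖m i‖ ≤ 1 := Finset.prod_le_one (fun i _ => norm_nonneg _) (fun i _ => hm i)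
  have h4 : |iteratedFDeriv ℝ n (fun x => f.1 (s, x)) x m|
      ≤ ‖iteratedFDeriv ℝ n (fun x => f.1 (s, x)) x‖ :=
    h2.trans (mul_le_of_le_one_right (norm_nonneg _) h3)
  rw [← sq_abs]
  gcongr

/-- `I` of a squared partial derivative is bounded by the corresponding Sobolev seminorm -/
theorem I_iter (f g : SF) {n : ℕ} (m : Fin n → ℝ × ℝ) (hm : ∀ i, ‖m i‖ ≤ 1)
    (h : ∀ z, g.1 z = iteratedFDeriv ℝ n f.1 z (fun i => (0, m i))) (s : ℝ) :
    I s (g ^ 2) ≤ dSq n (fun x => f.1 (s, x)) := by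
  have := I_le_dSq f.smooth n s 1 (g ^ 2) (fun x _ => by
    rw [map_pow, ev_apply, h, one_mul]
    exact iter_bd f m hm s x)
  linarith

theorem nrm10 : ‖((1, 0) : ℝ × ℝ)‖ ≤ 1 := by simp [Prod.norm_def]
theorem nrm01 : ‖((0, 1) : ℝ × ℝ)‖ ≤ 1 := by simp [Prod.norm_def]

theorem pdv_iter' {f g : SF} {n : ℕ} {m : Fin n → ℝ × ℝ}
    (h : ∀ z, g.1 z = iteratedFDeriv ℝ n f.1 z (fun i => (0, m i))) (v : ℝ × ℝ) (z : E3) :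
    (pdv (0, v) g).1 z
      = iteratedFDeriv ℝ (n + 1) f.1 z (fun i => (0, (Fin.cons v m : Fin (n+1) → ℝ × ℝ) i)) := by
  rw [pdv_iter h]
  congr 1
  funext i
  refine Fin.cases ?_ (fun i => ?_) i <;> simp

theorem it0 (f : SF) (z : E3) : f.1 z = iteratedFDeriv ℝ 0 f.1 z
    (fun i => (0, (Fin.elim0 : Fin 0 → ℝ × ℝ) i)) := by
  simp

/-- bounds for `I` of partial derivatives up to third order -/
theorem I_it0 (f : SF) (s : ℝ) : I s (f ^ 2) ≤ dSq 0 (fun x => f.1 (s, x)) :=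
  I_iter f f _ (fun i => i.elim0) (it0 f) s

theorem I_it1 (f : SF) (s : ℝ) {v : ℝ × ℝ} (hv : ‖v‖ ≤ 1) :
    I s ((pdv (0, v) f) ^ 2) ≤ dSq 1 (fun x => f.1 (s, x)) :=
  I_iter f _ _ (fun i => Fin.cases hv (fun i => i.elim0) i) (pdv_iter' (it0 f) v) s

theorem I_it2 (f : SF) (s : ℝ) {v w : ℝ × ℝ} (hv : ‖v‖ ≤ 1) (hw : ‖w‖ ≤ 1) :
    I s ((pdv (0, w) (pdv (0, v) f)) ^ 2) ≤ dSq 2 (fun x => f.1 (s, x)) :=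
  I_iter f _ _ (fun i => Fin.cases hw (fun i => Fin.cases hv (fun i => i.elim0) i) i)
    (pdv_iter' (pdv_iter' (it0 f) v) w) s

theorem I_it3 (f : SF) (s : ℝ) {u v w : ℝ × ℝ} (hu : ‖u‖ ≤ 1) (hv : ‖v‖ ≤ 1) (hw : ‖w‖ ≤ 1) :
    I s ((pdv (0, w) (pdv (0, v) (pdv (0, u) f))) ^ 2) ≤ dSq 3 (fun x => f.1 (s, x)) :=
  I_iter f _ _ (fun i => Fin.cases hw (fun i => Fin.cases hv
    (fun i => Fin.cases hu (fun i => i.elim0) i) i) i)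
    (pdv_iter' (pdv_iter' (pdv_iter' (it0 f) u) v) w) s

/-! ### Extraction of bounds from the energy functional -/

theorem sup_ge {f : ℝ → ℝ} (hf : Continuous f) (h0 : ∀ s, 0 ≤ f s) {T s : ℝ}
    (hs : s ∈ Set.Icc 0 T) : f s ≤ ⨆ s ∈ Set.Icc (0:ℝ) T, f s := by
  obtain ⟨M, hM⟩ := (isCompact_Icc.image hf : IsCompact (Set.image f (Set.Icc 0 T))).bddAbove
  have hb : BddAbove (Set.range fun s => ⨆ _ : s ∈ Set.Icc (0:ℝ) T, f s) := by
    refine ⟨max M 0, ?_⟩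
    rintro _ ⟨u, rfl⟩
    show (⨆ _ : u ∈ Set.Icc (0:ℝ) T, f u) ≤ _
    by_cases hu : u ∈ Set.Icc (0:ℝ) T
    · rw [ciSup_pos hu]
      exact le_max_of_le_left (hM ⟨u, hu, rfl⟩)
    · have : IsEmpty (u ∈ Set.Icc (0:ℝ) T) := ⟨hu⟩
      rw [Real.iSup_of_isEmpty]
      exact le_max_right _ _
  have := le_ciSup hb s
  simp only [ciSup_pos hs] at this
  exact this

theorem sup_nonneg {f : ℝ → ℝ} (h0 : ∀ s, 0 ≤ f s) (T : ℝ) :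
    0 ≤ ⨆ s ∈ Set.Icc (0:ℝ) T, f s :=
  Real.iSup_nonneg fun s => Real.iSup_nonneg fun _ => h0 s

theorem dt_smooth {V : Type*} [NormedAddCommGroup V] [NormedSpace ℝ V] {ψ : ℝ → ℝ × ℝ → V}
    (h : ContDiff ℝ (⊤ : ℕ∞) (Function.uncurry ψ)) :
    ContDiff ℝ (⊤ : ℕ∞) (Function.uncurry (dt ψ)) := by
  have e : Function.uncurry (dt ψ) = fun z => fderiv ℝ (Function.uncurry ψ) z (1, 0) := by
    funext z
    obtain ⟨s, x⟩ := z
    show deriv (fun s => ψ s x) s = _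
    have h1 : HasDerivAt (fun s : ℝ => ((s, x) : ℝ × ℝ × ℝ)) (1, 0) s :=
      (hasDerivAt_id s).prodMk (hasDerivAt_const s x)
    have hd : DifferentiableAt ℝ (Function.uncurry ψ) (s, x) :=
      h.differentiable (by simp) _
    exact (hd.hasFDerivAt.comp_hasDerivAt s h1).deriv
  rw [e]
  have h2 : ContDiff ℝ (⊤ : ℕ∞) (fderiv ℝ (Function.uncurry ψ)) := h.fderiv_right (by simp)
  exact h2.clm_apply contDiff_const

theorem dSq_c {V : Type*} [NormedAddCommGroup V] [NormedSpace ℝ V] {ψ : ℝ → ℝ × ℝ → V}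
    (h : ContDiff ℝ (⊤ : ℕ∞) (Function.uncurry ψ)) (j : ℕ) :
    Continuous (fun s => dSq j (ψ s)) := dSq_cont h j

theorem L2Sq_c {V : Type*} [NormedAddCommGroup V] [NormedSpace ℝ V] {ψ : ℝ → ℝ × ℝ → V}
    (h : ContDiff ℝ (⊤ : ℕ∞) (Function.uncurry ψ)) :
    Continuous (fun s => L2Sq (ψ s)) := dSq_cont h 0

section
variable {ε : ℝ} {φ θ : ℝ → ℝ × ℝ → ℝ} {ψ : ℝ → ℝ × ℝ → ℝ × ℝ} {T : ℝ}

theorem int_nn {f : ℝ → ℝ} (h0 : ∀ s, 0 ≤ f s) (hT : 0 ≤ T) : 0 ≤ ∫ s in (0:ℝ)..T, f s :=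
  intervalIntegral.integral_nonneg hT fun s _ => h0 s

theorem A0_ge (hφ : ContDiff ℝ (⊤ : ℕ∞) (Function.uncurry φ))
    (hψ : ContDiff ℝ (⊤ : ℕ∞) (Function.uncurry ψ))
    (hθ : ContDiff ℝ (⊤ : ℕ∞) (Function.uncurry θ)) {s : ℝ} (hs : s ∈ Set.Icc 0 T) :
    L2Sq (ψ s) + (ε ^ 2)⁻¹ * L2Sq (φ s) + (ε ^ 2)⁻¹ * L2Sq (θ s) ≤ A0 ε φ ψ θ T := by
  have h1 := L2Sq_c hφ
  have h2 := L2Sq_c hψ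
  have h3 := L2Sq_c hθ
  have hT : 0 ≤ T := hs.1.trans hs.2
  have := sup_ge (f := fun s => L2Sq (ψ s) + (ε ^ 2)⁻¹ * L2Sq (φ s) + (ε ^ 2)⁻¹ * L2Sq (θ s))
    (by fun_prop) (fun s => by
      have := L2Sq_nonneg (ψ s)
      have := L2Sq_nonneg (φ s)
      have := L2Sq_nonneg (θ s)
      positivity) hs
  have h4 : 0 ≤ ∫ s in (0:ℝ)..T, (HSq 1 (ψ s) + (ε ^ 2)⁻¹ * HSq 1 (θ s)) := int_nn (fun s => by
      have := HSq_nonneg 1 (ψ s)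
      have := HSq_nonneg 1 (θ s)
      positivity) hT
  unfold A0
  linarith

theorem A1_ge (hψ : ContDiff ℝ (⊤ : ℕ∞) (Function.uncurry ψ))
    (hθ : ContDiff ℝ (⊤ : ℕ∞) (Function.uncurry θ)) {s : ℝ} (hs : s ∈ Set.Icc 0 T) :
    dSq 1 (ψ s) + (ε ^ 2)⁻¹ * dSq 1 (θ s) ≤ A1 ε φ ψ θ T := by
  have h2 := dSq_c hψ 1
  have h3 := dSq_c hθ 1
  have hT : 0 ≤ T := hs.1.trans hs.2
  have := sup_ge (f := fun s => dSq 1 (ψ s) + (ε ^ 2)⁻¹ * dSq 1 (θ s))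
    (by fun_prop) (fun s => by
      have := dSq_nonneg 1 (ψ s)
      have := dSq_nonneg 1 (θ s)
      positivity) hs
  have h4 : 0 ≤ ∫ s in (0:ℝ)..T, (L2Sq (dt ψ s) + (ε ^ 2)⁻¹ * L2Sq (dt θ s)) :=
    int_nn (fun s => by
      have := L2Sq_nonneg (dt ψ s)
      have := L2Sq_nonneg (dt θ s)
      positivity) hT
  unfold A1
  linarith

theorem A2_ge (hφ : ContDiff ℝ (⊤ : ℕ∞) (Function.uncurry φ)) {s : ℝ} (hs : s ∈ Set.Icc 0 T) :
    (ε ^ 2)⁻¹ * dSq 1 (φ s) ≤ A2 ε φ ψ θ T := by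
  have h2 := dSq_c hφ 1
  have hT : 0 ≤ T := hs.1.trans hs.2
  have := sup_ge (f := fun s => dSq 1 (φ s)) h2 (fun s => dSq_nonneg 1 (φ s)) hs
  have h3 : (ε ^ 2)⁻¹ * dSq 1 (φ s) ≤ (ε ^ 2)⁻¹ * ⨆ s ∈ Set.Icc (0 : ℝ) T, dSq 1 (φ s) :=
    mul_le_mul_of_nonneg_left this (by positivity)
  have h4 : 0 ≤ ∫ s in (0:ℝ)..T, ((ε ^ 4)⁻¹ * HSq 1 (φ s) + (ε ^ 2)⁻¹ * L2Sq (dt φ s)) :=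
    int_nn (fun s => by
      have := L2Sq_nonneg (dt φ s)
      have := HSq_nonneg 1 (φ s)
      positivity) hT
  have h5 : 0 ≤ ∫ s in (0:ℝ)..T, (HSq 2 (ψ s) + (ε ^ 2)⁻¹ * HSq 2 (θ s)) :=
    int_nn (fun s => by
      have := HSq_nonneg 2 (ψ s)
      have := HSq_nonneg 2 (θ s)
      positivity) hT
  unfold A2
  linarith

theorem A3_nn (hT : 0 ≤ T) : 0 ≤ A3 ε φ ψ θ T := by
  have := sup_nonneg (f := fun s => (ε ^ 2)⁻¹ * L2Sq (dt φ s) + L2Sq (dt ψ s)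
      + (ε ^ 2)⁻¹ * L2Sq (dt θ s)) (fun s => by
      have := L2Sq_nonneg (dt ψ s)
      have := L2Sq_nonneg (dt φ s)
      have := L2Sq_nonneg (dt θ s)
      positivity) T
  have h4 : 0 ≤ ∫ s in (0:ℝ)..T, (dSq 1 (dt ψ s) + (ε ^ 2)⁻¹ * dSq 1 (dt θ s)) :=
    int_nn (fun s => by
      have := dSq_nonneg 1 (dt ψ s)
      have := dSq_nonneg 1 (dt θ s)
      positivity) hT
  unfold A3
  linarith

theorem A4_ge (hφ : ContDiff ℝ (⊤ : ℕ∞) (Function.uncurry φ))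
    (hψ : ContDiff ℝ (⊤ : ℕ∞) (Function.uncurry ψ))
    (hθ : ContDiff ℝ (⊤ : ℕ∞) (Function.uncurry θ)) {s : ℝ} (hs : s ∈ Set.Icc 0 T) :
    (ε ^ 2)⁻¹ * dSq 2 (φ s) + dSq 2 (ψ s) + (ε ^ 2)⁻¹ * dSq 2 (θ s) ≤ A4 ε φ ψ θ T := by
  have h1 := dSq_c hφ 2
  have h2 := dSq_c hψ 2
  have h3 := dSq_c hθ 2
  have hT : 0 ≤ T := hs.1.trans hs.2
  have := sup_ge (f := fun s => (ε ^ 2)⁻¹ * dSq 2 (φ s) + dSq 2 (ψ s) + (ε ^ 2)⁻¹ * dSq 2 (θ s))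
    (by fun_prop) (fun s => by
      have := dSq_nonneg 2 (ψ s)
      have := dSq_nonneg 2 (φ s)
      have := dSq_nonneg 2 (θ s)
      positivity) hs
  have h4 : 0 ≤ ∫ s in (0:ℝ)..T,
      ((ε ^ 4)⁻¹ * HSq 2 (φ s) + HSq 3 (ψ s) + (ε ^ 2)⁻¹ * HSq 3 (θ s)) := int_nn (fun s => by
      have := HSq_nonneg 3 (ψ s)
      have := HSq_nonneg 2 (φ s)
      have := HSq_nonneg 3 (θ s)
      positivity) hT
  unfold A4
  linarith

theorem A5_ge (hφ : ContDiff ℝ (⊤ : ℕ∞) (Function.uncurry φ))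
    (hψ : ContDiff ℝ (⊤ : ℕ∞) (Function.uncurry ψ))
    (hθ : ContDiff ℝ (⊤ : ℕ∞) (Function.uncurry θ)) {s : ℝ} (hs : s ∈ Set.Icc 0 T) :
    (ε ^ 2)⁻¹ * dSq 3 (φ s) + dSq 3 (ψ s) ≤ A5 ε φ ψ θ T := by
  have h1 := dSq_c hφ 3
  have h2 := dSq_c hψ 3
  have h3 := dSq_c hθ 3
  have h5 := dSq_c (dt_smooth hψ) 1
  have h6 := dSq_c (dt_smooth hθ) 1
  have hT : 0 ≤ T := hs.1.trans hs.2
  have := sup_ge (f := fun s => (ε ^ 2)⁻¹ * dSq 3 (φ s) + (dSq 3 (ψ s) + dSq 1 (dt ψ s))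
        + (ε ^ 2)⁻¹ * (dSq 3 (θ s) + dSq 1 (dt θ s)))
    (by fun_prop) (fun s => by
      have := dSq_nonneg 3 (ψ s)
      have := dSq_nonneg 3 (φ s)
      have := dSq_nonneg 3 (θ s)
      have := dSq_nonneg 1 (dt ψ s)
      have := dSq_nonneg 1 (dt θ s)
      positivity) hs
  have h4 : 0 ≤ ∫ s in (0:ℝ)..T,
      (L2Sq (dt (dt ψ) s) + (ε ^ 2)⁻¹ * L2Sq (dt (dt θ) s)) := int_nn (fun s => by
      have := L2Sq_nonneg (dt (dt ψ) s)
      have := L2Sq_nonneg (dt (dt θ) s)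
      positivity) hT
  have h7 : 0 ≤ dSq 1 (dt ψ s) + (ε ^ 2)⁻¹ * (dSq 3 (θ s) + dSq 1 (dt θ s)) := by
    have := dSq_nonneg 3 (θ s)
    have := dSq_nonneg 1 (dt ψ s)
    have := dSq_nonneg 1 (dt θ s)
    positivity
  unfold A5
  linarith

/-- The bounds provided by the smallness of the total energy functional. -/
theorem N_bounds {e : ℝ} (he : e = ε⁻¹) (hε : 0 < ε)
    (hφ : ContDiff ℝ (⊤ : ℕ∞) (Function.uncurry φ))
    (hψ : ContDiff ℝ (⊤ : ℕ∞) (Function.uncurry ψ))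
    (hθ : ContDiff ℝ (⊤ : ℕ∞) (Function.uncurry θ))
    (hN : Nfun ε φ ψ θ T ≤ 1) {s : ℝ} (hs : s ∈ Set.Icc 0 T) :
    (e ^ 2 * dSq 0 (ψ s) ≤ 1 ∧ dSq 1 (ψ s) ≤ 1 ∧ dSq 2 (ψ s) ≤ e ^ 2 ∧ dSq 3 (ψ s) ≤ e ^ 4) ∧
    (e ^ 4 * dSq 0 (φ s) ≤ 1 ∧ e ^ 2 * dSq 1 (φ s) ≤ 1 ∧ dSq 2 (φ s) ≤ 1 ∧
      dSq 3 (φ s) ≤ e ^ 2) ∧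
    (e ^ 4 * dSq 0 (θ s) ≤ 1 ∧ e ^ 2 * dSq 1 (θ s) ≤ 1 ∧ dSq 2 (θ s) ≤ 1) := by
  have hT : 0 ≤ T := hs.1.trans hs.2
  have e0 : 0 < e := by rw [he]; positivity
  have ee : (ε ^ 2)⁻¹ = e ^ 2 := by rw [he]; field_simp
  have ee2 : ε ^ 2 = (e ^ 2)⁻¹ := by rw [← ee, inv_inv]
  have ee4 : ε ^ 4 = (e ^ 4)⁻¹ := by rw [he]; field_simp
  have a0 := A0_ge (ε := ε) hφ hψ hθ hs
  have a1 := A1_ge (ε := ε) (φ := φ) hψ hθ hs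
  have a2 := A2_ge (ε := ε) (ψ := ψ) (θ := θ) hφ hs
  have a3 := A3_nn (ε := ε) (φ := φ) (ψ := ψ) (θ := θ) hT
  have a4 := A4_ge (ε := ε) hφ hψ hθ hs
  have a5 := A5_ge (ε := ε) hφ hψ hθ hs
  unfold Nfun at hN
  rw [ee] at a0 a1 a2 a4 a5 hN
  rw [ee2, ee4] at hN
  have p0 := dSq_nonneg 0 (ψ s)
  have p1 := dSq_nonneg 1 (ψ s)
  have p2 := dSq_nonneg 2 (ψ s)
  have p3 := dSq_nonneg 3 (ψ s)
  have q0 := dSq_nonneg 0 (φ s)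
  have q1 := dSq_nonneg 1 (φ s)
  have q2 := dSq_nonneg 2 (φ s)
  have q3 := dSq_nonneg 3 (φ s)
  have r0 := dSq_nonneg 0 (θ s)
  have r1 := dSq_nonneg 1 (θ s)
  have r2 := dSq_nonneg 2 (θ s)
  unfold L2Sq at a0
  have E2 : 0 < e ^ 2 := by positivity
  have E4 : 0 < e ^ 4 := by positivity
  have i2 : 0 < (e ^ 2)⁻¹ := by positivity
  have i4 : 0 < (e ^ 4)⁻¹ := by positivity
  have b0 := mul_le_mul_of_nonneg_left a0 E2.le
  have b4 := mul_le_mul_of_nonneg_left a4 i2.le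
  have b5 := mul_le_mul_of_nonneg_left a5 i4.le
  have b3 := mul_nonneg i2.le a3
  have s0 : 0 ≤ e ^ 2 * (dSq 0 (ψ s) + e ^ 2 * dSq 0 (φ s) + e ^ 2 * dSq 0 (θ s)) := by positivity
  have s1 : 0 ≤ dSq 1 (ψ s) + e ^ 2 * dSq 1 (θ s) := by positivity
  have s2 : 0 ≤ e ^ 2 * dSq 1 (φ s) := by positivity
  have s4 : 0 ≤ (e ^ 2)⁻¹ * (e ^ 2 * dSq 2 (φ s) + dSq 2 (ψ s) + e ^ 2 * dSq 2 (θ s)) := by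
    positivity
  have s5 : 0 ≤ (e ^ 4)⁻¹ * (e ^ 2 * dSq 3 (φ s) + dSq 3 (ψ s)) := by positivity
  have c0 : e ^ 2 * (dSq 0 (ψ s) + e ^ 2 * dSq 0 (φ s) + e ^ 2 * dSq 0 (θ s)) ≤ 1 := by linarith
  have c1 : dSq 1 (ψ s) + e ^ 2 * dSq 1 (θ s) ≤ 1 := by linarith
  have c2 : e ^ 2 * dSq 1 (φ s) ≤ 1 := by linarith
  have c4 : (e ^ 2)⁻¹ * (e ^ 2 * dSq 2 (φ s) + dSq 2 (ψ s) + e ^ 2 * dSq 2 (θ s)) ≤ 1 := by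
    linarith
  have c5 : (e ^ 4)⁻¹ * (e ^ 2 * dSq 3 (φ s) + dSq 3 (ψ s)) ≤ 1 := by linarith
  rw [inv_mul_le_iff₀ E2] at c4
  rw [inv_mul_le_iff₀ E4] at c5
  have f1 : 0 ≤ e ^ 2 * dSq 2 (φ s) := by positivity
  have f2 : 0 ≤ e ^ 2 * dSq 2 (θ s) := by positivity
  have f3 : 0 ≤ e ^ 2 * dSq 3 (φ s) := by positivity
  have f4 : 0 ≤ e ^ 2 * dSq 1 (θ s) := by positivity
  have f5 : 0 ≤ e ^ 4 * dSq 0 (φ s) := by positivity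
  have f6 : 0 ≤ e ^ 4 * dSq 0 (θ s) := by positivity
  have f7 : 0 ≤ e ^ 2 * dSq 0 (ψ s) := by positivity
  have c0' : e ^ 2 * dSq 0 (ψ s) + e ^ 4 * dSq 0 (φ s) + e ^ 4 * dSq 0 (θ s) ≤ 1 := by
    calc _ = e ^ 2 * (dSq 0 (ψ s) + e ^ 2 * dSq 0 (φ s) + e ^ 2 * dSq 0 (θ s)) := by ring
      _ ≤ 1 := c0
  refine ⟨⟨by linarith, by linarith, by linarith, by linarith⟩,
    ⟨by linarith, by linarith, ?_, ?_⟩, ⟨by linarith, by linarith, ?_⟩⟩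
  · have : e ^ 2 * dSq 2 (φ s) ≤ e ^ 2 * 1 := by linarith
    exact le_of_mul_le_mul_left this E2
  · have : e ^ 2 * dSq 3 (φ s) ≤ e ^ 2 * e ^ 2 := by
      have : e ^ 4 = e ^ 2 * e ^ 2 := by ring
      linarith
    exact le_of_mul_le_mul_left this E2
  · have : e ^ 2 * dSq 2 (θ s) ≤ e ^ 2 * 1 := by linarith
    exact le_of_mul_le_mul_left this E2
end

/-- Pointwise bound. -/
theorem sup_bd (f : SF) (s : ℝ) {e B : ℝ} (he : 1 ≤ e) (h0 : e ^ 2 * I s (f ^ 2) ≤ B)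
    (h1 : I s ((dX f) ^ 2) ≤ B) (h2 : I s ((dY f) ^ 2) ≤ B)
    (h3 : I s ((dX (dY f)) ^ 2) ≤ e ^ 2 * B) {x : ℝ × ℝ} (hx : x ∈ Ω) :
    (ev (s, x) f) ^ 2 ≤ 9 * B := by
  have hE : 0 < e ^ 2 := by positivity
  have h := sup_sq f s hE hx
  have g0 : (3 + e ^ 2) * I s (f ^ 2) ≤ 4 * B := by
    have : 0 ≤ I s (f ^ 2) := I_sq_nonneg s f
    have e2 : 1 ≤ e ^ 2 := one_le_pow₀ he
    nlinarith
  have g3 : (e ^ 2)⁻¹ * I s ((dX (dY f)) ^ 2) ≤ B := by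
    rw [inv_mul_le_iff₀ hE]; exact h3
  linarith

theorem dSq_comp {V W : Type*} [NormedAddCommGroup V] [NormedSpace ℝ V] [NormedAddCommGroup W]
    [NormedSpace ℝ W] {G : E3 → V} (hG : ContDiff ℝ (⊤ : ℕ∞) G) (L : V →L[ℝ] W) (hL : ‖L‖ ≤ 1)
    (j : ℕ) (s : ℝ) :
    dSq j (fun x => L (G (s, x))) ≤ dSq j (fun x => G (s, x)) := by
  have hLG : ContDiff ℝ (⊤ : ℕ∞) (fun z => L (G z)) := L.contDiff.comp hG
  have hc1 : Continuous (fun x : ℝ × ℝ => ‖iteratedFDeriv ℝ j (fun x => G (s, x)) x‖ ^ 2) :=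
    slice_c (iter_slice_cont hG j) s
  have hc2 : Continuous (fun x : ℝ × ℝ => ‖iteratedFDeriv ℝ j (fun x => L (G (s, x))) x‖ ^ 2) :=
    slice_c (iter_slice_cont hLG j) s
  refine setIntegral_mono_on (cont_integrableOn hc2) (cont_integrableOn hc1) Ω_meas ?_
  intro x _
  have hGs : ContDiff ℝ (⊤ : ℕ∞) (fun x : ℝ × ℝ => G (s, x)) :=
    hG.comp (contDiff_const.prodMk contDiff_id)
  have hj : (j : WithTop ℕ∞) ≤ ((⊤ : ℕ∞) : WithTop ℕ∞) := by exact_mod_cast le_top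
  have h := L.norm_iteratedFDeriv_comp_left (f := fun x : ℝ × ℝ => G (s, x)) (x := x)
    hGs.contDiffAt hj
  have h' : ‖iteratedFDeriv ℝ j (fun x => L (G (s, x))) x‖
      ≤ ‖iteratedFDeriv ℝ j (fun x => G (s, x)) x‖ :=
    h.trans (mul_le_of_le_one_left (norm_nonneg _) hL)
  gcongr

/-! ### The background profiles -/

theorem ev_pdv_zero' {f : SF} (v : E3) (h : ∀ s, ∀ x ∈ Ω, ev (s, x) f = 0)
    (s : ℝ) {x : ℝ × ℝ} (hx : x ∈ Ω) : ev (s, x) (pdv v f) = 0 := by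
  show fderiv ℝ f.1 (s, x) v = 0
  have : f.1 =ᶠ[𝓝 (s, x)] fun _ => 0 := by
    have hU : (Set.univ) ×ˢ Ω ∈ 𝓝 (s, x) :=
      (isOpen_univ.prod Ω_open).mem_nhds ⟨Set.mem_univ _, hx⟩
    filter_upwards [hU] with z hz
    exact h z.1 z.2 hz.2
  rw [this.fderiv_eq]; simp

/-- A globally smooth function equal to `u⁻¹` for `u ≥ 1/2`. -/
def sinv (u : ℝ) : ℝ := Real.smoothTransition (4 * u - 1) * u⁻¹

theorem sinv_eq {u : ℝ} (hu : 1 / 2 ≤ u) : sinv u = u⁻¹ := by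
  rw [sinv, Real.smoothTransition.one_of_one_le (by linarith), one_mul]

theorem sinv_smooth : ContDiff ℝ (⊤ : ℕ∞) sinv := by
  rw [contDiff_iff_contDiffAt]
  intro u
  by_cases hu : u = 0
  · subst hu
    have : sinv =ᶠ[𝓝 0] fun _ => 0 := by
      filter_upwards [Iio_mem_nhds (show (0:ℝ) < 1 / 4 by norm_num)] with v hv
      have hv' : v < 1 / 4 := hv
      rw [sinv, Real.smoothTransition.zero_of_nonpos (by linarith), zero_mul]
    exact contDiffAt_const.congr_of_eventuallyEq this
  · have h1 : ContDiff ℝ (⊤ : ℕ∞) (fun u : ℝ => Real.smoothTransition (4 * u - 1)) :=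
      Real.smoothTransition.contDiff.comp (by fun_prop)
    exact h1.contDiffAt.mul (contDiffAt_inv ℝ hu)

/-- The temperature profile. -/
def τf (χ k : ℝ) : SF := algebraMap ℝ SF χ + (1 - χ) • Yc - k • (Yc * Yc - Yc)

theorem ev_alg (z : E3) (c : ℝ) : ev z (algebraMap ℝ SF c) = c := by
  rw [AlgHom.commutes]; rfl

theorem ev_τf (χ k : ℝ) (z : E3) :
    ev z (τf χ k) = χ + (1 - χ) * z.2.2 - k * (z.2.2 ^ 2 - z.2.2) := by
  simp only [τf, map_add, map_sub, map_smul, map_mul, smul_eq_mul, ev_Yc, ev_alg]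
  ring

/-- The density profile. -/
def σf (χ k : ℝ) : SF := ⟨fun z => sinv ((τf χ k).1 z), sinv_smooth.comp (τf χ k).smooth⟩

theorem ev_σf (χ k : ℝ) (z : E3) : ev z (σf χ k) = sinv (ev z (τf χ k)) := rfl

theorem dT_alg (c : ℝ) : dT (algebraMap ℝ SF c) = 0 := Derivation.map_algebraMap _ _
theorem dX_alg (c : ℝ) : dX (algebraMap ℝ SF c) = 0 := Derivation.map_algebraMap _ _
theorem dY_alg (c : ℝ) : dY (algebraMap ℝ SF c) = 0 := Derivation.map_algebraMap _ _

theorem dT_τf (χ k : ℝ) : dT (τf χ k) = 0 := by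
  simp [τf, dT_Yc, Derivation.leibniz]
theorem dX_τf (χ k : ℝ) : dX (τf χ k) = 0 := by
  simp [τf, dX_Yc, Derivation.leibniz]
theorem dY_τf (χ k : ℝ) : dY (τf χ k) = algebraMap ℝ SF (1 - χ) - k • (Yc + Yc - 1) := by
  have h1 : dY (1 : SF) = 0 := by simp
  simp only [τf, dY_Yc, Derivation.leibniz, map_add, map_sub, Derivation.map_smul,
    smul_eq_mul, mul_one, Algebra.algebraMap_eq_smul_one, h1]
  module
theorem dYY_τf (χ k : ℝ) : dY (dY (τf χ k)) = algebraMap ℝ SF (-2 * k) := by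
  rw [dY_τf]
  have h1 : dY (1 : SF) = 0 := by simp
  simp only [dY_Yc, map_add, map_sub, Derivation.map_smul, h1,
    Algebra.algebraMap_eq_smul_one]
  module

theorem pdv_σf (χ k : ℝ) (v : E3) (h : pdv v (τf χ k) = 0) : pdv v (σf χ k) = 0 := by
  apply Subtype.ext
  funext z
  show fderiv ℝ (sinv ∘ (τf χ k).1) z v = 0
  have h1 : DifferentiableAt ℝ sinv ((τf χ k).1 z) := sinv_smooth.differentiable (by simp) _
  rw [fderiv_comp z h1 ((τf χ k).diff z)]
  have h2 : fderiv ℝ (τf χ k).1 z v = 0 := congrFun (congrArg Subtype.val h) z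
  simp [h2]

structure Prof (ε B : ℝ) (τ σ : SF) : Prop where
  dTσ : dT σ = 0
  dXσ : dX σ = 0
  dTτ : dT τ = 0
  dXτ : dX τ = 0
  στ : ∀ s, ∀ x ∈ Ω, ev (s, x) σ * ev (s, x) τ = 1
  τl : ∀ s, ∀ x ∈ Ω, 1 / 2 ≤ ev (s, x) τ
  στ1 : ∀ s, ∀ x ∈ Ω, ev (s, x) (dY σ) * ev (s, x) τ + ev (s, x) σ * ev (s, x) (dY τ) = 0
  bdτ : ∀ s, ∀ x ∈ Ω, |ev (s, x) τ - 1| ≤ B * ε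
  bdσ : ∀ s, ∀ x ∈ Ω, |ev (s, x) σ - 1| ≤ 16 * (B + 1) ^ 2 * ε
  bdτ2 : ∀ s, ∀ x ∈ Ω, |ev (s, x) (dY τ)| ≤ B * ε
  bdσ2 : ∀ s, ∀ x ∈ Ω, |ev (s, x) (dY σ)| ≤ 16 * (B + 1) ^ 2 * ε
  bdσ22 : ∀ s, ∀ x ∈ Ω, |ev (s, x) (dY (dY σ))| ≤ 16 * (B + 1) ^ 2 * ε

theorem prof_real {B ε τ σ τ1 σ1 τ2 σ2 : ℝ} (hB : 0 < B) (hε : 0 < ε) (hε1 : ε ≤ 1)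
    (hτ : 1 / 2 ≤ τ) (h1 : σ * τ = 1) (h2 : σ1 * τ + σ * τ1 = 0)
    (h3 : σ2 * τ + 2 * (σ1 * τ1) + σ * τ2 = 0) (b0 : |τ - 1| ≤ B * ε) (b1 : |τ1| ≤ B * ε)
    (b2 : |τ2| ≤ B * ε) :
    |σ - 1| ≤ 16 * (B + 1) ^ 2 * ε ∧ |σ1| ≤ 16 * (B + 1) ^ 2 * ε ∧
      |σ2| ≤ 16 * (B + 1) ^ 2 * ε := by
  have hτ0 : 0 < τ := by linarith
  have hσ0 : 0 < σ := by
    by_contra h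
    push Not at h
    nlinarith
  have hσ2 : σ ≤ 2 := by nlinarith
  have hBe : 0 < B * ε := by positivity
  have e0 : σ - 1 = -(σ * (τ - 1)) := by linear_combination h1
  have e1 : σ1 = -(σ * (σ * τ1)) := by linear_combination σ * h2 - σ1 * h1
  have e2 : σ2 = -(σ * (2 * (σ1 * τ1) + σ * τ2)) := by linear_combination σ * h3 - σ2 * h1
  have a0 : |σ - 1| ≤ 2 * (B * ε) := by
    rw [e0, abs_neg, abs_mul, abs_of_pos hσ0]
    exact mul_le_mul hσ2 b0 (abs_nonneg _) (by norm_num)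
  have a1 : |σ1| ≤ 4 * (B * ε) := by
    rw [e1, abs_neg, abs_mul, abs_mul, abs_of_pos hσ0]
    have : σ * |τ1| ≤ 2 * (B * ε) := mul_le_mul hσ2 b1 (abs_nonneg _) (by norm_num)
    have := mul_le_mul hσ2 this (by positivity) (by norm_num)
    linarith
  have a2 : |σ2| ≤ 2 * (2 * (4 * (B * ε) * (B * ε)) + 2 * (B * ε)) := by
    rw [e2, abs_neg, abs_mul, abs_of_pos hσ0]
    have g1 : |σ * τ2| ≤ 2 * (B * ε) := by
      rw [abs_mul, abs_of_pos hσ0]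
      exact mul_le_mul hσ2 b2 (abs_nonneg _) (by norm_num)
    have g2 : |σ1 * τ1| ≤ 4 * (B * ε) * (B * ε) := by
      rw [abs_mul]
      exact mul_le_mul a1 b1 (abs_nonneg _) (by positivity)
    have g3 : |2 * (σ1 * τ1) + σ * τ2| ≤ 2 * (4 * (B * ε) * (B * ε)) + 2 * (B * ε) := by
      refine (abs_add_le _ _).trans ?_
      rw [abs_mul, abs_of_pos (by norm_num : (0:ℝ) < 2)]
      linarith
    exact mul_le_mul hσ2 g3 (abs_nonneg _) (by norm_num)
  have k1 : 16 * (B + 1) ^ 2 * ε = 16 * (B ^ 2 * ε) + 32 * (B * ε) + 16 * ε := by ring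
  have k2 : 0 < B ^ 2 * ε := by positivity
  have k3 : B * ε * (B * ε) ≤ B ^ 2 * ε := by nlinarith
  refine ⟨by linarith, by linarith, by nlinarith⟩

theorem prof {χ k ε B Kχ c : ℝ} (hε : 0 < ε) (hε1 : ε ≤ 1) (hK : 0 < Kχ) (hχ : |1 - χ| ≤ Kχ * ε)
    (hχ2 : |1 - χ| ≤ 1 / 2) (hk0 : 0 ≤ k) (hk : 2 * k ≤ c * ε) (hc : 0 < c) (hB : B = Kχ + c) :
    Prof ε B (τf χ k) (σf χ k) := by
  have hB0 : 0 < B := by linarith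
  have X := abs_le.1 hχ
  have X2 := abs_le.1 hχ2
  have hBe : B * ε = Kχ * ε + c * ε := by rw [hB]; ring
  have ke : 0 < Kχ * ε := by positivity
  have ce : 0 < c * ε := by positivity
  have y0 : ∀ x : ℝ × ℝ, x ∈ Ω → 0 < x.2 ∧ x.2 < 1 := fun x hx => hx.2
  have τl : ∀ s, ∀ x ∈ Ω, 1 / 2 ≤ ev (s, x) (τf χ k) := by
    intro s x hx
    obtain ⟨h1, h2⟩ := y0 x hx
    rw [ev_τf]
    show 1 / 2 ≤ χ + (1 - χ) * x.2 - k * (x.2 ^ 2 - x.2)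
    have : 0 ≤ k * (x.2 * (1 - x.2)) := by
      apply mul_nonneg hk0 (mul_nonneg h1.le (by linarith))
    nlinarith
  have στ : ∀ s, ∀ x ∈ Ω, ev (s, x) (σf χ k) * ev (s, x) (τf χ k) = 1 := by
    intro s x hx
    have := τl s x hx
    rw [ev_σf, sinv_eq this, inv_mul_cancel₀ (by linarith)]
  have z0 : ∀ s, ∀ x ∈ Ω, ev (s, x) (σf χ k * τf χ k - 1) = 0 := by
    intro s x hx
    rw [map_sub, map_mul, map_one, στ s x hx, sub_self]
  have z1 : ∀ s, ∀ x ∈ Ω, ev (s, x) (dY (σf χ k * τf χ k - 1)) = 0 :=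
    fun s x hx => ev_pdv_zero' _ z0 s hx
  have z2 : ∀ s, ∀ x ∈ Ω, ev (s, x) (dY (dY (σf χ k * τf χ k - 1))) = 0 :=
    fun s x hx => ev_pdv_zero' _ z1 s hx
  have στ1 : ∀ s, ∀ x ∈ Ω, ev (s, x) (dY (σf χ k)) * ev (s, x) (τf χ k)
      + ev (s, x) (σf χ k) * ev (s, x) (dY (τf χ k)) = 0 := by
    intro s x hx
    have := z1 s x hx
    simp only [map_sub, map_add, Derivation.leibniz, smul_eq_mul, map_mul,
      Derivation.map_one_eq_zero, map_zero] at this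
    linarith
  have στ2 : ∀ s, ∀ x ∈ Ω, ev (s, x) (dY (dY (σf χ k))) * ev (s, x) (τf χ k)
      + 2 * (ev (s, x) (dY (σf χ k)) * ev (s, x) (dY (τf χ k)))
      + ev (s, x) (σf χ k) * ev (s, x) (dY (dY (τf χ k))) = 0 := by
    intro s x hx
    have := z2 s x hx
    simp only [map_sub, map_add, Derivation.leibniz, smul_eq_mul, map_mul,
      Derivation.map_one_eq_zero, map_zero] at this
    linarith
  have bdτ : ∀ s, ∀ x ∈ Ω, |ev (s, x) (τf χ k) - 1| ≤ B * ε := by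
    intro s x hx
    obtain ⟨h1, h2⟩ := y0 x hx
    rw [ev_τf, hBe]
    show |χ + (1 - χ) * x.2 - k * (x.2 ^ 2 - x.2) - 1| ≤ _
    have e : χ + (1 - χ) * x.2 - k * (x.2 ^ 2 - x.2) - 1
        = -((1 - χ) * (1 - x.2)) + k * (x.2 * (1 - x.2)) := by ring
    rw [e]
    refine (abs_add_le _ _).trans (add_le_add ?_ ?_)
    · rw [abs_neg, abs_mul, abs_of_pos (by linarith : 0 < 1 - x.2)]
      have := abs_nonneg (1 - χ)
      nlinarith
    · rw [abs_of_nonneg (mul_nonneg hk0 (mul_nonneg h1.le (by linarith)))]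
      have : x.2 * (1 - x.2) ≤ 1 := by nlinarith
      nlinarith
  have bdτ2 : ∀ s, ∀ x ∈ Ω, |ev (s, x) (dY (τf χ k))| ≤ B * ε := by
    intro s x hx
    obtain ⟨h1, h2⟩ := y0 x hx
    rw [dY_τf, hBe]
    simp only [map_sub, map_add, map_smul, smul_eq_mul, map_one, ev_alg, ev_Yc]
    show |1 - χ - k * (x.2 + x.2 - 1)| ≤ _
    refine (abs_sub _ _).trans (add_le_add hχ ?_)
    rw [abs_mul, abs_of_nonneg hk0]
    have : |x.2 + x.2 - 1| ≤ 1 := abs_le.2 ⟨by linarith, by linarith⟩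
    nlinarith
  have bdτ3 : ∀ s, ∀ x ∈ Ω, |ev (s, x) (dY (dY (τf χ k)))| ≤ B * ε := by
    intro s x hx
    rw [dYY_τf, ev_alg, hBe, abs_mul, abs_of_nonneg hk0]
    norm_num
    linarith
  have main := fun s x (hx : x ∈ Ω) => prof_real hB0 hε hε1 (τl s x hx) (στ s x hx)
    (στ1 s x hx) (στ2 s x hx) (bdτ s x hx) (bdτ2 s x hx) (bdτ3 s x hx)
  exact ⟨pdv_σf χ k _ (dT_τf χ k), pdv_σf χ k _ (dX_τf χ k), dT_τf χ k, dX_τf χ k, στ, τl, στ1, bdτ,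
    fun s x hx => (main s x hx).1, bdτ2, fun s x hx => (main s x hx).2.1,
    fun s x hx => (main s x hx).2.2⟩

/-! ### Translation of the perturbation system -/

theorem d1_sl (f : SF) (t : ℝ) (x : ℝ × ℝ) : d1 (fun x => f.1 (t, x)) x = ev (t, x) (dX f) := by
  have h1 : HasFDerivAt (fun x : ℝ × ℝ => ((t, x) : E3)) (ContinuousLinearMap.inr ℝ ℝ (ℝ × ℝ)) x :=
    hasFDerivAt_prodMk_right t x
  have h2 := (f.diff (t, x)).hasFDerivAt.comp x h1
  rw [d1]
  have h3 : fderiv ℝ (fun x : ℝ × ℝ => f.1 (t, x)) x = _ := h2.fderiv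
  rw [h3]; rfl

theorem d2_sl (f : SF) (t : ℝ) (x : ℝ × ℝ) : d2 (fun x => f.1 (t, x)) x = ev (t, x) (dY f) := by
  have h1 : HasFDerivAt (fun x : ℝ × ℝ => ((t, x) : E3)) (ContinuousLinearMap.inr ℝ ℝ (ℝ × ℝ)) x :=
    hasFDerivAt_prodMk_right t x
  have h2 := (f.diff (t, x)).hasFDerivAt.comp x h1
  rw [d2]
  have h3 : fderiv ℝ (fun x : ℝ × ℝ => f.1 (t, x)) x = _ := h2.fderiv
  rw [h3]; rfl

theorem d1_of {g : ℝ × ℝ → ℝ} {f : SF} {t : ℝ} (h : ∀ x, g x = f.1 (t, x)) (x : ℝ × ℝ) :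
    d1 g x = ev (t, x) (dX f) := by
  rw [← d1_sl]; congr 1; exact funext h

theorem d2_of {g : ℝ × ℝ → ℝ} {f : SF} {t : ℝ} (h : ∀ x, g x = f.1 (t, x)) (x : ℝ × ℝ) :
    d2 g x = ev (t, x) (dY f) := by
  rw [← d2_sl]; congr 1; exact funext h

theorem d1_ofΩ {g : ℝ × ℝ → ℝ} {f : SF} {t : ℝ} (h : ∀ x ∈ Ω, g x = f.1 (t, x)) {x : ℝ × ℝ}
    (hx : x ∈ Ω) : d1 g x = ev (t, x) (dX f) := by
  have e : g =ᶠ[𝓝 x] fun x => f.1 (t, x) := by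
    filter_upwards [Ω_open.mem_nhds hx] with y hy using h y hy
  rw [← d1_sl, d1, d1, e.fderiv_eq]

theorem d2_ofΩ {g : ℝ × ℝ → ℝ} {f : SF} {t : ℝ} (h : ∀ x ∈ Ω, g x = f.1 (t, x)) {x : ℝ × ℝ}
    (hx : x ∈ Ω) : d2 g x = ev (t, x) (dY f) := by
  have e : g =ᶠ[𝓝 x] fun x => f.1 (t, x) := by
    filter_upwards [Ω_open.mem_nhds hx] with y hy using h y hy
  rw [← d2_sl, d2, d2, e.fderiv_eq]

theorem dt_of {g : ℝ → ℝ × ℝ → ℝ} {f : SF} (h : ∀ t x, g t x = f.1 (t, x)) (t : ℝ) (x : ℝ × ℝ) :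
    dt g t x = ev (t, x) (dT f) := by
  have := (hasDerivAt_T f t x.1 x.2).deriv
  rw [dt]
  have e : (fun s => g s x) = fun s => f.1 (s, x.1, x.2) := funext fun s => h s x
  rw [e, this]; rfl

theorem dt_of2 {g : ℝ → ℝ × ℝ → ℝ × ℝ} {f f' : SF} (h : ∀ t x, (g t x).1 = f.1 (t, x))
    (h' : ∀ t x, (g t x).2 = f'.1 (t, x)) (t : ℝ) (x : ℝ × ℝ) :
    dt g t x = (ev (t, x) (dT f), ev (t, x) (dT f')) := by
  have := ((hasDerivAt_T f t x.1 x.2).prodMk (hasDerivAt_T f' t x.1 x.2)).deriv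
  rw [dt]
  have e : (fun s => g s x) = fun s => (f.1 (s, x.1, x.2), f'.1 (s, x.1, x.2)) :=
    funext fun s => Prod.ext (h s x) (h' s x)
  rw [e, this]; rfl

section
variable {γ Pr r Re ε χ T : ℝ}

/-- The abstract fields associated with a solution. -/
def toFld (S : PerturbSol γ Pr r Re ε χ T) (h : SmoothSol S) (k : ℝ) : Fld where
  φ := ⟨Function.uncurry S.φ, h.1⟩
  p := ⟨fun z => (Function.uncurry S.ψ z).1, contDiff_fst.comp h.2.1⟩
  q := ⟨fun z => (Function.uncurry S.ψ z).2, contDiff_snd.comp h.2.1⟩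
  θ := ⟨Function.uncurry S.θ, h.2.2⟩
  τ := τf χ k
  σ := σf χ k

/-- The abstract parameters. -/
def toPar (γ Pr r Re ε T K : ℝ) : Par :=
  ⟨Re⁻¹, Re⁻¹ + r * Re⁻¹, r, γ / (γ - 1) / (Re * Pr), 1 / (γ - 1), ε⁻¹, K, T⟩

set_option linter.unusedSimpArgs false in
theorem trans_eqs (S : PerturbSol γ Pr r Re ε χ T) (h : SmoothSol S) (hε : 0 < ε) {k B K : ℝ}
    (hk : k = ε ^ 2 * Pr / (2 * (γ / (γ - 1))))
    (hp : Prof ε B (τf χ k) (σf χ k)) {s : ℝ} (hs : s ∈ Set.Icc 0 T) {x : ℝ × ℝ} (hx : x ∈ Ω) :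
    (ev (s, x) (toFld S h k).mass = 0) ∧
    (ev (s, x)
    (((toFld S h k).σ + (toFld S h k).φ) * (dT (toFld S h k).p
        + (Yc + (toFld S h k).p) * dX (toFld S h k).p + (toFld S h k).q * dY (toFld S h k).p
        + (toFld S h k).q)
      + ((toPar γ Pr r Re ε T K).e ^ 2) • (((toFld S h k).τ + (toFld S h k).θ) * dX (toFld S h k).φ
        + ((toFld S h k).σ + (toFld S h k).φ) * dX (toFld S h k).θ)
      - (toPar γ Pr r Re ε T K).μ • (dX (dX (toFld S h k).p) + dY (dY (toFld S h k).p))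
      - (toPar γ Pr r Re ε T K).lam • (dX (dX (toFld S h k).p) + dX (dY (toFld S h k).q))) = 0) ∧
    (ev (s, x)
    (((toFld S h k).σ + (toFld S h k).φ) * (dT (toFld S h k).q
        + (Yc + (toFld S h k).p) * dX (toFld S h k).q + (toFld S h k).q * dY (toFld S h k).q)
      + ((toPar γ Pr r Re ε T K).e ^ 2) • (((toFld S h k).τ + (toFld S h k).θ) * dY (toFld S h k).φ
        + ((toFld S h k).σ + (toFld S h k).φ) * dY (toFld S h k).θ
        + dY (toFld S h k).σ * (toFld S h k).θ + (toFld S h k).φ * dY (toFld S h k).τ)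
      - (toPar γ Pr r Re ε T K).μ • (dX (dX (toFld S h k).q) + dY (dY (toFld S h k).q))
      - (toPar γ Pr r Re ε T K).lam • (dX (dY (toFld S h k).p) + dY (dY (toFld S h k).q))) = 0) ∧
    (ev (s, x)
    (((toPar γ Pr r Re ε T K).e ^ 2 * (toPar γ Pr r Re ε T K).g) •
        (((toFld S h k).σ + (toFld S h k).φ) * (dT (toFld S h k).θ
        + (Yc + (toFld S h k).p) * dX (toFld S h k).θ + (toFld S h k).q * dY (toFld S h k).θ
        + (toFld S h k).q * dY (toFld S h k).τ))
      + ((toPar γ Pr r Re ε T K).e ^ 2) • (((toFld S h k).σ + (toFld S h k).φ) *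
        ((toFld S h k).τ + (toFld S h k).θ) * (dX (toFld S h k).p + dY (toFld S h k).q))
      - ((toPar γ Pr r Re ε T K).κ * (toPar γ Pr r Re ε T K).e ^ 2) •
        (dX (dX (toFld S h k).θ) + dY (dY (toFld S h k).θ))
      - (toFld S h k).Q (toPar γ Pr r Re ε T K)) = 0) := by
  obtain ⟨φ, hφ⟩ : ∃ φ : SF, φ = (toFld S h k).φ := ⟨_, rfl⟩
  obtain ⟨p, hpp⟩ : ∃ p : SF, p = (toFld S h k).p := ⟨_, rfl⟩
  obtain ⟨q, hq⟩ : ∃ q : SF, q = (toFld S h k).q := ⟨_, rfl⟩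
  obtain ⟨θ, hθ⟩ : ∃ θ : SF, θ = (toFld S h k).θ := ⟨_, rfl⟩
  obtain ⟨τ, hτ⟩ : ∃ τ : SF, τ = (toFld S h k).τ := ⟨_, rfl⟩
  obtain ⟨σ, hσ⟩ : ∃ σ : SF, σ = (toFld S h k).σ := ⟨_, rfl⟩
  have vφ : ∀ t x, S.φ t x = φ.1 (t, x) := fun t x => by rw [hφ]; rfl
  have vp : ∀ t x, (S.ψ t x).1 = p.1 (t, x) := fun t x => by rw [hpp]; rfl
  have vq : ∀ t x, (S.ψ t x).2 = q.1 (t, x) := fun t x => by rw [hq]; rfl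
  have vθ : ∀ t x, S.θ t x = θ.1 (t, x) := fun t x => by rw [hθ]; rfl
  have vτ : ∀ x, tT γ Pr ε χ x = τ.1 (s, x) := fun x => by
    rw [hτ, ← ev_apply]
    show _ = ev (s, x) (τf χ k)
    rw [ev_τf, tT, hk]
  have pr : Prof ε B τ σ := by rw [hτ, hσ]; exact hp
  have vσ : ∀ x ∈ Ω, tρ γ Pr ε χ x = σ.1 (s, x) := fun x hx => by
    have h1 := pr.στ s x hx
    have h2 := pr.τl s x hx
    rw [tρ, vτ, ← ev_apply, ← ev_apply]
    exact (eq_inv_of_mul_eq_one_left h1).symm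
  have vu1 : ∀ x, (tu x).1 = Yc.1 (s, x) := fun x => rfl
  have vu2 : ∀ x, (tu x).2 = (0 : SF).1 (s, x) := fun x => rfl
  have vd : ∀ x, divv (S.ψ s) x = (dX p + dY q).1 (s, x) := fun x => by
    rw [divv, d1_of (vp s), d2_of (vq s)]; rfl
  have vP : ∀ x ∈ Ω, pρ γ Pr ε χ S.φ s x * pT γ Pr ε χ S.θ s x
      = ((σ + φ) * (τ + θ)).1 (s, x) := fun x hx => by
    rw [pρ, pT, vσ x hx, vτ, vφ, vθ]; rfl
  have lp : lap (fun y => (S.ψ s y).1) x = ev (s, x) (dX (dX p) + dY (dY p)) := by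
    rw [lap, d1_of (f := dX p) (fun x => d1_of (vp s) x),
      d2_of (f := dY p) (fun x => d2_of (vp s) x), map_add]
  have lq : lap (fun y => (S.ψ s y).2) x = ev (s, x) (dX (dX q) + dY (dY q)) := by
    rw [lap, d1_of (f := dX q) (fun x => d1_of (vq s) x),
      d2_of (f := dY q) (fun x => d2_of (vq s) x), map_add]
  have lθ : lap (S.θ s) x = ev (s, x) (dX (dX θ) + dY (dY θ)) := by
    rw [lap, d1_of (f := dX θ) (fun x => d1_of (vθ s) x),
      d2_of (f := dY θ) (fun x => d2_of (vθ s) x), map_add]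
  have eqm := S.mass_eq s hs x hx
  have eq1 := S.mom_eq1 s hs x hx
  have eq2 := S.mom_eq2 s hs x hx
  have eqe := S.energy_eq s hs x hx
  simp only [defContract] at eqe
  have zYX : ev (s, x) (dX Yc) = 0 := by rw [dX_Yc, map_zero]
  have zYY : ev (s, x) (dY Yc) = 1 := by rw [dY_Yc, map_one]
  have zσ : ev (s, x) (dX σ) = 0 := by rw [pr.dXσ, map_zero]
  have zτ : ev (s, x) (dX τ) = 0 := by rw [pr.dXτ, map_zero]
  have στ1 := pr.στ1 s x hx
  have hdY := dY_dX p
  have he : (toPar γ Pr r Re ε T K).e ^ 2 = (ε ^ 2)⁻¹ := by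
    show ε⁻¹ ^ 2 = _
    rw [inv_pow]
  have hee : (ε ^ 2)⁻¹ * ε ^ 2 = 1 := inv_mul_cancel₀ (by positivity)
  have hμ : (toPar γ Pr r Re ε T K).μ = Re⁻¹ := rfl
  have hlam : (toPar γ Pr r Re ε T K).lam = Re⁻¹ + r * Re⁻¹ := rfl
  have hr : (toPar γ Pr r Re ε T K).r = r := rfl
  have hκ : (toPar γ Pr r Re ε T K).κ = γ / (γ - 1) / (Re * Pr) := rfl
  have hg : (toPar γ Pr r Re ε T K).g = 1 / (γ - 1) := rfl
  rw [he, hμ, hlam, hκ, hg]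
  simp only [Fld.mass, Fld.Q, hr, hμ]
  rw [← hφ, ← hpp, ← hq, ← hθ, ← hτ, ← hσ]
  simp only [pρ, pT, pu, dot, grad, Prod.fst_add, Prod.snd_add,
    d1_of vu1, d2_of vu1, d1_of vu2, d2_of vu2, d1_of (vφ s), d2_of (vφ s), d1_of (vp s),
    d2_of (vp s), d1_of (vq s), d2_of (vq s), d1_of (vθ s), d2_of (vθ s), d1_ofΩ vσ hx,
    d2_ofΩ vσ hx, d1_of vτ, d2_of vτ, d1_of vd, d2_of vd, lp, lq, lθ, dt_of vφ, dt_of vθ,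
    dt_of2 vp vq] at eqm eqe
  simp only [vφ, vp, vq, vθ, vτ, vσ x hx, vd, vu1, vu2] at eqm eqe
  rw [d1_ofΩ vP hx] at eq1
  rw [d2_ofΩ vP hx] at eq2
  simp only [pρ, pT, pu, dot, grad, Prod.fst_add, Prod.snd_add,
    d1_of vu1, d2_of vu1, d1_of vu2, d2_of vu2, d1_of (vφ s), d2_of (vφ s), d1_of (vp s),
    d2_of (vp s), d1_of (vq s), d2_of (vq s), d1_of (vθ s), d2_of (vθ s), d1_ofΩ vσ hx,
    d2_ofΩ vσ hx, d1_of vτ, d2_of vτ, d1_of vd, d2_of vd, lp, lq, lθ, dt_of vφ, dt_of vθ,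
    dt_of2 vp vq] at eq1 eq2
  simp only [vφ, vp, vq, vθ, vτ, vσ x hx, vd, vu1, vu2] at eq1 eq2
  simp only [← ev_apply, map_add, map_sub, map_mul, map_smul, map_zero, smul_eq_mul,
    Derivation.leibniz, zYX, zYY, zσ, zτ, hdY, ev_Yc] at eqm eq1 eq2 eqe ⊢
  refine ⟨?_, ?_, ?_, ?_⟩
  · linear_combination eqm
  · linear_combination eq1
  · linear_combination eq2 - (ε ^ 2)⁻¹ * στ1
  · clear eqm eq1 eq2 στ1 he
    generalize (ε ^ 2)⁻¹ = E at eqe hee ⊢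
    generalize ε ^ 2 = W at eqe hee
    linear_combination E * eqe
      + (2 * Re⁻¹ * (ev (s, x) (dX p) * ev (s, x) (dX p) + ev (s, x) (dY q) * ev (s, x) (dY q))
        + Re⁻¹ * ((ev (s, x) (dX q) + ev (s, x) (dY p)) * (ev (s, x) (dX q) + ev (s, x) (dY p)))
        + 2 * Re⁻¹ * (ev (s, x) (dX q) + ev (s, x) (dY p))
        + r * Re⁻¹ * ((ev (s, x) (dX p) + ev (s, x) (dY q)) * (ev (s, x) (dX p) + ev (s, x) (dY q))))
        * hee
end

/-! ### Verification of the structural hypotheses -/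

theorem sup_a (f : SF) (s : ℝ) {e b : ℝ} (he : 1 ≤ e) (hb : 0 ≤ b)
    (h0 : e ^ 2 * dSq 0 (fun x => f.1 (s, x)) ≤ b ^ 2) (h1 : dSq 1 (fun x => f.1 (s, x)) ≤ b ^ 2)
    (h2 : dSq 2 (fun x => f.1 (s, x)) ≤ e ^ 2 * b ^ 2) {x : ℝ × ℝ} (hx : x ∈ Ω) :
    |ev (s, x) f| ≤ 3 * b := by
  have hE : 0 ≤ e ^ 2 := by positivity
  have := sup_bd f s (B := b ^ 2) he ((mul_le_mul_of_nonneg_left (I_it0 f s) hE).trans h0)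
    ((I_it1 f s nrm10).trans h1) ((I_it1 f s nrm01).trans h1)
    ((I_it2 f s nrm01 nrm10).trans h2) hx
  refine abs_le_of_sq_le_sq ?_ (by positivity)
  linarith

theorem sup_b (f : SF) (s : ℝ) {e b : ℝ} (he : 1 ≤ e) (hb : 0 ≤ b) {v : ℝ × ℝ} (hv : ‖v‖ ≤ 1)
    (h0 : e ^ 2 * dSq 1 (fun x => f.1 (s, x)) ≤ b ^ 2) (h1 : dSq 2 (fun x => f.1 (s, x)) ≤ b ^ 2)
    (h2 : dSq 3 (fun x => f.1 (s, x)) ≤ e ^ 2 * b ^ 2) {x : ℝ × ℝ} (hx : x ∈ Ω) :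
    |ev (s, x) (pdv (0, v) f)| ≤ 3 * b := by
  have hE : 0 ≤ e ^ 2 := by positivity
  have := sup_bd (pdv (0, v) f) s (B := b ^ 2) he
    ((mul_le_mul_of_nonneg_left (I_it1 f s hv) hE).trans h0)
    ((I_it2 f s hv nrm10).trans h1) ((I_it2 f s hv nrm01).trans h1)
    ((I_it3 f s hv nrm01 nrm10).trans h2) hx
  refine abs_le_of_sq_le_sq ?_ (by positivity)
  linarith

section
variable {γ Pr r Re ε χ T : ℝ}

theorem dSq_p (S : PerturbSol γ Pr r Re ε χ T) (h : SmoothSol S) (k : ℝ) (j : ℕ) (s : ℝ) :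
    dSq j (fun x => (toFld S h k).p.1 (s, x)) ≤ dSq j (S.ψ s) :=
  dSq_comp h.2.1 (ContinuousLinearMap.fst ℝ ℝ ℝ) (ContinuousLinearMap.norm_fst_le ℝ ℝ ℝ) j s

theorem dSq_q (S : PerturbSol γ Pr r Re ε χ T) (h : SmoothSol S) (k : ℝ) (j : ℕ) (s : ℝ) :
    dSq j (fun x => (toFld S h k).q.1 (s, x)) ≤ dSq j (S.ψ s) :=
  dSq_comp h.2.1 (ContinuousLinearMap.snd ℝ ℝ ℝ) (ContinuousLinearMap.norm_snd_le ℝ ℝ ℝ) j s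

theorem toSys (S : PerturbSol γ Pr r Re ε χ T) (h : SmoothSol S) {k B K : ℝ}
    (hγ : 1 < γ) (hPr : 0 < Pr) (hr : 0 < 1 + r) (hRe : 0 < Re) (hε : 0 < ε) (hε1 : ε ≤ 1)
    (hk : k = ε ^ 2 * Pr / (2 * (γ / (γ - 1)))) (hB : 0 < B) (hK : K = 16 * (B + 1) ^ 2)
    (hp : Prof ε B (τf χ k) (σf χ k)) (hKε : 100 * K ≤ ε⁻¹)
    (hmean : (∫ x in Ω, S.φ 0 x) = 0) (hN : Nfun ε S.φ S.ψ S.θ T ≤ 1) :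
    Sys (toPar γ Pr r Re ε T K) (toFld S h k) := by
  have hγ1 : 0 < γ - 1 := by linarith
  have hRi : 0 < Re⁻¹ := inv_pos.2 hRe
  have hK3 : 3 ≤ K := by rw [hK]; nlinarith
  have hBK : B ≤ K := by rw [hK]; nlinarith
  have hei : ε⁻¹ * ε = 1 := inv_mul_cancel₀ hε.ne'
  have he1 : 1 ≤ ε⁻¹ := one_le_inv_iff₀.2 ⟨hε, hε1⟩
  have hee : ε⁻¹ ^ 2 * ε ^ 2 = 1 := by rw [← mul_pow, hei, one_pow]
  have hE : 0 < ε⁻¹ ^ 2 := by positivity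
  have nb := fun s (hs : s ∈ Set.Icc 0 T) => N_bounds rfl hε h.1 h.2.1 h.2.2 hN hs
  have bφ : ∀ {g : ℝ → ℝ × ℝ → ℝ} (f : SF) (_ : ∀ s, (fun x => f.1 (s, x)) = g s) (s : ℝ)
      (_ : ε⁻¹ ^ 4 * dSq 0 (g s) ≤ 1 ∧ ε⁻¹ ^ 2 * dSq 1 (g s) ≤ 1 ∧ dSq 2 (g s) ≤ 1)
      (x : ℝ × ℝ) (_ : x ∈ Ω), ε⁻¹ * |ev (s, x) f| ≤ K := by
    intro g f hf s ⟨n0, n1, n2⟩ x hx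
    have h1 := sup_a f s (e := ε⁻¹) (b := ε) he1 hε.le (by
      rw [hf]
      have : ε ^ 2 * (ε⁻¹ ^ 4 * dSq 0 (g s)) ≤ ε ^ 2 * 1 :=
        mul_le_mul_of_nonneg_left n0 (by positivity)
      calc _ = (ε⁻¹ ^ 2 * ε ^ 2) * (ε⁻¹ ^ 2 * dSq 0 (g s)) := by rw [hee, one_mul]
        _ = ε ^ 2 * (ε⁻¹ ^ 4 * dSq 0 (g s)) := by ring
        _ ≤ _ := by linarith) (by
      rw [hf]
      have : ε ^ 2 * (ε⁻¹ ^ 2 * dSq 1 (g s)) ≤ ε ^ 2 * 1 :=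
        mul_le_mul_of_nonneg_left n1 (by positivity)
      calc _ = (ε⁻¹ ^ 2 * ε ^ 2) * (dSq 1 (g s)) := by rw [hee, one_mul]
        _ = ε ^ 2 * (ε⁻¹ ^ 2 * dSq 1 (g s)) := by ring
        _ ≤ _ := by linarith) (by rw [hf, hee]; exact n2) hx
    calc _ ≤ ε⁻¹ * (3 * ε) := mul_le_mul_of_nonneg_left h1 (by positivity)
      _ = 3 * (ε⁻¹ * ε) := by ring
      _ ≤ K := by rw [hei]; linarith
  have bp0 : ∀ (f : SF) (_ : ∀ j s, dSq j (fun x => f.1 (s, x)) ≤ dSq j (S.ψ s)),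
      ∀ s ∈ Set.Icc 0 T, ∀ x ∈ Ω, |ev (s, x) f| ≤ K := by
    intro f hf s hs x hx
    obtain ⟨⟨n0, n1, n2, n3⟩, -, -⟩ := nb s hs
    have := sup_a f s (e := ε⁻¹) (b := 1) he1 zero_le_one
      (by have := mul_le_mul_of_nonneg_left (hf 0 s) hE.le; linarith)
      (by have := hf 1 s; linarith) (by have := hf 2 s; linarith) hx
    linarith
  have bp1 : ∀ (f : SF) (_ : ∀ j s, dSq j (fun x => f.1 (s, x)) ≤ dSq j (S.ψ s)) (v : ℝ × ℝ)
      (_ : ‖v‖ ≤ 1),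
      ∀ s ∈ Set.Icc 0 T, ∀ x ∈ Ω, |ev (s, x) (pdv (0, v) f)| ≤ K * ε⁻¹ := by
    intro f hf v hv s hs x hx
    obtain ⟨⟨n0, n1, n2, n3⟩, -, -⟩ := nb s hs
    have := sup_b f s (e := ε⁻¹) (b := ε⁻¹) he1 (by positivity) hv
      (by have := mul_le_mul_of_nonneg_left ((hf 1 s).trans n1) hE.le; linarith)
      ((hf 2 s).trans n2) ((hf 3 s).trans (n3.trans (le_of_eq (by ring)))) hx
    nlinarith
  have bf1 : ∀ (v : ℝ × ℝ) (_ : ‖v‖ ≤ 1),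
      ∀ s ∈ Set.Icc 0 T, ∀ x ∈ Ω, |ev (s, x) (pdv (0, v) (toFld S h k).φ)| ≤ K := by
    intro v hv s hs x hx
    obtain ⟨-, ⟨n0, n1, n2, n3⟩, -⟩ := nb s hs
    have := sup_b (toFld S h k).φ s (e := ε⁻¹) (b := 1) he1 zero_le_one hv
      (by rw [one_pow]; exact n1) (by rw [one_pow]; exact n2)
      (by rw [one_pow, mul_one]; exact n3) hx
    linarith
  have sc : ∀ {a c : ℝ}, a ≤ c * ε → c ≤ K → ε⁻¹ * a ≤ K := by
    intro a c h1 h2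
    calc _ ≤ ε⁻¹ * (c * ε) := mul_le_mul_of_nonneg_left h1 (by positivity)
      _ = c * (ε⁻¹ * ε) := by ring
      _ ≤ K := by rw [hei]; linarith
  exact
  { hμ := hRi
    hlam := by show 0 < Re⁻¹ + r * Re⁻¹; nlinarith
    hκ := by show 0 < γ / (γ - 1) / (Re * Pr); positivity
    hg := by show 0 < 1 / (γ - 1); positivity
    hK := by show 1 ≤ K; linarith
    he := hKε
    mass := fun s hs x hx => (trans_eqs (K := K) S h hε hk hp hs hx).1
    mom1 := fun s hs x hx => (trans_eqs (K := K) S h hε hk hp hs hx).2.1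
    mom2 := fun s hs x hx => (trans_eqs (K := K) S h hε hk hp hs hx).2.2.1
    ener := fun s hs x hx => (trans_eqs (K := K) S h hε hk hp hs hx).2.2.2
    dTσ := hp.dTσ
    dXσ := hp.dXσ
    dTτ := hp.dTτ
    dXτ := hp.dXτ
    perφ := fun t x y => S.periodic_φ t (x, y)
    perp := fun t x y => congrArg Prod.fst (S.periodic_ψ t (x, y))
    perq := fun t x y => congrArg Prod.snd (S.periodic_ψ t (x, y))
    perθ := fun t x y => S.periodic_θ t (x, y)
    bp := fun s hs x y hy => congrArg Prod.fst (S.bc_ψ s hs (x, y) hy)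
    bq := fun s hs x y hy => congrArg Prod.snd (S.bc_ψ s hs (x, y) hy)
    bθ := fun s hs x y hy => S.bc_θ s hs (x, y) hy
    mean := hmean
    φL2 := fun s hs => by
      obtain ⟨-, ⟨n0, n1, n2, n3⟩, -⟩ := nb s hs
      have := mul_le_mul_of_nonneg_left (I_it0 (toFld S h k).φ s)
        (show 0 ≤ ε⁻¹ ^ 4 by positivity)
      exact this.trans (n0.trans (by show 1 ≤ K; linarith))
    bdφ := fun s hs => bφ (toFld S h k).φ (fun _ => rfl) s
      ⟨(nb s hs).2.1.1, (nb s hs).2.1.2.1, (nb s hs).2.1.2.2.1⟩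
    bdθ := fun s hs => bφ (toFld S h k).θ (fun _ => rfl) s (nb s hs).2.2
    bdp := bp0 _ (dSq_p S h k)
    bdq := bp0 _ (dSq_q S h k)
    bdφ1 := bf1 _ nrm10
    bdφ2 := bf1 _ nrm01
    bdp1 := bp1 _ (dSq_p S h k) _ nrm10
    bdp2 := bp1 _ (dSq_p S h k) _ nrm01
    bdq1 := bp1 _ (dSq_q S h k) _ nrm10
    bdq2 := bp1 _ (dSq_q S h k) _ nrm01
    bdτ := fun s x hx => sc (hp.bdτ s x hx) hBK
    bdσ := fun s x hx => sc (hp.bdσ s x hx) hK.ge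
    bdτ2 := fun s x hx => sc (hp.bdτ2 s x hx) hBK
    bdσ2 := fun s x hx => sc (hp.bdσ2 s x hx) hK.ge
    bdσ22 := fun s x hx => sc (hp.bdσ22 s x hx) hK.ge }
end

/-! ### Final assembly -/

theorem opnorm2 (L : ℝ × ℝ →L[ℝ] ℝ) : ‖L‖ ≤ |L (1, 0)| + |L (0, 1)| := by
  refine L.opNorm_le_bound (by positivity) fun v => ?_
  have e : L v = v.1 * L (1, 0) + v.2 * L (0, 1) := by
    rw [← smul_eq_mul, ← smul_eq_mul, ← map_smul, ← map_smul, ← map_add]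
    congr 1
    ext <;> simp
  have h1 : |v.1| ≤ ‖v‖ := norm_fst_le v
  have h2 : |v.2| ≤ ‖v‖ := norm_snd_le v
  rw [e, Real.norm_eq_abs]
  refine (abs_add_le _ _).trans ?_
  rw [abs_mul, abs_mul]
  nlinarith [abs_nonneg (L (1, 0)), abs_nonneg (L (0, 1))]

theorem dSq1_le (f : SF) (s : ℝ) :
    dSq 1 (fun x => f.1 (s, x)) ≤ 2 * I s ((dX f) ^ 2 + (dY f) ^ 2) := by
  rw [← smul_eq_mul, ← map_smul]
  refine dSq_le_I f.smooth 1 s _ fun x _ => ?_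
  rw [norm_iteratedFDeriv_one]
  have h := opnorm2 (fderiv ℝ (fun x => f.1 (s, x)) x)
  have e1 : fderiv ℝ (fun x => f.1 (s, x)) x (1, 0) = ev (s, x) (dX f) := d1_sl f s x
  have e2 : fderiv ℝ (fun x => f.1 (s, x)) x (0, 1) = ev (s, x) (dY f) := d2_sl f s x
  rw [e1, e2] at h
  simp only [map_smul, map_add, map_pow, smul_eq_mul]
  have h0 := norm_nonneg (fderiv ℝ (fun x => f.1 (s, x)) x)
  rw [← sq_abs (ev (s, x) (dX f)), ← sq_abs (ev (s, x) (dY f))]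
  nlinarith [sq_nonneg (|ev (s, x) (dX f)| - |ev (s, x) (dY f)|)]

theorem pair_smooth (a b : SF) : ContDiff ℝ (⊤ : ℕ∞) (fun z : E3 => (a.1 z, b.1 z)) :=
  a.smooth.prodMk b.smooth

theorem pair_le (a b : SF) (s : ℝ) :
    L2Sq (fun x => (a.1 (s, x), b.1 (s, x))) ≤ I s (a ^ 2 + b ^ 2) := by
  refine dSq_le_I (pair_smooth a b) 0 s _ fun x _ => ?_
  rw [norm_iteratedFDeriv_zero, Prod.norm_def]
  simp only [map_add, map_pow, ev_apply, Real.norm_eq_abs]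
  rcases max_cases |a.1 (s, x)| |b.1 (s, x)| with h | h <;> rw [h.1, sq_abs] <;>
    nlinarith [sq_nonneg (a.1 (s, x)), sq_nonneg (b.1 (s, x))]

section
variable {γ Pr r Re ε χ T : ℝ}

theorem d1ψ (S : PerturbSol γ Pr r Re ε χ T) (h : SmoothSol S) (k : ℝ) (s : ℝ) :
    d1 (S.ψ s) = fun x => ((dX (toFld S h k).p).1 (s, x), (dX (toFld S h k).q).1 (s, x)) := by
  funext x
  have hd : ∀ f : SF, DifferentiableAt ℝ (fun x : ℝ × ℝ => f.1 (s, x)) x := fun f =>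
    (f.diff (s, x)).comp x (hasFDerivAt_prodMk_right s x).differentiableAt
  have h1 := (hd (toFld S h k).p).hasFDerivAt
  have h2 := (hd (toFld S h k).q).hasFDerivAt
  have h3 : fderiv ℝ (S.ψ s) x = _ := (h1.prodMk h2).fderiv
  rw [d1, h3]
  exact Prod.ext (d1_sl (toFld S h k).p s x) (d1_sl (toFld S h k).q s x)

theorem gradD (S : PerturbSol γ Pr r Re ε χ T) (h : SmoothSol S) (k : ℝ) (s : ℝ) :
    grad (divv (S.ψ s)) =
      fun x => ((dX (toFld S h k).D).1 (s, x), (dY (toFld S h k).D).1 (s, x)) := by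
  have vd : ∀ x, divv (S.ψ s) x = (toFld S h k).D.1 (s, x) := fun x => by
    have e1 : d1 (fun y => (S.ψ s y).1) x = _ := d1_sl (toFld S h k).p s x
    have e2 : d2 (fun y => (S.ψ s y).2) x = _ := d2_sl (toFld S h k).q s x
    rw [divv, e1, e2]; rfl
  funext x
  rw [grad, d1_of vd, d2_of vd]; rfl

theorem lhs_le (S : PerturbSol γ Pr r Re ε χ T) (h : SmoothSol S) (k K : ℝ) {t : ℝ} (ht : 0 ≤ t) :
    (ε ^ 2)⁻¹ * dSq 1 (S.φ t) + L2Sq (d1 (S.ψ t))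
        + (∫ s in (0 : ℝ)..t, L2Sq (grad (divv (S.ψ s))))
      ≤ 2 * ((toPar γ Pr r Re ε T K).e ^ 2 * I t (toFld S h k).gφ
        + (I t ((dX (toFld S h k).p) ^ 2) + I t ((dX (toFld S h k).q) ^ 2))
        + J t ((dX (toFld S h k).D) ^ 2 + (dY (toFld S h k).D) ^ 2)) := by
  have he : (toPar γ Pr r Re ε T K).e ^ 2 = (ε ^ 2)⁻¹ := by
    show ε⁻¹ ^ 2 = _
    rw [inv_pow]
  have h1 : dSq 1 (S.φ t) ≤ 2 * I t (toFld S h k).gφ := dSq1_le (toFld S h k).φ t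
  have h2 := pair_le (dX (toFld S h k).p) (dX (toFld S h k).q) t
  rw [← d1ψ S h k, map_add] at h2
  have h3 : (∫ s in (0 : ℝ)..t, L2Sq (grad (divv (S.ψ s))))
      ≤ J t ((dX (toFld S h k).D) ^ 2 + (dY (toFld S h k).D) ^ 2) := by
    rw [J_apply]
    simp only [gradD S h k]
    refine intervalIntegral.integral_mono_on ht ?_ ?_ fun s _ => pair_le _ _ s
    · exact (L2Sq_c (ψ := fun s x => ((dX (toFld S h k).D).1 (s, x),
        (dY (toFld S h k).D).1 (s, x))) (pair_smooth _ _)).intervalIntegrable _ _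
    · exact (I_cont _).intervalIntegrable _ _
  have h4 := mul_le_mul_of_nonneg_left h1 (show 0 ≤ (ε ^ 2)⁻¹ by positivity)
  have h5 := I_sq_nonneg t (dX (toFld S h k).p)
  have h6 := I_sq_nonneg t (dX (toFld S h k).q)
  have h7 : 0 ≤ J t ((dX (toFld S h k).D) ^ 2 + (dY (toFld S h k).D) ^ 2) := by
    rw [map_add]
    exact add_nonneg (J_sq_nonneg ht _) (J_sq_nonneg ht _)
  rw [he]
  linarith

theorem rhs_ge (S : PerturbSol γ Pr r Re ε χ T) (h : SmoothSol S) (k K : ℝ) (hε : 0 < ε)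
    {t : ℝ} (ht : 0 ≤ t) :
    Rq (toPar γ Pr r Re ε T K) (toFld S h k) t ≤
      4 * ((ε ^ 2)⁻¹ * HSq 1 (S.φ 0) + L2Sq (d1 (S.ψ 0))
                    + A1 ε S.φ S.ψ S.θ 0 + (ε ^ 2)⁻¹ * A0 ε S.φ S.ψ S.θ 0
                    + (ε ^ 2)⁻¹ * ∫ s in (0 : ℝ)..t, dSq 1 (S.φ s)) := by
  have he : (toPar γ Pr r Re ε T K).e ^ 2 = (ε ^ 2)⁻¹ := by
    show ε⁻¹ ^ 2 = _
    rw [inv_pow]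
  have hE : 0 ≤ (ε ^ 2)⁻¹ := by positivity
  have hH : HSq 1 (S.φ 0) = dSq 0 (S.φ 0) + dSq 1 (S.φ 0) := by
    simp [HSq, Finset.sum_range_succ]
  have gφ : ∀ s, I s (toFld S h k).gφ ≤ 2 * dSq 1 (S.φ s) := fun s => by
    have h1 : I s ((dX (toFld S h k).φ) ^ 2) ≤ dSq 1 (S.φ s) := I_it1 (toFld S h k).φ s nrm10
    have h2 : I s ((dY (toFld S h k).φ) ^ 2) ≤ dSq 1 (S.φ s) := I_it1 (toFld S h k).φ s nrm01
    rw [Fld.gφ, map_add]; linarith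
  have gθ : I 0 (toFld S h k).gθ ≤ 2 * dSq 1 (S.θ 0) := by
    have h1 : I 0 ((dX (toFld S h k).θ) ^ 2) ≤ dSq 1 (S.θ 0) := I_it1 (toFld S h k).θ 0 nrm10
    have h2 : I 0 ((dY (toFld S h k).θ) ^ 2) ≤ dSq 1 (S.θ 0) := I_it1 (toFld S h k).θ 0 nrm01
    rw [Fld.gθ, map_add]; linarith
  have gψ : I 0 (toFld S h k).gψ ≤ 4 * dSq 1 (S.ψ 0) := by
    have h1 := (I_it1 (toFld S h k).p 0 nrm10).trans (dSq_p S h k 1 0)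
    have h2 := (I_it1 (toFld S h k).p 0 nrm01).trans (dSq_p S h k 1 0)
    have h3 := (I_it1 (toFld S h k).q 0 nrm10).trans (dSq_q S h k 1 0)
    have h4 := (I_it1 (toFld S h k).q 0 nrm01).trans (dSq_q S h k 1 0)
    have : I 0 (toFld S h k).gψ = I 0 ((pdv (0, (1, 0)) (toFld S h k).p) ^ 2)
        + I 0 ((pdv (0, (0, 1)) (toFld S h k).p) ^ 2) + I 0 ((pdv (0, (1, 0)) (toFld S h k).q) ^ 2)
        + I 0 ((pdv (0, (0, 1)) (toFld S h k).q) ^ 2) := by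
      rw [Fld.gψ, map_add, map_add, map_add]; rfl
    linarith
  have hX : I 0 ((toFld S h k).X0 (toPar γ Pr r Re ε T K)) ≤
      2 * L2Sq (S.ψ 0) + (ε ^ 2)⁻¹ * L2Sq (S.φ 0) + (ε ^ 2)⁻¹ * L2Sq (S.θ 0) := by
    have h1 : _ ≤ L2Sq (S.ψ 0) := (I_it0 (toFld S h k).p 0).trans (dSq_p S h k 0 0)
    have h2 : _ ≤ L2Sq (S.ψ 0) := (I_it0 (toFld S h k).q 0).trans (dSq_q S h k 0 0)
    have h3 : I 0 ((toFld S h k).φ ^ 2) ≤ L2Sq (S.φ 0) := I_it0 (toFld S h k).φ 0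
    have h4 : I 0 ((toFld S h k).θ ^ 2) ≤ L2Sq (S.θ 0) := I_it0 (toFld S h k).θ 0
    have h5 := mul_le_mul_of_nonneg_left h3 hE
    have h6 := mul_le_mul_of_nonneg_left h4 hE
    rw [Fld.X0, he]
    simp only [map_add, map_smul, smul_eq_mul]
    linarith
  have hJ : J t (toFld S h k).gφ ≤ 2 * ∫ s in (0 : ℝ)..t, dSq 1 (S.φ s) := by
    rw [J_apply, ← intervalIntegral.integral_const_mul]
    exact intervalIntegral.integral_mono_on ht ((I_cont _).intervalIntegrable _ _)
      ((continuous_const.mul (dSq_c h.1 1)).intervalIntegrable _ _) fun s _ => gφ s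
  have a0 := A0_ge (ε := ε) h.1 h.2.1 h.2.2 (Set.left_mem_Icc.2 le_rfl : (0 : ℝ) ∈ Set.Icc (0:ℝ) 0)
  have a1 := A1_ge (ε := ε) (φ := S.φ) h.2.1 h.2.2
    (Set.left_mem_Icc.2 le_rfl : (0 : ℝ) ∈ Set.Icc (0:ℝ) 0)
  have n1 := L2Sq_nonneg (S.ψ 0)
  have n2 := L2Sq_nonneg (S.φ 0)
  have n3 := L2Sq_nonneg (S.θ 0)
  have n4 := L2Sq_nonneg (d1 (S.ψ 0))
  have n5 := dSq_nonneg 0 (S.φ 0)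
  have n6 := dSq_nonneg 1 (S.φ 0)
  have n7 := dSq_nonneg 1 (S.ψ 0)
  have n8 := dSq_nonneg 1 (S.θ 0)
  have n9 : 0 ≤ ∫ s in (0 : ℝ)..t, dSq 1 (S.φ s) :=
    int_nn (fun s => dSq_nonneg 1 (S.φ s)) ht
  have m1 := mul_le_mul_of_nonneg_left gθ hE
  have m2 := mul_le_mul_of_nonneg_left (hX.trans (show _ ≤ 2 * A0 ε S.φ S.ψ S.θ 0 by
    have := mul_nonneg hE n2
    have := mul_nonneg hE n3
    linarith)) hE
  have m3 := mul_le_mul_of_nonneg_left (gφ 0) hE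
  have m4 := mul_le_mul_of_nonneg_left hJ hE
  have m5 := mul_nonneg hE n5
  have m6 := mul_nonneg hE n6
  have m8 := mul_nonneg hE n8
  have m9 := mul_nonneg hE n9
  have m7 : 0 ≤ (ε ^ 2)⁻¹ * A0 ε S.φ S.ψ S.θ 0 := mul_nonneg hE (le_trans (by
    have := mul_nonneg hE n2
    have := mul_nonneg hE n3
    linarith) a0)
  rw [Rq, he, hH, mul_add]
  linarith
end

theorem final_est (γ Pr r Kχ : ℝ)
    (hγ : 1 < γ) (hPr : 0 < Pr) (hr : 0 < 1 + r) (hK : 0 < Kχ) :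
    ∃ Re₀ ε₁ : ℝ, 0 < Re₀ ∧ 0 < ε₁ ∧ ∀ Re : ℝ, 0 < Re → Re < Re₀ → ∃ C : ℝ, 0 < C ∧
          ∀ (ε χ T : ℝ) (S : PerturbSol γ Pr r Re ε χ T),
            0 < ε → ε ≤ 1 → ε < ε₁ → 0 < χ → |1 - χ| ≤ Kχ * ε → |1 - χ| ≤ 1 / 2 →
            0 ≤ T → SmoothSol S → StdHyp S → Nfun ε S.φ S.ψ S.θ T ≤ 1 →
            ∀ t ∈ Set.Icc (0 : ℝ) T,
              (ε ^ 2)⁻¹ * dSq 1 (S.φ t) + L2Sq (d1 (S.ψ t))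
                  + (∫ s in (0 : ℝ)..t, L2Sq (grad (divv (S.ψ s))))
                ≤ C * ((ε ^ 2)⁻¹ * HSq 1 (S.φ 0) + L2Sq (d1 (S.ψ 0))
                    + A1 ε S.φ S.ψ S.θ 0 + (ε ^ 2)⁻¹ * A0 ε S.φ S.ψ S.θ 0
                    + (ε ^ 2)⁻¹ * ∫ s in (0 : ℝ)..t, dSq 1 (S.φ s)) := by
  have hγ1 : 0 < γ - 1 := by linarith
  obtain ⟨B, hB⟩ : ∃ B, B = Kχ + Pr := ⟨_, rfl⟩
  obtain ⟨K, hKB⟩ : ∃ K, K = 16 * (B + 1) ^ 2 := ⟨_, rfl⟩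
  have hB0 : 0 < B := by linarith
  have hK1 : 1 ≤ K := by rw [hKB]; nlinarith
  obtain ⟨c, hc⟩ : ∃ c, c = min 1 (γ / (γ - 1) / Pr) := ⟨_, rfl⟩
  have hc0 : 0 < c := by rw [hc]; exact lt_min one_pos (by positivity)
  have hc1 : c ≤ 1 := by rw [hc]; exact min_le_left _ _
  have hc2 : c ≤ γ / (γ - 1) / Pr := by rw [hc]; exact min_le_right _ _
  obtain ⟨M, hM⟩ : ∃ M, M = 20 + 40 * K + 4 * (1 / (γ - 1)) * K := ⟨_, rfl⟩
  have hg : 0 < 1 / (γ - 1) := by positivity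
  have hM0 : 0 < M := by rw [hM]; positivity
  obtain ⟨N, hN⟩ : ∃ N, N = (1 + (1 + r) + |r|) * K := ⟨_, rfl⟩
  have hN0 : 0 < N := by rw [hN]; positivity
  refine ⟨c / (80 * M), min (1 / (100 * K)) (c / (3200 * N)), by positivity,
    lt_min (by positivity) (by positivity), fun Re hRe hRe0 => ?_⟩
  have hRi : 0 < Re⁻¹ := inv_pos.2 hRe
  have hpos : Pos (toPar γ Pr r Re 1 0 K) := ⟨hK1, hRi, by
    show 0 < Re⁻¹ + r * Re⁻¹
    nlinarith, hg, by show 0 < γ / (γ - 1) / (Re * Pr); positivity⟩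
  obtain ⟨C, hC0, hC⟩ := ub_final hpos
  refine ⟨8 * C + 1, by linarith, ?_⟩
  intro ε χ T S hε hε1 hεs hχ hχK hχ2 hT h hstd hNf t ht
  have hεa : ε ≤ 1 / (100 * K) := hεs.le.trans (min_le_left _ _)
  have hεb : ε ≤ c / (3200 * N) := hεs.le.trans (min_le_right _ _)
  have hKε : 100 * K ≤ ε⁻¹ := by
    rw [le_inv_comm₀ (by positivity) hε, ← one_div]; exact hεa
  obtain ⟨k, hk⟩ : ∃ k, k = ε ^ 2 * Pr / (2 * (γ / (γ - 1))) := ⟨_, rfl⟩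
  have hk0 : 0 ≤ k := by rw [hk]; positivity
  have hk1 : 2 * k ≤ Pr * ε := by
    have hq : 1 ≤ γ / (γ - 1) := by rw [le_div_iff₀ hγ1]; linarith
    have : 2 * k = ε ^ 2 * Pr / (γ / (γ - 1)) := by rw [hk]; field_simp
    rw [this, div_le_iff₀ (by linarith)]
    have h1 : ε ^ 2 * Pr ≤ Pr * ε := by nlinarith [mul_pos hPr hε]
    have h2 : 0 < Pr * ε := mul_pos hPr hε
    nlinarith
  have hp := prof hε hε1 hK hχK hχ2 hk0 hk1 hPr hB
  have hsys := toSys S h hγ hPr hr hRe hε hε1 hk hB0 hKB hp hKε hstd.2.2.2.1 hNf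
  have hM0' : 40 * M0 (toPar γ Pr r Re ε T K) ≤ c * Re⁻¹ := by
    have e : M0 (toPar γ Pr r Re ε T K)
        = M + 40 * ((Re⁻¹ + (Re⁻¹ + r * Re⁻¹) + |r| * Re⁻¹) * (K / ε⁻¹)) := by rw [hM]; rfl
    have e2 : M0 (toPar γ Pr r Re ε T K) = M + 40 * (N * ε) * Re⁻¹ := by
      rw [e, hN, div_inv_eq_mul]; ring
    have h1 : 80 * M ≤ c * Re⁻¹ := by
      rw [lt_div_iff₀ (by positivity)] at hRe0
      rw [← div_eq_mul_inv, le_div_iff₀ hRe]; linarith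
    have h2 : 3200 * (N * ε) ≤ c := by
      rw [le_div_iff₀ (by positivity)] at hεb; linarith
    have h3 := mul_le_mul_of_nonneg_right h2 hRi.le
    rw [e2]; linarith
  have hadm : Adm (toPar γ Pr r Re 1 0 K) (toPar γ Pr r Re ε T K) (toFld S h k) :=
    ⟨hsys, rfl, rfl, rfl, rfl, rfl, rfl, hM0'.trans (by show _ ≤ Re⁻¹; nlinarith),
      hM0'.trans (by
        show _ ≤ γ / (γ - 1) / (Re * Pr)
        have : γ / (γ - 1) / (Re * Pr) = γ / (γ - 1) / Pr * Re⁻¹ := by field_simp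
        rw [this]
        exact mul_le_mul_of_nonneg_right hc2 hRi.le)⟩
  have f1 := hC _ _ hadm t ht
  have f2 := lhs_le S h k K ht.1
  have f3 := rhs_ge S h k K hε ht.1
  have f4 := mul_le_mul_of_nonneg_left f3 hC0
  have f5 : 0 ≤ Rq (toPar γ Pr r Re ε T K) (toFld S h k) t :=
    (Rq_parts _ _ ht.1).1
  refine f2.trans ?_
  refine (mul_le_mul_of_nonneg_left (f1.trans f4) (by norm_num : (0:ℝ) ≤ 2)).trans ?_
  linarith

/-- estimate for `∇φ`, `∂₁ψ` and `∇div ψ`. -/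
theorem gradient_density_estimate (γ Pr r Kχ : ℝ)
    (hγ : 1 < γ) (hPr : 0 < Pr) (hr : 0 < 1 + r) (hK : 0 < Kχ) :
    ∃ Re₀ ε₁ : ℝ, 0 < Re₀ ∧ 0 < ε₁ ∧
      ∀ Re : ℝ, 0 < Re → Re < Re₀ →
        ∃ C : ℝ, 0 < C ∧
          ∀ (ε χ T : ℝ) (S : PerturbSol γ Pr r Re ε χ T),
            0 < ε → ε ≤ 1 → ε < ε₁ → 0 < χ → |1 - χ| ≤ Kχ * ε → |1 - χ| ≤ 1 / 2 →
            0 ≤ T → SmoothSol S → StdHyp S → Nfun ε S.φ S.ψ S.θ T ≤ 1 →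
            ∀ t ∈ Set.Icc (0 : ℝ) T,
              (ε ^ 2)⁻¹ * dSq 1 (S.φ t) + L2Sq (d1 (S.ψ t))
                  + (∫ s in (0 : ℝ)..t, L2Sq (grad (divv (S.ψ s))))
                ≤ C * ((ε ^ 2)⁻¹ * HSq 1 (S.φ 0) + L2Sq (d1 (S.ψ 0))
                    + A1 ε S.φ S.ψ S.θ 0 + (ε ^ 2)⁻¹ * A0 ε S.φ S.ψ S.θ 0
                    + (ε ^ 2)⁻¹ * ∫ s in (0 : ℝ)..t, dSq 1 (S.φ s)) := by
  exact final_est γ Pr r Kχ hγ hPr hr hK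
end Couette
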